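/- Let ρ ∈ (0, 1). There exists a constant c_ρ > 0 depending only on ρ such that: for each n, if the martingale differences (X_i)_{1≤i≤n} satisfy conditions (A1), (A2) (with exponent ρ), and (A4) (with the same ρ), and (x_n) is a sequence with x_n ≥ 0 and x_n γ_n → 0 (i.e. x_n = o(γ_n^{-1})), then for all sufficiently large n, P(W_n ≥ x_n)/(1 − Φ(x_n)) ≤ exp{ c_ρ ( x_n^{2+ρ} ε_n^ρ + x_n² δ_n² + (1 + x_n)( x_n^ρ γ_n^ρ + γ_n^ρ + δ_n + ε̂_n(x_n, ρ) ) ) }, where ε̂_n(x, ρ) = ε_n^{ρ(2−ρ)/4} / (1 + x^{ρ(2+ρ)/4}). The same upper bound holds with P(W_n ≥ x_n)/(1 − Φ(x_n)) replaced by P(W_n ≤ −x_n)/Φ(−x_n). -/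

import Mathlib

open MeasureTheory Filter
open scoped Topology ENNReal

noncomputable def stdNormalCDF (x : ℝ) : ℝ :=
  (Real.sqrt (2 * Real.pi))⁻¹ * ∫ t in Set.Iic x, Real.exp (-(t ^ 2) / 2)

/-- A finite sequence of square-integrable martingale differences
`X 1, ..., X n` adapted to a filtration `F 0 ⊆ F 1 ⊆ ... ⊆ F n`, with
`F 0` trivial, `E[X i | F (i-1)] = 0` and `0 < E[(X i)^2] < ∞`. -/
structure MDS (Ω : Type) [mΩ : MeasurableSpace Ω] (P : Measure Ω) where
  n : ℕ
  npos : 0 < n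
  F : ℕ → MeasurableSpace Ω
  F_mono : Monotone F
  F_le : ∀ i, F i ≤ mΩ
  F_zero : F 0 = ⊥
  X : ℕ → Ω → ℝ
  meas : ∀ i, 1 ≤ i → i ≤ n → StronglyMeasurable[F i] (X i)
  sq_int : ∀ i, 1 ≤ i → i ≤ n → Integrable (fun ω => (X i ω) ^ 2) P
  mean_zero : ∀ i, 1 ≤ i → i ≤ n → P[X i|F (i - 1)] =ᵐ[P] 0
  var_pos : ∀ i, 1 ≤ i → i ≤ n → 0 < ∫ ω, (X i ω) ^ 2 ∂P

namespace MDS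

variable {Ω : Type} [mΩ : MeasurableSpace Ω] {P : Measure Ω}

/-- `S_n = ∑_{i=1}^n X_i`. -/
noncomputable def S (A : MDS Ω P) : Ω → ℝ := fun ω => ∑ i ∈ Finset.Icc 1 A.n, A.X i ω

/-- `B_n² = ∑_{i=1}^n E[X_i²]`. -/
noncomputable def Bsq (A : MDS Ω P) : ℝ := ∑ i ∈ Finset.Icc 1 A.n, ∫ ω, (A.X i ω) ^ 2 ∂P

/-- `[S]_n = ∑_{i=1}^n X_i²`. -/
noncomputable def QV (A : MDS Ω P) : Ω → ℝ := fun ω => ∑ i ∈ Finset.Icc 1 A.n, (A.X i ω) ^ 2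

/-- `⟨S⟩_n = ∑_{i=1}^n E[X_i² | F_{i-1}]`. -/
noncomputable def CV (A : MDS Ω P) : Ω → ℝ :=
  fun ω => ∑ i ∈ Finset.Icc 1 A.n, (P[fun ω' => (A.X i ω') ^ 2|A.F (i - 1)]) ω

/-- `W_n = S_n / √[S]_n`. -/
noncomputable def W (A : MDS Ω P) : Ω → ℝ := fun ω => A.S ω / Real.sqrt (A.QV ω)

/-- Condition (A1): `|⟨S⟩_n − B_n²| ≤ δ² B_n²` a.s., with `δ ∈ [0, 1/4]`. -/
def CondA1 (A : MDS Ω P) (δ : ℝ) : Prop :=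
  0 ≤ δ ∧ δ ≤ 1 / 4 ∧ ∀ᵐ ω ∂P, |A.CV ω - A.Bsq| ≤ δ ^ 2 * A.Bsq

/-- Condition (A2): `∑_{i=1}^n E[|X_i|^{2+ρ} | F_{i-1}] ≤ ε^ρ B_n^{2+ρ}` a.s.,
with `ε ∈ (0, 1/4]`. -/
def CondA2 (A : MDS Ω P) (ρ ε : ℝ) : Prop :=
  0 < ε ∧ ε ≤ 1 / 4 ∧
    (∀ i, 1 ≤ i → i ≤ A.n → Integrable (fun ω => |A.X i ω| ^ (2 + ρ)) P) ∧
    ∀ᵐ ω ∂P,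
      ∑ i ∈ Finset.Icc 1 A.n, (P[fun ω' => |A.X i ω'| ^ (2 + ρ)|A.F (i - 1)]) ω ≤
        ε ^ ρ * A.Bsq ^ ((2 + ρ) / 2)

/-- Condition (A3): `E[X_i² | F_{i-1}] ≤ κ² B_n²` a.s. for each `i`, with `κ ∈ (0, 1/4]`. -/
def CondA3 (A : MDS Ω P) (κ : ℝ) : Prop :=
  0 < κ ∧ κ ≤ 1 / 4 ∧
    ∀ i, 1 ≤ i → i ≤ A.n →
      ∀ᵐ ω ∂P, (P[fun ω' => (A.X i ω') ^ 2|A.F (i - 1)]) ω ≤ κ ^ 2 * A.Bsq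

/-- Condition (A4): `E[|X_i|^{2+ρ} | F_{i-1}] ≤ (γ B_n)^ρ E[X_i² | F_{i-1}]` a.s.
for each `i`, with `γ ∈ (0, 1/4]`. -/
def CondA4 (A : MDS Ω P) (ρ γ : ℝ) : Prop :=
  0 < γ ∧ γ ≤ 1 / 4 ∧
    (∀ i, 1 ≤ i → i ≤ A.n → Integrable (fun ω => |A.X i ω| ^ (2 + ρ)) P) ∧
    ∀ i, 1 ≤ i → i ≤ A.n →
      ∀ᵐ ω ∂P,
        (P[fun ω' => |A.X i ω'| ^ (2 + ρ)|A.F (i - 1)]) ω ≤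
          (γ * Real.sqrt A.Bsq) ^ ρ * (P[fun ω' => (A.X i ω') ^ 2|A.F (i - 1)]) ω

end MDS

namespace SNC
open MeasureTheory Filter ProbabilityTheory
open scoped Topology ENNReal NNReal

/-- the standard normal density -/
noncomputable def phi (x : ℝ) : ℝ := (Real.sqrt (2 * Real.pi))⁻¹ * Real.exp (-(x ^ 2) / 2)

/-- standard Gaussian measure -/
noncomputable abbrev gam : Measure ℝ := gaussianReal 0 1

lemma phi_eq (x : ℝ) : phi x = gaussianPDFReal 0 1 x := by
  simp [phi, gaussianPDFReal]

lemma phi_pos (x : ℝ) : 0 < phi x := by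
  rw [phi_eq]; exact gaussianPDFReal_pos _ _ _ one_ne_zero

lemma phi_integrable : Integrable phi := by
  have := integrable_gaussianPDFReal 0 1
  simpa [funext phi_eq] using this

lemma phi_cont : Continuous phi := by unfold phi; fun_prop

lemma integral_phi : ∫ x, phi x = 1 := by
  have := integral_gaussianPDFReal_eq_one 0 (v := 1) one_ne_zero
  simpa [funext phi_eq] using this

lemma sqrt_two_pi_ge : 2 ≤ Real.sqrt (2 * Real.pi) := by
  apply Real.le_sqrt_of_sq_le; nlinarith [Real.pi_gt_three]

lemma sqrt_two_pi_le : Real.sqrt (2 * Real.pi) ≤ 3 := by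
  rw [Real.sqrt_le_left (by norm_num)]; nlinarith [Real.pi_lt_four]

lemma phi_le_half (x : ℝ) : phi x ≤ 1 / 2 := by
  unfold phi
  have h1 : (Real.sqrt (2 * Real.pi))⁻¹ ≤ 1 / 2 := by
    rw [inv_le_comm₀ (by linarith [sqrt_two_pi_ge]) (by norm_num)]
    simpa using sqrt_two_pi_ge
  have h2 : Real.exp (-(x ^ 2) / 2) ≤ 1 := by
    rw [Real.exp_le_one_iff]; nlinarith [sq_nonneg x]
  have := Real.exp_pos (-(x ^ 2) / 2)
  nlinarith

lemma phi_le_one (x : ℝ) : phi x ≤ 1 := by linarith [phi_le_half x]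

lemma cdf_eq (x : ℝ) : stdNormalCDF x = ∫ t in Set.Iic x, phi t := by
  unfold stdNormalCDF phi
  rw [integral_const_mul]

lemma gam_real (s : Set ℝ) : gam.real s = ∫ t in s, phi t := by
  rw [measureReal_def, gaussianReal_apply_eq_integral 0 one_ne_zero,
    ENNReal.toReal_ofReal]
  · simp [phi_eq]
  · exact integral_nonneg fun x => gaussianPDFReal_nonneg _ _ _

lemma gam_integral (f : ℝ → ℝ) : ∫ x, f x ∂gam = ∫ x, phi x * f x := by
  rw [integral_gaussianReal_eq_integral_smul one_ne_zero]
  simp [phi_eq]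

lemma gam_Iic (x : ℝ) : gam.real (Set.Iic x) = stdNormalCDF x := by
  rw [gam_real, cdf_eq]

lemma cdf_nonneg (x : ℝ) : 0 ≤ stdNormalCDF x := by rw [← gam_Iic]; positivity

lemma cdf_le_one (x : ℝ) : stdNormalCDF x ≤ 1 := by rw [← gam_Iic]; exact measureReal_le_one

lemma cdf_mono : Monotone stdNormalCDF := by
  intro x y h
  rw [← gam_Iic, ← gam_Iic]
  exact measureReal_mono (Set.Iic_subset_Iic.2 h)

lemma gam_Ioi (x : ℝ) : gam.real (Set.Ioi x) = 1 - stdNormalCDF x := by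
  rw [← gam_Iic, ← Set.compl_Iic, probReal_compl_eq_one_sub measurableSet_Iic]

lemma cdf_sub {a b : ℝ} (h : a ≤ b) : stdNormalCDF b - stdNormalCDF a = ∫ t in Set.Ioc a b, phi t := by
  rw [cdf_eq, cdf_eq, intervalIntegral.integral_Iic_sub_Iic phi_integrable.integrableOn
    phi_integrable.integrableOn, intervalIntegral.integral_of_le h]

lemma gam_Icc {a b : ℝ} (h : a ≤ b) : gam.real (Set.Icc a b) = stdNormalCDF b - stdNormalCDF a := by
  rw [cdf_sub h, gam_real, integral_Icc_eq_integral_Ioc]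

lemma cdf_deriv (x : ℝ) : HasDerivAt stdNormalCDF (phi x) x := by
  have h : stdNormalCDF = fun y => (∫ t in (0:ℝ)..y, phi t) + stdNormalCDF 0 := by
    funext y
    rw [cdf_eq, cdf_eq, ← intervalIntegral.integral_Iic_sub_Iic phi_integrable.integrableOn
      phi_integrable.integrableOn]; ring
  rw [h]
  refine HasDerivAt.add_const _ ?_
  exact intervalIntegral.integral_hasDerivAt_right (phi_integrable.intervalIntegrable)
    (phi_cont.stronglyMeasurableAtFilter _ _) phi_cont.continuousAt

lemma cdf_cont : Continuous stdNormalCDF :=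
  continuous_iff_continuousAt.2 fun x => (cdf_deriv x).continuousAt

lemma cdf_lip {a b : ℝ} (h : a ≤ b) : stdNormalCDF b - stdNormalCDF a ≤ b - a := by
  rw [cdf_sub h]
  calc ∫ t in Set.Ioc a b, phi t ≤ ∫ t in Set.Ioc a b, (1:ℝ) := by
        refine setIntegral_mono phi_integrable.integrableOn ?_ phi_le_one
        simp
    _ = b - a := by simp [h]

lemma cdf_neg (x : ℝ) : stdNormalCDF (-x) = 1 - stdNormalCDF x := by
  rw [← gam_Ioi, gam_real, cdf_eq, ← integral_comp_neg_Ioi x phi]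
  apply setIntegral_congr_fun measurableSet_Ioi
  intro t _; simp [phi]

/-- Lower Mills bound. -/
lemma mills_lower {x : ℝ} (hx : 0 ≤ x) :
    Real.exp (-(x ^ 2) / 2) ≤ 15 * (1 + x) * (1 - stdNormalCDF x) := by
  have hx1 : 0 < 1 + x := by linarith
  set y := x + 1 / (1 + x) with hy
  have hxy : x ≤ y := by rw [hy]; have : 0 ≤ 1 / (1 + x) := by positivity
                         linarith
  have h1 : stdNormalCDF y - stdNormalCDF x ≤ 1 - stdNormalCDF x := by linarith [cdf_le_one y]
  have hyb : y ^ 2 ≤ x ^ 2 + 3 := by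
    have h2 : 1 / (1 + x) ≤ 1 := by rw [div_le_one hx1]; linarith
    have h3 : x * (1 / (1 + x)) ≤ 1 := by rw [mul_one_div, div_le_one hx1]; linarith
    have h4 : 0 ≤ 1 / (1 + x) := by positivity
    rw [hy]; nlinarith
  have h5 : (1 / (1 + x)) * ((1/3) * (Real.exp (-(x ^ 2) / 2) * Real.exp (-(3/2)))) ≤
      stdNormalCDF y - stdNormalCDF x := by
    rw [cdf_sub hxy]
    have : ∫ t in Set.Ioc x y, ((1/3) * (Real.exp (-(x ^ 2) / 2) * Real.exp (-(3/2)))) ≤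
        ∫ t in Set.Ioc x y, phi t := by
      refine setIntegral_mono_on (integrable_const _) phi_integrable.integrableOn measurableSet_Ioc ?_
      intro t ht
      unfold phi
      rw [← Real.exp_add]
      gcongr
      · rw [one_div]
        exact inv_anti₀ (by linarith [sqrt_two_pi_ge]) sqrt_two_pi_le
      · have : t ^ 2 ≤ y ^ 2 := by
          apply pow_le_pow_left₀ (by linarith [ht.1]) ht.2
        linarith
    rw [setIntegral_const] at this
    simp only [measureReal_def, Real.volume_Ioc] at this
    rw [ENNReal.toReal_ofReal (by linarith)] at this
    have hyx : y - x = 1 / (1 + x) := by rw [hy]; ring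
    rw [hyx] at this
    simpa using this
  have h6 : (1:ℝ)/5 ≤ Real.exp (-(3/2)) := by
    rw [Real.exp_neg, one_div]
    apply inv_anti₀ (Real.exp_pos _)
    have : Real.exp (3/2) = (Real.exp (1/2)) ^ 3 := by
      rw [← Real.exp_nat_mul]; norm_num
    have h7 : Real.exp (1/2) ^ 2 = Real.exp 1 := by rw [← Real.exp_nat_mul]; norm_num
    have h8 := Real.exp_one_lt_d9
    have h9 : Real.exp (1/2) ≤ 1.65 := by
      have := Real.exp_pos (1/2)
      nlinarith
    rw [this]
    have := Real.exp_pos (1/2)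
    calc Real.exp (1/2) ^ 3 ≤ 1.65 ^ 3 := by gcongr
      _ ≤ 5 := by norm_num
  have he := Real.exp_pos (-(x ^ 2) / 2)
  have h10 : (1 / (1 + x)) * ((1/3) * (Real.exp (-(x ^ 2) / 2) * (1/5))) ≤ 1 - stdNormalCDF x := by
    refine le_trans ?_ (h5.trans h1)
    gcongr
  have h11 : (1 / (1 + x)) * ((1/3) * (Real.exp (-(x ^ 2) / 2) * (1/5))) =
    Real.exp (-(x ^ 2) / 2) / (15 * (1 + x)) := by field_simp; norm_num
  rw [h11, div_le_iff₀ (by positivity)] at h10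
  linarith

lemma one_sub_cdf_pos (x : ℝ) : 0 < 1 - stdNormalCDF x := by
  rcases le_total 0 x with h | h
  · have := mills_lower h
    have he := Real.exp_pos (-(x ^ 2) / 2)
    by_contra hc
    push Not at hc
    have : 15 * (1 + x) * (1 - stdNormalCDF x) ≤ 0 :=
      mul_nonpos_of_nonneg_of_nonpos (by positivity) hc
    linarith
  · have h0 := mills_lower (le_refl (0:ℝ))
    have := cdf_mono h
    norm_num at h0
    linarith

/-- hazard bound -/
lemma hazard {y x : ℝ} (hx : 0 ≤ x) (hyx : y ≤ x) :
    phi y ≤ 15 * (1 + x) * (1 - stdNormalCDF y) := by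
  have hphi : ∀ z, phi z ≤ Real.exp (-(z ^ 2) / 2) := by
    intro z; unfold phi
    have : (Real.sqrt (2 * Real.pi))⁻¹ ≤ 1 := by
      apply inv_le_one_of_one_le₀; linarith [sqrt_two_pi_ge]
    have := Real.exp_pos (-(z ^ 2) / 2)
    nlinarith
  rcases le_total 0 y with h | h
  · refine (hphi y).trans ((mills_lower h).trans ?_)
    have := (one_sub_cdf_pos y).le
    gcongr
  · have h0 := mills_lower (le_refl (0:ℝ))
    norm_num at h0
    have := cdf_mono h
    have h1 := phi_le_one y
    nlinarith

/-- shift bound for the Gaussian tail -/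
lemma tail_shift {x h : ℝ} (hx : 0 ≤ x) (hh : 0 ≤ h) :
    1 - stdNormalCDF (x - h) ≤ (1 - stdNormalCDF x) * Real.exp (15 * (1 + x) * h) := by
  set L := 15 * (1 + x)
  have hd : ∀ y, HasDerivAt (fun y => (1 - stdNormalCDF y) * Real.exp (L * y))
      ((- phi y) * Real.exp (L * y) + (1 - stdNormalCDF y) * (Real.exp (L * y) * L)) y := by
    intro y
    have h1 : HasDerivAt (fun y => 1 - stdNormalCDF y) (- phi y) y := (cdf_deriv y).const_sub 1
    have h2 : HasDerivAt (fun y => Real.exp (L * y)) (Real.exp (L * y) * L) y := by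
      have := ((hasDerivAt_id y).const_mul L).exp
      simpa using this
    exact h1.mul h2
  have hmono : MonotoneOn (fun y => (1 - stdNormalCDF y) * Real.exp (L * y)) (Set.Iic x) := by
    apply monotoneOn_of_deriv_nonneg (convex_Iic x)
    · exact (continuous_iff_continuousAt.2 fun y => (hd y).continuousAt).continuousOn
    · intro y _; exact (hd y).differentiableAt.differentiableWithinAt
    · intro y hy
      rw [interior_Iic] at hy
      rw [(hd y).deriv]
      have := hazard hx (le_of_lt hy)
      have he := Real.exp_pos (L * y)
      have : (-phi y + L * (1 - stdNormalCDF y)) * Real.exp (L * y) ≥ 0 := by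
        apply mul_nonneg _ he.le
        linarith
      linarith
  have := hmono (show x - h ∈ Set.Iic x by simp [hh]) (show x ∈ Set.Iic x by simp) (by linarith)
  simp only at this
  have he := Real.exp_pos (L * (x - h))
  have h3 : Real.exp (L * x) = Real.exp (L * h) * Real.exp (L * (x - h)) := by
    rw [← Real.exp_add]; ring_nf
  rw [h3, ← mul_assoc] at this
  exact le_of_mul_le_mul_right this he

/-- exponentially tilted Gaussian integrals -/
lemma gam_exp_tail (x c : ℝ) :
    ∫ y in Set.Ioi c, phi y * Real.exp (-x * y) = Real.exp (x ^ 2 / 2) * (1 - stdNormalCDF (x + c)) := by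
  have h1 : ∀ y, phi y * Real.exp (-x * y) = Real.exp (x ^ 2 / 2) * phi (y + x) := by
    intro y; unfold phi
    rw [mul_left_comm, mul_assoc, ← Real.exp_add, ← Real.exp_add]
    congr 2; ring
  simp_rw [h1]
  rw [integral_const_mul]
  congr 1
  rw [← gam_Ioi, gam_real]
  have := (measurePreserving_add_right volume x).setIntegral_preimage_emb
    (measurableEmbedding_addRight x) phi (Set.Ioi (x + c))
  rw [← this]
  congr 2
  ext a; simp [add_comm x c]

lemma phi_exp_integrable (x : ℝ) : Integrable (fun y => phi y * Real.exp (-x * y)) := by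
  have h1 : ∀ y, phi y * Real.exp (-x * y) = Real.exp (x ^ 2 / 2) * phi (y + x) := by
    intro y; unfold phi
    rw [mul_left_comm, mul_assoc, ← Real.exp_add, ← Real.exp_add]
    congr 2; ring
  simp_rw [h1]
  exact (phi_integrable.comp_add_right x).const_mul _

lemma chernoff (s : ℝ) : 1 - stdNormalCDF s ≤ Real.exp (1 / 2 - s) := by
  rw [← gam_Ioi, gam_real]
  have h2 := phi_exp_integrable (-1)
  have h1 : ∫ t in Set.Ioi s, phi t ≤ ∫ t in Set.Ioi s, Real.exp (-s) * (phi t * Real.exp (-(-1) * t)) := by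
    refine setIntegral_mono_on phi_integrable.integrableOn (h2.const_mul _).integrableOn
      measurableSet_Ioi ?_
    intro t ht
    have : 1 ≤ Real.exp (-s) * Real.exp (-(-1) * t) := by
      rw [← Real.exp_add]; apply Real.one_le_exp; have : s < t := ht; linarith
    have := phi_pos t
    nlinarith
  refine h1.trans ?_
  rw [integral_const_mul, gam_exp_tail]
  have : 1 - stdNormalCDF (-1 + s) ≤ 1 := by linarith [cdf_nonneg (-1 + s)]
  have h3 : Real.exp (1/2 - s) = Real.exp (-s) * (Real.exp ((-1)^2/2) * 1) := by
    rw [mul_one, ← Real.exp_add]; congr 1; ring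
  rw [h3]
  gcongr

end SNC


namespace SNC
open MeasureTheory Filter ProbabilityTheory
open scoped Topology ENNReal NNReal

/-- mean value step -/
lemma mv_step {g g' : ℝ → ℝ} {y r K : ℝ} (hg : ∀ w, HasDerivAt g (g' w) w)
    (hb : ∀ w, |w - y| ≤ r → |g' w| ≤ K) {w : ℝ} (hw : |w - y| ≤ r) :
    |g w - g y| ≤ K * r := by
  have hr : 0 ≤ r := (abs_nonneg _).trans hw
  have hK : 0 ≤ K := (abs_nonneg _).trans (hb y (by simpa using hr))
  have h := (convex_Icc (y - r) (y + r)).norm_image_sub_le_of_norm_hasDerivWithin_le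
    (f := g) (f' := g') (C := K) (x := y) (y := w)
    (fun x _ => (hg x).hasDerivWithinAt)
    (fun x hx => hb x (by rw [abs_le]; constructor <;> linarith [hx.1, hx.2]))
    ⟨by linarith, by linarith⟩
    (by rw [abs_le] at hw; constructor <;> linarith [hw.1, hw.2])
  simp only [Real.norm_eq_abs] at h
  exact h.trans (by gcongr)

lemma taylor3 {h h1 h2 h3 : ℝ → ℝ} {y r K : ℝ}
    (d1 : ∀ w, HasDerivAt h (h1 w) w) (d2 : ∀ w, HasDerivAt h1 (h2 w) w)
    (d3 : ∀ w, HasDerivAt h2 (h3 w) w)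
    (hb : ∀ w, |w - y| ≤ r → |h3 w| ≤ K) {u : ℝ} (hu : |u| ≤ r) :
    |h (y + u) - h y - h1 y * u - h2 y / 2 * u ^ 2| ≤ K * r ^ 3 := by
  have s1 : ∀ w, |w - y| ≤ r → |h2 w - h2 y| ≤ K * r := fun w hw => mv_step d3 hb hw
  have s2 : ∀ w, |w - y| ≤ r → |h1 w - h1 y - h2 y * (w - y)| ≤ K * r * r := by
    intro w hw
    have := mv_step (g := fun w => h1 w - h2 y * w) (g' := fun w => h2 w - h2 y)
      (fun w => by
        have := (d2 w).fun_sub ((hasDerivAt_id' w).const_mul (h2 y))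
        simpa using this) s1 hw
    convert this using 2; ring
  have s3 := mv_step (y := y) (r := r) (w := y + u)
    (g := fun w => h w - h1 y * w - h2 y / 2 * (w - y) ^ 2)
      (g' := fun w => h1 w - h1 y - h2 y * (w - y))
      (fun w => by
        have a1 := (d1 w).fun_sub ((hasDerivAt_id' w).const_mul (h1 y))
        have a2 := (((hasDerivAt_id' w).sub_const y).fun_pow 2).const_mul (h2 y / 2)
        have a3 := a1.fun_sub a2
        exact a3.congr_deriv (by norm_num; ring)) s2 (by simpa using hu)
  calc _ = _ := by congr 1; ring
    _ ≤ _ := s3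
    _ = _ := by ring

lemma taylor_low {h h1 h2 h3 : ℝ → ℝ} {y q M ρ : ℝ} (hq : 0 < q) (hρ : 0 < ρ) (hρ' : ρ < 1)
    (d1 : ∀ w, HasDerivAt h (h1 w) w) (d2 : ∀ w, HasDerivAt h1 (h2 w) w)
    (d3 : ∀ w, HasDerivAt h2 (h3 w) w)
    (b1 : |h1 y| ≤ M / q) (b2 : |h2 y| ≤ M / q ^ 2)
    (b3 : ∀ w, |w - y| ≤ q / 2 → |h3 w| ≤ M / q ^ 3) {u : ℝ} (lb : h y - h (y + u) ≤ M) :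
    h y + h1 y * u + h2 y / 2 * u ^ 2 - 13 * M * (|u| / q) ^ (2 + ρ) ≤ h (y + u) := by
  have hM : 0 ≤ M := by
    have := (abs_nonneg _).trans b1
    by_contra hc
    push Not at hc
    have := div_neg_of_neg_of_pos hc hq
    linarith
  set L := |u| / q with hL
  have hL0 : 0 ≤ L := by positivity
  have hu : |u| = L * q := by rw [hL]; field_simp
  rcases le_total L (1/2) with hc | hc
  · have h0 : |u| ≤ q / 2 := by rw [hu]; nlinarith
    have h1' := taylor3 (r := |u|) d1 d2 d3 (fun w hw => b3 w (hw.trans h0)) le_rfl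
    have h2' : M / q ^ 3 * |u| ^ 3 = M * L ^ 3 := by rw [hu]; field_simp
    have h3' : L ^ 3 ≤ L ^ (2 + ρ) := by
      rcases hL0.eq_or_lt with h | h
      · rw [← h]; rw [Real.zero_rpow (by linarith)]; norm_num
      · rw [← Real.rpow_natCast L 3]
        apply Real.rpow_le_rpow_of_exponent_ge h (by linarith)
        push_cast; linarith
    rw [h2', abs_le] at h1'
    have h4 : M * L ^ 3 ≤ M * L ^ (2 + ρ) := by gcongr
    have h5 : 0 ≤ M * L ^ (2 + ρ) := by positivity
    linarith [h1'.1]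
  · have hLp : 0 < L := by linarith
    have e1 : (2 * L) ^ (2 + ρ) ≤ 8 * L ^ (2 + ρ) := by
      rw [Real.mul_rpow (by norm_num) hL0]
      have : (2:ℝ) ^ (2 + ρ) ≤ 2 ^ (3:ℝ) :=
        Real.rpow_le_rpow_of_exponent_le (by norm_num) (by linarith)
      have h8 : (2:ℝ) ^ (3:ℝ) = 8 := by
        rw [show (3:ℝ) = ((3:ℕ):ℝ) by norm_num, Real.rpow_natCast]; norm_num
      rw [h8] at this
      gcongr
    have h2L : 1 ≤ 2 * L := by linarith
    have e2 : 1 ≤ (2 * L) ^ (2 + ρ) := Real.one_le_rpow h2L (by linarith)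
    have e4 : (2 * L) ^ 2 ≤ (2 * L) ^ (2 + ρ) := by
      rw [← Real.rpow_natCast (2 * L) 2]
      apply Real.rpow_le_rpow_of_exponent_le h2L
      push_cast; linarith
    have e3 : 2 * L ≤ (2 * L) ^ (2 + ρ) := by nlinarith
    have f1 : |h1 y * u| ≤ M * L := by
      rw [abs_mul, hu]
      calc |h1 y| * (L * q) ≤ M / q * (L * q) := by gcongr
        _ = M * L := by field_simp
    have f2 : |h2 y / 2 * u ^ 2| ≤ M * L ^ 2 / 2 := by
      rw [abs_mul, abs_div, abs_pow, hu]
      calc |h2 y| / |2| * (L * q) ^ 2 ≤ (M / q ^ 2) / |2| * (L * q) ^ 2 := by gcongr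
        _ = M * L ^ 2 / 2 := by simp; field_simp
    have k0 : M ≤ M * (8 * L ^ (2 + ρ)) := le_mul_of_one_le_right hM (e2.trans e1)
    have k1 : M * (2 * L) ≤ M * (8 * L ^ (2 + ρ)) := mul_le_mul_of_nonneg_left (e3.trans e1) hM
    have k2 : M * ((2 * L) ^ 2) ≤ M * (8 * L ^ (2 + ρ)) := mul_le_mul_of_nonneg_left (e4.trans e1) hM
    linarith [(abs_le.1 f1).2, (abs_le.1 f2).2, abs_nonneg u]

/-- fast decay of the normal density -/
lemma phi_dec (z : ℝ) : phi z * (2 + z ^ 2) ^ 5 ≤ 50000 := by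
  have h1 : (1 + z ^ 2 / 10) ^ 5 ≤ Real.exp (z ^ 2 / 2) := by
    have : 1 + z ^ 2 / 10 ≤ Real.exp (z ^ 2 / 10) := by linarith [Real.add_one_le_exp (z ^ 2 / 10)]
    calc (1 + z ^ 2 / 10) ^ 5 ≤ (Real.exp (z ^ 2 / 10)) ^ 5 := by gcongr
      _ = _ := by rw [← Real.exp_nat_mul]; congr 1; push_cast; ring
  have h2 : (2 + z ^ 2) ^ 5 ≤ 100000 * Real.exp (z ^ 2 / 2) := by
    calc (2 + z ^ 2) ^ 5 ≤ (10 * (1 + z ^ 2 / 10)) ^ 5 := by gcongr; nlinarith [sq_nonneg z]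
      _ = 100000 * (1 + z ^ 2 / 10) ^ 5 := by ring
      _ ≤ _ := by gcongr
  have h3 : phi z * Real.exp (z ^ 2 / 2) ≤ 1 / 2 := by
    have := phi_le_half 0
    unfold phi at *
    rw [mul_assoc, ← Real.exp_add]
    simpa [neg_div] using this
  have := phi_pos z
  calc phi z * (2 + z ^ 2) ^ 5 ≤ phi z * (100000 * Real.exp (z ^ 2 / 2)) := by gcongr
    _ = 100000 * (phi z * Real.exp (z ^ 2 / 2)) := by ring
    _ ≤ 100000 * (1 / 2) := by gcongr
    _ = _ := by norm_num

lemma phi_deriv (z : ℝ) : HasDerivAt phi (-z * phi z) z := by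
  unfold phi
  have h := ((((hasDerivAt_id' z).fun_pow 2).fun_neg.div_const 2).exp).const_mul (Real.sqrt (2 * Real.pi))⁻¹
  exact h.congr_deriv (by norm_num; ring)

lemma q_lower {t y w : ℝ} (ht : 0 < t) (h : |w - y| ≤ Real.sqrt (2 * t + y ^ 2) / 2) :
    (2 * t + y ^ 2) / 4 ≤ 2 * t + w ^ 2 := by
  set q := Real.sqrt (2 * t + y ^ 2)
  have hq : q ^ 2 = 2 * t + y ^ 2 := Real.sq_sqrt (by positivity)
  have h2 : (w - y) ^ 2 ≤ (q / 2) ^ 2 := by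
    rw [← sq_abs]; gcongr
  nlinarith [sq_nonneg (y - 2 * (y - w)), sq_nonneg (2 * w - y), sq_nonneg w]

/-- bounds for z-polynomials against the density, in terms of `t` and `B = t(2+z²)` -/
lemma phi_bd {z p : ℝ} (k : ℕ) (hk : k ≤ 3) (hp : |p| ≤ (2 + z ^ 2) ^ 2) :
    |p| * phi z * (2 + z ^ 2) ^ k ≤ 50000 := by
  have h0 : 1 ≤ 2 + z ^ 2 := by nlinarith [sq_nonneg z]
  have := phi_pos z
  calc |p| * phi z * (2 + z ^ 2) ^ k ≤ (2 + z ^ 2) ^ 2 * phi z * (2 + z ^ 2) ^ 3 := by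
        gcongr
    _ = phi z * (2 + z ^ 2) ^ 5 := by ring
    _ ≤ _ := phi_dec z

lemma abs_poly1 (z : ℝ) : |z| ≤ (2 + z ^ 2) ^ 2 := by
  rw [abs_le]; constructor <;> nlinarith [sq_nonneg z, sq_nonneg (z-1), sq_nonneg (z+1), sq_nonneg (z^2)]
lemma abs_poly2 (z : ℝ) : |z ^ 2 - 1| ≤ (2 + z ^ 2) ^ 2 := by
  rw [abs_le]; constructor <;> nlinarith [sq_nonneg z, sq_nonneg (z^2)]
lemma abs_poly3 (z : ℝ) : |3 / 4 * z - 1 / 4 * z ^ 3| ≤ (2 + z ^ 2) ^ 2 := by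
  rw [abs_le]; constructor <;>
    nlinarith [sq_nonneg z, sq_nonneg (z^2-z), sq_nonneg (z^2+z), sq_nonneg (z^2), sq_nonneg (z-1), sq_nonneg (z+1)]


lemma _root_.HasDerivAt.fun_comp' {f g : ℝ → ℝ} {f' g' : ℝ} (y : ℝ) (h : HasDerivAt f f' (g y))
    (hg : HasDerivAt g g' y) : HasDerivAt (fun w => f (g w)) (f' * g') y :=
  HasDerivAt.comp y h hg

lemma F_derivs (t : ℝ) (ht : 0 < t) (y : ℝ) :
    HasDerivAt (fun w => stdNormalCDF (w / Real.sqrt t)) (phi (y / Real.sqrt t) / Real.sqrt t) y ∧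
    HasDerivAt (fun w => phi (w / Real.sqrt t) / Real.sqrt t)
      (-(y / Real.sqrt t) * phi (y / Real.sqrt t) / t) y ∧
    HasDerivAt (fun w => -(w / Real.sqrt t) * phi (w / Real.sqrt t) / t)
      (((y / Real.sqrt t) ^ 2 - 1) * phi (y / Real.sqrt t) / (t * Real.sqrt t)) y := by
  have hs : 0 < Real.sqrt t := Real.sqrt_pos.2 ht
  have hst : t = Real.sqrt t * Real.sqrt t := (Real.mul_self_sqrt ht.le).symm
  have h0 : HasDerivAt (fun w : ℝ => w / Real.sqrt t) (1 / Real.sqrt t) y :=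
    (hasDerivAt_id' y).div_const _
  have h1 : HasDerivAt (fun w => stdNormalCDF (w / Real.sqrt t))
      (phi (y / Real.sqrt t) * (1 / Real.sqrt t)) y :=
    (cdf_deriv (y / Real.sqrt t)).fun_comp' y h0
  have h2 : HasDerivAt (fun w => phi (w / Real.sqrt t))
      ((-(y / Real.sqrt t) * phi (y / Real.sqrt t)) * (1 / Real.sqrt t)) y :=
    (phi_deriv (y / Real.sqrt t)).fun_comp' y h0
  refine ⟨h1.congr_deriv (by ring), (h2.div_const _).congr_deriv ?_, ?_⟩
  · have : -(y / Real.sqrt t) * phi (y / Real.sqrt t) / t =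
        -(y / Real.sqrt t) * phi (y / Real.sqrt t) / (Real.sqrt t * Real.sqrt t) := by rw [← hst]
    rw [this]; field_simp
  · have h3 := (h0.fun_neg.fun_mul h2).div_const t
    refine h3.congr_deriv ?_
    field_simp; ring

lemma F_bounds {t y : ℝ} (ht : 0 < t) :
    |phi (y / Real.sqrt t) / Real.sqrt t| ≤ 50000 / Real.sqrt (2 * t + y ^ 2) ∧
    |-(y / Real.sqrt t) * phi (y / Real.sqrt t) / t| ≤ 50000 / Real.sqrt (2 * t + y ^ 2) ^ 2 ∧
    |((y / Real.sqrt t) ^ 2 - 1) * phi (y / Real.sqrt t) / (t * Real.sqrt t)| ≤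
      50000 / Real.sqrt (2 * t + y ^ 2) ^ 3 := by
  have hs : 0 < Real.sqrt t := Real.sqrt_pos.2 ht
  have hst : Real.sqrt t ^ 2 = t := Real.sq_sqrt ht.le
  set s := Real.sqrt t
  set z := y / s with hz
  have hy : y = z * s := by rw [hz]; field_simp
  have hB : 2 * t + y ^ 2 = s ^ 2 * (2 + z ^ 2) := by rw [hy, ← hst]; ring
  have h0 : 1 ≤ 2 + z ^ 2 := by nlinarith [sq_nonneg z]
  set r := Real.sqrt (2 + z ^ 2) with hr
  have hr2 : r ^ 2 = 2 + z ^ 2 := Real.sq_sqrt (by linarith)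
  have hr1 : 1 ≤ r := Real.one_le_sqrt.2 h0
  have hq : Real.sqrt (2 * t + y ^ 2) = s * r := by
    rw [hB, Real.sqrt_mul (by positivity), Real.sqrt_sq hs.le]
  rw [hq]
  have hp := phi_pos z
  have hr4 : r ≤ 2 + z ^ 2 := by nlinarith
  have hr5 : r ^ 3 ≤ (2 + z ^ 2) ^ 2 := by rw [← hr2]; nlinarith [pow_pos (by linarith : 0 < r) 3]
  refine ⟨?_, ?_, ?_⟩
  · rw [abs_of_pos (by positivity), div_le_div_iff₀ hs (by positivity)]
    have := phi_bd (z := z) (p := 1) 1 (by norm_num) (by rw [abs_one]; nlinarith)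
    simp at this
    have : phi z * r ≤ 50000 := le_trans (by gcongr) this
    nlinarith
  · rw [abs_div, abs_mul, abs_neg, abs_of_pos hp, abs_of_pos ht, div_le_div_iff₀ ht (by positivity), mul_pow, hr2]
    have := phi_bd (z := z) (p := z) 1 (by norm_num) (abs_poly1 z)
    rw [hst]
    calc _ = t * (|z| * phi z * (2 + z ^ 2) ^ 1) := by ring
      _ ≤ t * 50000 := by gcongr
      _ = _ := by ring
  · rw [abs_div, abs_mul, abs_of_pos hp, abs_of_pos (by positivity : 0 < t * s),
      div_le_div_iff₀ (by positivity) (by positivity), mul_pow]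
    have := phi_bd (z := z) (p := z ^ 2 - 1) 2 (by norm_num) (abs_poly2 z)
    calc _ = s ^ 3 * (|z ^ 2 - 1| * phi z * r ^ 3) := by ring
      _ ≤ s ^ 3 * (|z ^ 2 - 1| * phi z * (2 + z ^ 2) ^ 2) := by gcongr
      _ ≤ s ^ 3 * 50000 := by gcongr
      _ = _ := by rw [← hst]; ring

/-- the second derivative is bounded by `C B^{-1-ρ/2}` -/
lemma F2_bound {t y ρ : ℝ} (ht : 0 < t) (ht3 : t ≤ 3) (hρ : 0 < ρ) (hρ' : ρ < 1) :
    |-(y / Real.sqrt t) * phi (y / Real.sqrt t) / t| ≤ 150000 * (2 * t + y ^ 2) ^ (-1 - ρ / 2) := by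
  have hs : 0 < Real.sqrt t := Real.sqrt_pos.2 ht
  have hst : Real.sqrt t ^ 2 = t := Real.sq_sqrt ht.le
  set s := Real.sqrt t
  set z := y / s with hz
  have hy : y = z * s := by rw [hz]; field_simp
  have hB : 2 * t + y ^ 2 = t * (2 + z ^ 2) := by rw [hy, ← hst]; ring
  have h0 : 1 ≤ 2 + z ^ 2 := by nlinarith [sq_nonneg z]
  have hp := phi_pos z
  have hm : (2 * t + y ^ 2) ^ (-1 - ρ / 2) = (t * (2 + z ^ 2))⁻¹ * (t * (2 + z ^ 2)) ^ (- (ρ / 2)) := by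
    rw [hB, sub_eq_add_neg, Real.rpow_add (by positivity), Real.rpow_neg_one]
  have h1 : (t * (2 + z ^ 2)) ^ (ρ / 2) ≤ 3 * (2 + z ^ 2) := by
    calc (t * (2 + z ^ 2)) ^ (ρ / 2) ≤ (3 * (2 + z ^ 2)) ^ (ρ / 2) := by gcongr
      _ ≤ (3 * (2 + z ^ 2)) ^ (1:ℝ) := by
        apply Real.rpow_le_rpow_of_exponent_le (by linarith) (by linarith)
      _ = _ := Real.rpow_one _
  have h2 : (3 * (2 + z ^ 2))⁻¹ ≤ (t * (2 + z ^ 2)) ^ (- (ρ / 2)) := by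
    rw [Real.rpow_neg (by positivity)]
    apply inv_anti₀ (by positivity) h1
  have h3 := phi_bd (z := z) (p := z) 2 (by norm_num) (abs_poly1 z)
  rw [abs_div, abs_mul, abs_neg, abs_of_pos hp, abs_of_pos ht, hm]
  calc |z| * phi z / t = (|z| * phi z * (2 + z ^ 2) ^ 2) * ((t * (2 + z ^ 2))⁻¹ * (2 + z ^ 2)⁻¹) := by
        field_simp
    _ ≤ 50000 * ((t * (2 + z ^ 2))⁻¹ * (2 + z ^ 2)⁻¹) := by gcongr
    _ = 150000 * ((t * (2 + z ^ 2))⁻¹ * (3 * (2 + z ^ 2))⁻¹) := by rw [mul_inv 3]; ring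
    _ ≤ _ := by gcongr

/-- Taylor bound for the smoothed distribution function, in the space variable -/
lemma F_taylor {t y u ρ : ℝ} (ht : 0 < t) (hρ : 0 < ρ) (hρ' : ρ < 1) :
    |stdNormalCDF ((y + u) / Real.sqrt t) - stdNormalCDF (y / Real.sqrt t)
      - phi (y / Real.sqrt t) / Real.sqrt t * u
      - (-(y / Real.sqrt t) * phi (y / Real.sqrt t) / t) / 2 * u ^ 2| ≤
    5200000 * (2 * t + y ^ 2) ^ (-1 - ρ / 2) * |u| ^ (2 + ρ) := by
  have hB : 0 < 2 * t + y ^ 2 := by positivity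
  set q := Real.sqrt (2 * t + y ^ 2) with hq
  have hq0 : 0 < q := Real.sqrt_pos.2 hB
  have hq2 : q ^ 2 = 2 * t + y ^ 2 := Real.sq_sqrt hB.le
  obtain ⟨b1, b2, b3⟩ := F_bounds (y := y) ht
  have b3' : ∀ w, |w - y| ≤ q / 2 →
      |((w / Real.sqrt t) ^ 2 - 1) * phi (w / Real.sqrt t) / (t * Real.sqrt t)| ≤ 400000 / q ^ 3 := by
    intro w hw
    have h1 := q_lower ht hw
    refine (F_bounds (y := w) ht).2.2.trans ?_
    have h2 : q / 2 ≤ Real.sqrt (2 * t + w ^ 2) := by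
      apply Real.le_sqrt_of_sq_le
      rw [div_pow, hq2]; linarith
    calc 50000 / Real.sqrt (2 * t + w ^ 2) ^ 3 ≤ 50000 / (q / 2) ^ 3 := by gcongr
      _ = _ := by field_simp; norm_num
  have e : (|u| / q) ^ (2 + ρ) = (2 * t + y ^ 2) ^ (-1 - ρ / 2) * |u| ^ (2 + ρ) := by
    rw [Real.div_rpow (abs_nonneg _) hq0.le, hq, Real.sqrt_eq_rpow, ← Real.rpow_mul hB.le,
      div_eq_mul_inv, ← Real.rpow_neg hB.le, mul_comm]
    congr 2; ring
  have lb : ∀ z w : ℝ, stdNormalCDF z - stdNormalCDF w ≤ 400000 := by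
    intro z w; linarith [cdf_le_one z, cdf_nonneg w]
  have up := taylor_low (h := fun w => stdNormalCDF (w / Real.sqrt t))
    (h1 := fun w => phi (w / Real.sqrt t) / Real.sqrt t)
    (h2 := fun w => -(w / Real.sqrt t) * phi (w / Real.sqrt t) / t)
    (h3 := fun w => ((w / Real.sqrt t) ^ 2 - 1) * phi (w / Real.sqrt t) / (t * Real.sqrt t))
    (M := 400000) (y := y) (u := u) hq0 hρ hρ'
    (fun w => (F_derivs t ht w).1) (fun w => (F_derivs t ht w).2.1) (fun w => (F_derivs t ht w).2.2)
    (b1.trans (by gcongr; norm_num)) (b2.trans (by gcongr; norm_num)) b3' (lb _ _)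
  have dn := taylor_low (h := fun w => -stdNormalCDF (w / Real.sqrt t))
    (h1 := fun w => -(phi (w / Real.sqrt t) / Real.sqrt t))
    (h2 := fun w => -(-(w / Real.sqrt t) * phi (w / Real.sqrt t) / t))
    (h3 := fun w => -(((w / Real.sqrt t) ^ 2 - 1) * phi (w / Real.sqrt t) / (t * Real.sqrt t)))
    (M := 400000) (y := y) (u := u) hq0 hρ hρ'
    (fun w => (F_derivs t ht w).1.fun_neg) (fun w => (F_derivs t ht w).2.1.fun_neg)
    (fun w => (F_derivs t ht w).2.2.fun_neg)
    (by rw [abs_neg]; exact b1.trans (by gcongr; norm_num))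
    (by rw [abs_neg]; exact b2.trans (by gcongr; norm_num))
    (fun w hw => by rw [abs_neg]; exact b3' w hw) (by linarith [lb ((y+u) / Real.sqrt t) (y / Real.sqrt t)])
  simp only [e] at up dn
  rw [abs_le]
  constructor <;> linarith

/-- Taylor bound in the time variable -/
lemma F_time {t y v : ℝ} (ht : 0 < t) (hv : 0 ≤ v) :
    |stdNormalCDF (y / Real.sqrt (t + v)) - stdNormalCDF (y / Real.sqrt t)
      - (-(y / Real.sqrt t) * phi (y / Real.sqrt t) / t) / 2 * v| ≤
    50000 * v ^ 2 / (2 * t + y ^ 2) ^ 2 := by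
  have hB : 0 < 2 * t + y ^ 2 := by positivity
  have d0 : ∀ τ, 0 < τ → HasDerivAt (fun τ => y / Real.sqrt τ) (-(y / Real.sqrt τ) / (2 * τ)) τ := by
    intro τ hτ
    have hs : 0 < Real.sqrt τ := Real.sqrt_pos.2 hτ
    have hst : Real.sqrt τ ^ 2 = τ := Real.sq_sqrt hτ.le
    have := (hasDerivAt_const τ y).fun_div (Real.hasDerivAt_sqrt hτ.ne') hs.ne'
    refine this.congr_deriv ?_
    rw [hst]; field_simp; ring
  have d1 : ∀ τ, 0 < τ → HasDerivAt (fun τ => stdNormalCDF (y / Real.sqrt τ))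
      ((-(y / Real.sqrt τ) * phi (y / Real.sqrt τ) / τ) / 2) τ := by
    intro τ hτ
    have : HasDerivAt (fun τ => stdNormalCDF (y / Real.sqrt τ)) _ τ :=
      (cdf_deriv (y / Real.sqrt τ)).fun_comp' τ (d0 τ hτ)
    refine this.congr_deriv ?_
    field_simp
  have d2 : ∀ τ, 0 < τ → HasDerivAt (fun τ => (-(y / Real.sqrt τ) * phi (y / Real.sqrt τ) / τ) / 2)
      ((3 / 4 * (y / Real.sqrt τ) - 1 / 4 * (y / Real.sqrt τ) ^ 3) * phi (y / Real.sqrt τ) / τ ^ 2) τ := by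
    intro τ hτ
    have h2 : HasDerivAt (fun τ => phi (y / Real.sqrt τ)) _ τ :=
      (phi_deriv (y / Real.sqrt τ)).fun_comp' τ (d0 τ hτ)
    have := (((d0 τ hτ).fun_neg.fun_mul h2).fun_div (hasDerivAt_id' τ) hτ.ne').div_const 2
    refine this.congr_deriv ?_
    field_simp; ring
  have bd : ∀ τ, t ≤ τ → |(3 / 4 * (y / Real.sqrt τ) - 1 / 4 * (y / Real.sqrt τ) ^ 3)
      * phi (y / Real.sqrt τ) / τ ^ 2| ≤ 50000 / (2 * t + y ^ 2) ^ 2 := by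
    intro τ hτt
    have hτ : 0 < τ := by linarith
    have hs : 0 < Real.sqrt τ := Real.sqrt_pos.2 hτ
    have hst : Real.sqrt τ ^ 2 = τ := Real.sq_sqrt hτ.le
    set s := Real.sqrt τ
    set z := y / s with hz
    have hy : y = z * s := by rw [hz]; field_simp
    have hB : 2 * τ + y ^ 2 = τ * (2 + z ^ 2) := by rw [hy, ← hst]; ring
    have h3 := phi_bd (z := z) 2 (by norm_num) (abs_poly3 z)
    rw [abs_div, abs_mul, abs_of_pos (phi_pos z), abs_of_pos (by positivity : 0 < τ ^ 2)]
    have : 50000 / (τ * (2 + z ^ 2)) ^ 2 ≤ 50000 / (2 * t + y ^ 2) ^ 2 := by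
      rw [← hB]; gcongr
    refine le_trans ?_ this
    rw [div_le_div_iff₀ (by positivity) (by positivity)]
    calc _ = τ ^ 2 * (|3 / 4 * z - 1 / 4 * z ^ 3| * phi z * (2 + z ^ 2) ^ 2) := by ring
      _ ≤ τ ^ 2 * 50000 := by gcongr
      _ = _ := by ring
  set K := 50000 / (2 * t + y ^ 2) ^ 2 with hK
  have s1 : ∀ τ ∈ Set.Icc t (t + v), |(-(y / Real.sqrt τ) * phi (y / Real.sqrt τ) / τ) / 2
      - (-(y / Real.sqrt t) * phi (y / Real.sqrt t) / t) / 2| ≤ K * v := by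
    intro τ hτ
    have := (convex_Icc t (t + v)).norm_image_sub_le_of_norm_hasDerivWithin_le
      (C := K) (x := t) (y := τ)
      (fun x hx => (d2 x (by linarith [hx.1])).hasDerivWithinAt)
      (fun x hx => bd x hx.1) ⟨le_rfl, by linarith⟩ hτ
    refine this.trans ?_
    rw [Real.norm_eq_abs, abs_of_nonneg (by linarith [hτ.1])]
    have : 0 ≤ K := by positivity
    gcongr; linarith [hτ.2]
  have s2 := (convex_Icc t (t + v)).norm_image_sub_le_of_norm_hasDerivWithin_le
      (f := fun τ => stdNormalCDF (y / Real.sqrt τ) - (-(y / Real.sqrt t) * phi (y / Real.sqrt t) / t) / 2 * τ)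
      (f' := fun τ => (-(y / Real.sqrt τ) * phi (y / Real.sqrt τ) / τ) / 2
      - (-(y / Real.sqrt t) * phi (y / Real.sqrt t) / t) / 2)
      (C := K * v) (x := t) (y := t + v)
      (fun x hx => by
        have := ((d1 x (by linarith [hx.1])).fun_sub ((hasDerivAt_id' x).const_mul
          ((-(y / Real.sqrt t) * phi (y / Real.sqrt t) / t) / 2))).hasDerivWithinAt (s := Set.Icc t (t + v))
        simpa only [mul_one] using this)
      s1 ⟨le_rfl, by linarith⟩ ⟨by linarith, le_rfl⟩
  rw [Real.norm_eq_abs, Real.norm_eq_abs, add_sub_cancel_left, abs_of_nonneg hv] at s2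
  calc _ = _ := by congr 1; ring
    _ ≤ _ := s2
    _ = _ := by rw [hK]; ring

end SNC


namespace SNC
open MeasureTheory Filter ProbabilityTheory
open scoped Topology ENNReal NNReal

/-- the function `H(t,y) = (2t+y²)^{-m}` -/
noncomputable def Hf (m t y : ℝ) : ℝ := (2 * t + y ^ 2) ^ (-m)
noncomputable def Hf1 (m t y : ℝ) : ℝ := -2 * m * y * (2 * t + y ^ 2) ^ (-m - 1)
noncomputable def Hf2 (m t y : ℝ) : ℝ :=
  -2 * m * (2 * t + y ^ 2) ^ (-m - 1) + 4 * m * (m + 1) * y ^ 2 * (2 * t + y ^ 2) ^ (-m - 2)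
noncomputable def Hf3 (m t y : ℝ) : ℝ :=
  12 * m * (m + 1) * y * (2 * t + y ^ 2) ^ (-m - 2)
    - 8 * m * (m + 1) * (m + 2) * y ^ 3 * (2 * t + y ^ 2) ^ (-m - 3)

lemma Bpow_deriv (p t : ℝ) (ht : 0 < t) (y : ℝ) :
    HasDerivAt (fun w => (2 * t + w ^ 2) ^ p) (2 * p * y * (2 * t + y ^ 2) ^ (p - 1)) y := by
  have hB : 0 < 2 * t + y ^ 2 := by positivity
  have h0 : HasDerivAt (fun w : ℝ => 2 * t + w ^ 2) (2 * y) y := by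
    have := ((hasDerivAt_id' y).fun_pow 2).const_add (2 * t)
    exact this.congr_deriv (by norm_num)
  have := h0.rpow_const (p := p) (Or.inl hB.ne')
  exact this.congr_deriv (by ring)

lemma Hf_deriv (m t : ℝ) (ht : 0 < t) (y : ℝ) : HasDerivAt (Hf m t) (Hf1 m t y) y := by
  unfold Hf Hf1
  exact (Bpow_deriv (-m) t ht y).congr_deriv (by ring)

lemma Hf1_deriv (m t : ℝ) (ht : 0 < t) (y : ℝ) : HasDerivAt (Hf1 m t) (Hf2 m t y) y := by
  unfold Hf1 Hf2
  have h := ((hasDerivAt_id' y).const_mul (-2 * m)).fun_mul (Bpow_deriv (-m - 1) t ht y)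
  refine h.congr_deriv ?_
  rw [show -m - 1 - 1 = -m - 2 by ring]; ring

lemma Hf2_deriv (m t : ℝ) (ht : 0 < t) (y : ℝ) : HasDerivAt (Hf2 m t) (Hf3 m t y) y := by
  unfold Hf2 Hf3
  have h1 := (Bpow_deriv (-m - 1) t ht y).const_mul (-2 * m)
  have h2 := (((hasDerivAt_id' y).fun_pow 2).const_mul (4 * m * (m + 1))).fun_mul
    (Bpow_deriv (-m - 2) t ht y)
  refine (h1.fun_add h2).congr_deriv ?_
  rw [show -m - 1 - 1 = -m - 2 by ring, show -m - 2 - 1 = -m - 3 by ring]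
  norm_num; ring

section
variable {m t y : ℝ} (hm : 0 < m) (hm' : m ≤ 1 / 2) (ht : 0 < t)

lemma Bpow_sub (ht : 0 < t) (m : ℝ) (k : ℕ) : (2 * t + y ^ 2) ^ (-m - k) =
    (2 * t + y ^ 2) ^ (-m) / Real.sqrt (2 * t + y ^ 2) ^ (2 * k) := by
  have hB : 0 < 2 * t + y ^ 2 := by positivity
  rw [Real.rpow_sub hB, pow_mul, Real.sq_sqrt hB.le, Real.rpow_natCast]

lemma abs_le_q (ht : 0 < t) : |y| ≤ Real.sqrt (2 * t + y ^ 2) := by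
  apply Real.le_sqrt_of_sq_le
  rw [sq_abs]; linarith

lemma Hf1_bd (hm : 0 < m) (hm' : m ≤ 1 / 2) (ht : 0 < t) : |Hf1 m t y| ≤ 384 * Hf m t y / Real.sqrt (2 * t + y ^ 2) := by
  have hB : 0 < 2 * t + y ^ 2 := by positivity
  have h1 := Bpow_sub (y := y) ht m 1
  have hq := abs_le_q (y := y) ht
  unfold Hf1 Hf
  push_cast at h1
  rw [h1]
  set q := Real.sqrt (2 * t + y ^ 2)
  have hq0 : 0 < q := Real.sqrt_pos.2 hB
  set h := (2 * t + y ^ 2) ^ (-m)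
  have hh : 0 < h := Real.rpow_pos_of_pos hB _
  rw [abs_mul, abs_mul, abs_mul, abs_of_pos hm, abs_of_pos (by positivity : 0 < h / q ^ 2), abs_neg, abs_two]
  rw [le_div_iff₀ hq0]
  have : 2 * m * |y| * (h / q ^ 2) * q = (2 * m) * h * (|y| / q) := by field_simp
  rw [this]
  have h2 : |y| / q ≤ 1 := by rw [div_le_one hq0]; exact hq
  calc (2 * m) * h * (|y| / q) ≤ (2 * (1/2)) * h * 1 := by gcongr
    _ ≤ _ := by linarith

lemma Hf2_bd' (hm : 0 < m) (hm' : m ≤ 1 / 2) (ht : 0 < t) : |Hf2 m t y| ≤ 8 * m * (2 * t + y ^ 2) ^ (-m - 1) := by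
  have hB : 0 < 2 * t + y ^ 2 := by positivity
  have h1 : (2 * t + y ^ 2) ^ (-m - 1) = (2 * t + y ^ 2) * (2 * t + y ^ 2) ^ (-m - 2) := by
    nth_rewrite 2 [← Real.rpow_one (2 * t + y ^ 2)]
    rw [← Real.rpow_add hB]; ring_nf
  unfold Hf2
  rw [h1]
  set h := (2 * t + y ^ 2) ^ (-m - 2)
  have hh : 0 < h := Real.rpow_pos_of_pos hB _
  have : -2 * m * ((2 * t + y ^ 2) * h) + 4 * m * (m + 1) * y ^ 2 * h
    = m * h * (-2 * (2 * t + y ^ 2) + 4 * (m + 1) * y ^ 2) := by ring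
  rw [this, show 8 * m * ((2 * t + y ^ 2) * h) = m * h * (8 * (2 * t + y ^ 2)) by ring, abs_mul,
    abs_of_pos (by positivity : 0 < m * h)]
  gcongr
  rw [abs_le]; constructor <;> nlinarith [sq_nonneg y, mul_nonneg hm.le (sq_nonneg y)]

lemma Hf2_lower (hm : 0 < m) (hm' : m ≤ 1 / 2) (ht : 0 < t) : -2 * m * (2 * t + y ^ 2) ^ (-m - 1) ≤ Hf2 m t y := by
  have hB : 0 < 2 * t + y ^ 2 := by positivity
  unfold Hf2
  have : 0 ≤ 4 * m * (m + 1) * y ^ 2 * (2 * t + y ^ 2) ^ (-m - 2) := by positivity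
  linarith

lemma Hf2_bd (hm : 0 < m) (hm' : m ≤ 1 / 2) (ht : 0 < t) : |Hf2 m t y| ≤ 384 * Hf m t y / Real.sqrt (2 * t + y ^ 2) ^ 2 := by
  have hB : 0 < 2 * t + y ^ 2 := by positivity
  refine (Hf2_bd' hm hm' ht).trans ?_
  have h1 := Bpow_sub (y := y) ht m 1
  push_cast at h1
  rw [h1]
  unfold Hf
  have hh : 0 < (2 * t + y ^ 2) ^ (-m) := Real.rpow_pos_of_pos hB _
  rw [mul_div_assoc]
  gcongr
  linarith

lemma Hf3_bd0 (hm : 0 < m) (hm' : m ≤ 1 / 2) (ht : 0 < t) : |Hf3 m t y| ≤ 24 * Hf m t y / Real.sqrt (2 * t + y ^ 2) ^ 3 := by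
  have hB : 0 < 2 * t + y ^ 2 := by positivity
  have h2 := Bpow_sub (y := y) ht m 2
  have h3 := Bpow_sub (y := y) ht m 3
  have hq := abs_le_q (y := y) ht
  unfold Hf3 Hf
  push_cast at h2 h3
  rw [h2, h3]
  set q := Real.sqrt (2 * t + y ^ 2)
  have hq0 : 0 < q := Real.sqrt_pos.2 hB
  set h := (2 * t + y ^ 2) ^ (-m)
  have hh : 0 < h := Real.rpow_pos_of_pos hB _
  set w := y / q with hw
  have hyw : y = w * q := by rw [hw]; field_simp
  have hw1 : |w| ≤ 1 := by rw [hw, abs_div, abs_of_pos hq0, div_le_one hq0]; exact hq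
  have : 12 * m * (m + 1) * y * (h / q ^ 4) - 8 * m * (m + 1) * (m + 2) * y ^ 3 * (h / q ^ 6)
    = (12 * m * (m + 1) * w - 8 * m * (m + 1) * (m + 2) * w ^ 3) * h / q ^ 3 := by
    rw [hyw]; field_simp
  rw [this, abs_div, abs_mul, abs_of_pos hh, abs_of_pos (by positivity : 0 < q ^ 3)]
  gcongr
  refine (abs_sub _ _).trans ?_
  rw [abs_mul, abs_mul _ (w ^ 3), abs_pow, abs_of_pos (by positivity : 0 < 12 * m * (m + 1)),
    abs_of_pos (by positivity : 0 < 8 * m * (m + 1) * (m + 2))]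
  have hw3 : |w| ^ 3 ≤ 1 := pow_le_one₀ (abs_nonneg _) hw1
  have k1 : 12 * m * (m + 1) ≤ 9 := by nlinarith
  have k2 : 8 * m * (m + 1) * (m + 2) ≤ 15 := by
    have : m * (m + 1) ≤ 3/4 := by nlinarith
    nlinarith
  have : 12 * m * (m + 1) * |w| ≤ 9 * 1 := by gcongr
  have : 8 * m * (m + 1) * (m + 2) * |w| ^ 3 ≤ 15 * 1 := by gcongr
  linarith

end

/-- Taylor lower bound for `H` -/
lemma Hf_taylor {m t y u : ℝ} (hm : 0 < m) (hm' : m < 1 / 2) (ht : 0 < t) :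
    Hf m t y + Hf1 m t y * u + Hf2 m t y / 2 * u ^ 2
      - 4992 * ((2 * t + y ^ 2) ^ (-m) * (2 * t + y ^ 2) ^ (-m - 1)) * |u| ^ (2 + 2 * m) ≤ Hf m t (y + u) := by
  have hB : 0 < 2 * t + y ^ 2 := by positivity
  set q := Real.sqrt (2 * t + y ^ 2) with hq
  have hq0 : 0 < q := Real.sqrt_pos.2 hB
  have hq2 : q ^ 2 = 2 * t + y ^ 2 := Real.sq_sqrt hB.le
  have hpos : ∀ w, 0 < Hf m t w := fun w => Real.rpow_pos_of_pos (by positivity) _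
  have e : (|u| / q) ^ (2 + 2 * m) = (2 * t + y ^ 2) ^ (-m - 1) * |u| ^ (2 + 2 * m) := by
    rw [Real.div_rpow (abs_nonneg _) hq0.le, hq, Real.sqrt_eq_rpow, ← Real.rpow_mul hB.le,
      div_eq_mul_inv, ← Real.rpow_neg hB.le, mul_comm]
    congr 2; ring
  have b3 : ∀ w, |w - y| ≤ q / 2 → |Hf3 m t w| ≤ 384 * Hf m t y / q ^ 3 := by
    intro w hw
    have h1 := q_lower ht hw
    refine (Hf3_bd0 hm hm'.le ht).trans ?_
    have h2 : q / 2 ≤ Real.sqrt (2 * t + w ^ 2) := by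
      apply Real.le_sqrt_of_sq_le
      rw [div_pow, hq2]; linarith
    have h3 : Hf m t w ≤ 2 * Hf m t y := by
      unfold Hf
      calc (2 * t + w ^ 2) ^ (-m) ≤ ((2 * t + y ^ 2) / 4) ^ (-m) :=
            Real.rpow_le_rpow_of_nonpos (by positivity) h1 (by linarith)
        _ = (2 * t + y ^ 2) ^ (-m) * 4 ^ m := by
            rw [Real.div_rpow hB.le (by norm_num), Real.rpow_neg (by norm_num : (0:ℝ) ≤ 4)]
            field_simp
        _ ≤ (2 * t + y ^ 2) ^ (-m) * 2 := by
            gcongr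
            calc (4:ℝ) ^ m ≤ 4 ^ (1/2:ℝ) := Real.rpow_le_rpow_of_exponent_le (by norm_num) hm'.le
              _ = 2 := by
                rw [← Real.sqrt_eq_rpow, show (4:ℝ) = 2 ^ 2 by norm_num, Real.sqrt_sq (by norm_num)]
        _ = _ := by ring
    calc 24 * Hf m t w / Real.sqrt (2 * t + w ^ 2) ^ 3 ≤ 24 * (2 * Hf m t y) / (q / 2) ^ 3 := by
          have := hpos y
          gcongr
      _ = _ := by field_simp; ring
  have := taylor_low (M := 384 * Hf m t y) (u := u) (ρ := 2 * m) hq0 (by linarith) (by linarith)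
    (Hf_deriv m t ht) (Hf1_deriv m t ht) (Hf2_deriv m t ht) (Hf1_bd hm hm'.le ht)
    (Hf2_bd hm hm'.le ht) b3 (by linarith [hpos y, hpos (y + u)])
  rw [e] at this
  refine le_trans (le_of_eq ?_) this
  unfold Hf; ring

/-- decrease of `H` in time -/
lemma Hf_time {m t y v : ℝ} (hm : 0 < m) (hm' : m < 1 / 2) (ht : 0 < t) (hv : 0 ≤ v)
    (hvB : v ≤ (2 * t + y ^ 2) / 100) :
    Hf m (t + v) y + 7 / 4 * m * v * (2 * t + y ^ 2) ^ (-m - 1) ≤ Hf m t y := by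
  set B := 2 * t + y ^ 2 with hBd
  have hB : 0 < B := by positivity
  have hE : 2 * (t + v) + y ^ 2 = B + 2 * v := by rw [hBd]; ring
  unfold Hf
  rw [hE]
  set E := B + 2 * v
  have hEB : B ≤ E := by simp [E, hv]
  have hE0 : 0 < E := by linarith
  have h1 : E ^ (-m) * (1 + m * (1 - B / E)) ≤ B ^ (-m) := by
    have : B ^ (-m) = E ^ (-m) * (B / E) ^ (-m) := by
      rw [← Real.mul_rpow hE0.le (by positivity)]; congr 1; field_simp
    rw [this]
    gcongr
    rw [Real.rpow_def_of_pos (by positivity)]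
    have h2 := Real.add_one_le_exp (Real.log (B / E) * (-m))
    have h3 := Real.log_le_sub_one_of_pos (by positivity : 0 < B / E)
    nlinarith
  have h2 : E ^ (-m) = E * E ^ (-m - 1) := by
    nth_rewrite 2 [← Real.rpow_one E]
    rw [← Real.rpow_add hE0]; ring_nf
  have h3 : E ^ (-m) * (m * (1 - B / E)) = 2 * m * v * E ^ (-m - 1) := by
    rw [h2]; simp only [E]; field_simp; ring
  have h4 : 7 / 8 * B ^ (-m - 1) ≤ E ^ (-m - 1) := by
    calc 7 / 8 * B ^ (-m - 1) ≤ (1.02:ℝ) ^ (-m - 1) * B ^ (-m - 1) := by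
          gcongr
          calc (7/8:ℝ) ≤ 1.02 ^ (-2:ℝ) := by
                rw [Real.rpow_neg (by norm_num), show (2:ℝ) = ((2:ℕ):ℝ) by norm_num, Real.rpow_natCast]
                norm_num
            _ ≤ _ := Real.rpow_le_rpow_of_exponent_le (by norm_num) (by linarith)
      _ = (1.02 * B) ^ (-m - 1) := by rw [Real.mul_rpow (by norm_num) hB.le]
      _ ≤ _ := by
        apply Real.rpow_le_rpow_of_nonpos hE0 _ (by linarith)
        simp only [E]; linarith
  have h5 : 2 * m * v * (7 / 8 * B ^ (-m - 1)) ≤ 2 * m * v * E ^ (-m - 1) := by gcongr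
  nlinarith
end SNC


namespace SNC
open MeasureTheory Filter ProbabilityTheory
open scoped Topology ENNReal NNReal

/-- interval concentration comparison with the Gaussian up to `D` -/
def CB {Ω : Type} [MeasurableSpace Ω] (Q : Measure Ω) (Y : Ω → ℝ) (D : ℝ) : Prop :=
  ∀ a b, Q.real {ω | a ≤ Y ω ∧ Y ω ≤ b} ≤ gam.real (Set.Icc a b) + D

lemma layer_cake {Ω : Type} [MeasurableSpace Ω] {Q : Measure Ω} [IsProbabilityMeasure Q]
    {Y : Ω → ℝ} (hY : Measurable Y) {D : ℝ} (hCB : CB Q Y D) {f : ℝ → ℝ} (hf : Measurable f)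
    {M : ℝ} (hM : 0 ≤ M) (hf0 : ∀ y, 0 ≤ f y) (hfM : ∀ y, f y ≤ M)
    (hI : ∀ s, 0 < s → ∃ a b, {y | s ≤ f y} = Set.Icc a b) :
    ∫ ω, f (Y ω) ∂Q ≤ ∫ y, f y ∂gam + M * D := by
  have i1 : Integrable (fun ω => f (Y ω)) Q :=
    Integrable.of_bound (hf.comp hY).aestronglyMeasurable M
      (ae_of_all _ fun ω => by rw [Real.norm_eq_abs, abs_of_nonneg (hf0 _)]; exact hfM _)
  have i2 : Integrable f gam :=
    Integrable.of_bound hf.aestronglyMeasurable M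
      (ae_of_all _ fun ω => by rw [Real.norm_eq_abs, abs_of_nonneg (hf0 _)]; exact hfM _)
  rw [i1.integral_eq_integral_Ioc_meas_le (ae_of_all _ fun ω => hf0 _) (ae_of_all _ fun ω => hfM _),
    i2.integral_eq_integral_Ioc_meas_le (ae_of_all _ fun ω => hf0 _) (ae_of_all _ fun ω => hfM _)]
  have anti : ∀ {Ω' : Type} [MeasurableSpace Ω'] (μ : Measure Ω') [IsProbabilityMeasure μ] (h : Ω' → ℝ),
      IntegrableOn (fun t => μ.real {a | t ≤ h a}) (Set.Ioc 0 M) := by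
    intro Ω' _ μ _ h
    have : Antitone (fun t => μ.real {a | t ≤ h a}) := by
      intro s t hst
      exact measureReal_mono (fun a (ha : t ≤ h a) => hst.trans ha)
    refine Integrable.of_bound this.measurable.aestronglyMeasurable 1 (ae_of_all _ fun t => ?_)
    rw [Real.norm_eq_abs, abs_of_nonneg (by positivity)]
    exact measureReal_le_one
  have hc : M * D = ∫ t in Set.Ioc 0 M, D := by simp [hM]
  rw [hc, ← integral_add (anti gam f) (integrable_const _)]
  refine setIntegral_mono_on (anti Q _) ((anti gam f).add (integrable_const _)) measurableSet_Ioc ?_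
  intro s hs
  obtain ⟨a, b, hab⟩ := hI s hs.1
  rw [hab]
  have : {ω | s ≤ f (Y ω)} = {ω | a ≤ Y ω ∧ Y ω ≤ b} := by
    ext ω
    have := Set.ext_iff.1 hab (Y ω)
    simpa using this
  rw [this]
  exact hCB a b

/-- uniform bound for the singular Gaussian integral -/
lemma sing_int (ρ : ℝ) (hρ : 0 < ρ) (hρ' : ρ < 1) :
    ∃ C : ℝ, 0 < C ∧ ∀ κ c : ℝ, 0 < κ → ∫ y, (2 * κ ^ 2 + (y - c) ^ 2) ^ (-(ρ / 2)) ∂gam ≤ C := by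
  set k : ℝ → ℝ := (Set.Ioc (0:ℝ) 1).indicator (fun u => u ^ (-ρ)) with hk
  have hk0 : ∀ u, 0 ≤ k u := fun u => Set.indicator_nonneg (fun x hx => by
    have := hx.1; positivity) u
  have ik : Integrable k := by
    have := (intervalIntegral.intervalIntegrable_rpow' (a := 0) (b := 1) (r := -ρ) (by linarith)).1
    exact this.integrable_indicator measurableSet_Ioc
  refine ⟨1 + 2 * ∫ u, k u, by have := integral_nonneg (μ := volume) (show 0 ≤ k from hk0); linarith, ?_⟩
  intro κ c hκ
  rw [gam_integral]
  have j1 : Integrable (fun y => k (y - c)) := ik.comp_sub_right c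
  have j2 : Integrable (fun y => k (c - y)) := ik.comp_sub_left c
  have e1 : ∫ y, k (y - c) = ∫ u, k u := integral_sub_right_eq_self k c
  have e2 : ∫ y, k (c - y) = ∫ u, k u := integral_sub_left_eq_self k volume c
  have e3 : 1 + 2 * ∫ u, k u = ∫ y, (phi y + (k (y - c) + k (c - y))) := by
    rw [integral_add phi_integrable (j1.fun_add j2), integral_add j1 j2, integral_phi, e1, e2]; ring
  rw [e3]
  refine integral_mono_of_nonneg ?_ (phi_integrable.fun_add (j1.fun_add j2)) ?_
  · exact ae_of_all _ fun y => mul_nonneg (phi_pos y).le (by positivity)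
  · have : ∀ᵐ y : ℝ, y ≠ c := by simp [ae_iff]
    filter_upwards [this] with y hy
    have hu : y - c ≠ 0 := sub_ne_zero.2 hy
    have hpos : 0 < |y - c| := abs_pos.2 hu
    have hle : (2 * κ ^ 2 + (y - c) ^ 2) ^ (-(ρ / 2)) ≤ |y - c| ^ (-ρ) := by
      calc _ ≤ ((y - c) ^ 2) ^ (-(ρ / 2)) := by
            apply Real.rpow_le_rpow_of_nonpos (by positivity) _ (by linarith)
            have : 0 < κ ^ 2 := by positivity
            linarith
        _ = _ := by
          rw [← sq_abs, ← Real.rpow_natCast, ← Real.rpow_mul (abs_nonneg _)]; congr 1; push_cast; ring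
    have hp := phi_pos y
    have hp1 := phi_le_one y
    rcases le_total |y - c| 1 with h | h
    · have : |y - c| ^ (-ρ) ≤ k (y - c) + k (c - y) := by
        rcases lt_or_gt_of_ne hu with h' | h'
        · have : k (c - y) = |y - c| ^ (-ρ) := by
            rw [abs_of_neg h'] at h ⊢
            rw [hk, Set.indicator_of_mem (by constructor <;> linarith)]
            congr 1; ring
          rw [this]; linarith [hk0 (y - c)]
        · have : k (y - c) = |y - c| ^ (-ρ) := by
            rw [abs_of_pos h'] at h ⊢
            rw [hk, Set.indicator_of_mem (by constructor <;> linarith)]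
          rw [this]; linarith [hk0 (c - y)]
      have h0 : 0 ≤ (2 * κ ^ 2 + (y - c) ^ 2) ^ (-(ρ / 2)) := by positivity
      nlinarith
    · have h1 : |y - c| ^ (-ρ) ≤ 1 := Real.rpow_le_one_of_one_le_of_nonpos h (by linarith)
      have := hk0 (y - c)
      have := hk0 (c - y)
      nlinarith

lemma expo_int_left (a b r : ℝ) (hr : 0 < r) :
    ∫ y, (Set.Icc a b).indicator (fun y => Real.exp (-(y - a) / r)) y ∂gam ≤ r := by
  rw [gam_integral]
  have hi : IntegrableOn (fun y => Real.exp (a / r) * Real.exp (-(1/r) * y)) (Set.Ici a) :=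
    ((integrableOn_Ici_iff_integrableOn_Ioi (by simp)).2 (integrableOn_exp_mul_Ioi (by
      have : 0 < 1 / r := by positivity
      linarith) a)).const_mul _
  have hv : ∫ y in Set.Ici a, Real.exp (a / r) * Real.exp (-(1/r) * y) = r := by
    rw [integral_const_mul, integral_Ici_eq_integral_Ioi, integral_exp_mul_Ioi (by
      have : 0 < 1 / r := by positivity
      linarith)]
    rw [mul_div, mul_neg, ← Real.exp_add]
    have : a / r + -(1 / r) * a = 0 := by ring
    rw [this, Real.exp_zero]; field_simp
  refine le_of_le_of_eq ?_ hv
  rw [← integral_indicator measurableSet_Ici]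
  refine integral_mono_of_nonneg ?_ (hi.integrable_indicator measurableSet_Ici) ?_
  · exact ae_of_all _ fun y => mul_nonneg (phi_pos y).le (Set.indicator_nonneg (fun _ _ => (Real.exp_pos _).le) _)
  · refine ae_of_all _ fun y => ?_
    by_cases h : y ∈ Set.Icc a b
    · simp only [Set.indicator_of_mem h, Set.indicator_of_mem (show y ∈ Set.Ici a from h.1)]
      rw [← Real.exp_add]
      have : a / r + -(1 / r) * y = -(y - a) / r := by ring
      rw [this]
      have := phi_le_one y
      nlinarith [Real.exp_pos (-(y - a) / r)]
    · simp only [Set.indicator_of_notMem h, mul_zero]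
      exact Set.indicator_nonneg (fun _ _ => by positivity) _

lemma expo_int_right (a b r : ℝ) (hr : 0 < r) :
    ∫ y, (Set.Icc a b).indicator (fun y => Real.exp (-(b - y) / r)) y ∂gam ≤ r := by
  rw [gam_integral]
  have hpos : 0 < 1 / r := by positivity
  have hi : IntegrableOn (fun y => Real.exp (-b / r) * Real.exp ((1/r) * y)) (Set.Iic b) :=
    (integrableOn_exp_mul_Iic hpos b).const_mul _
  have hv : ∫ y in Set.Iic b, Real.exp (-b / r) * Real.exp ((1/r) * y) = r := by
    rw [integral_const_mul, integral_exp_mul_Iic hpos]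
    rw [mul_div, ← Real.exp_add]
    have : -b / r + (1 / r) * b = 0 := by ring
    rw [this, Real.exp_zero]; field_simp
  refine le_of_le_of_eq ?_ hv
  rw [← integral_indicator measurableSet_Iic]
  refine integral_mono_of_nonneg ?_ (hi.integrable_indicator measurableSet_Iic) ?_
  · exact ae_of_all _ fun y => mul_nonneg (phi_pos y).le (Set.indicator_nonneg (fun _ _ => (Real.exp_pos _).le) _)
  · refine ae_of_all _ fun y => ?_
    by_cases h : y ∈ Set.Icc a b
    · simp only [Set.indicator_of_mem h, Set.indicator_of_mem (show y ∈ Set.Iic b from h.2)]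
      rw [← Real.exp_add]
      have : -b / r + (1 / r) * y = -(b - y) / r := by ring
      rw [this]
      have := phi_le_one y
      nlinarith [Real.exp_pos (-(b - y) / r)]
    · simp only [Set.indicator_of_notMem h, mul_zero]
      exact Set.indicator_nonneg (fun _ _ => by positivity) _

/-- superlevel sets of truncated exponentials -/
lemma expo_superlevel_left (a b x s : ℝ) (hx : 0 ≤ x) (hs : 0 < s) :
    ∃ a' b', {y | s ≤ (Set.Icc a b).indicator (fun y => Real.exp (-x * (y - a))) y} = Set.Icc a' b' := by
  rcases hx.eq_or_lt with hx0 | hx0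
  · by_cases h : s ≤ 1
    · refine ⟨a, b, ?_⟩
      ext y
      by_cases hy : y ∈ Set.Icc a b
      · simp only [Set.mem_ofPred_eq, Set.indicator_of_mem hy, hy, ← hx0]
        simpa using h
      · simp only [Set.mem_ofPred_eq, Set.indicator_of_notMem hy, hy, iff_false, not_le]; exact hs
    · refine ⟨1, 0, ?_⟩
      rw [Set.Icc_eq_empty (a := (1:ℝ)) (b := 0) (by norm_num)]
      ext y
      simp only [Set.mem_ofPred_eq, Set.mem_empty_iff_false, iff_false, not_le]
      push Not at h
      by_cases hy : y ∈ Set.Icc a b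
      · rw [Set.indicator_of_mem hy, ← hx0]; simpa using h
      · rw [Set.indicator_of_notMem hy]; exact hs
  · refine ⟨a, min b (a - Real.log s / x), ?_⟩
    ext y
    by_cases hy : y ∈ Set.Icc a b
    · simp only [Set.mem_ofPred_eq, Set.indicator_of_mem hy, Set.mem_Icc, le_min_iff, hy.1, hy.2, true_and]
      rw [← Real.log_le_iff_le_exp hs, le_sub_comm, div_le_iff₀ hx0]
      constructor <;> intro h <;> linarith
    · simp only [Set.mem_ofPred_eq, Set.indicator_of_notMem hy]
      constructor
      · intro h; linarith
      · intro h; exact absurd ⟨h.1, h.2.trans (min_le_left _ _)⟩ hy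

lemma expo_superlevel_right (a b x s : ℝ) (hx : 0 < x) (hs : 0 < s) :
    ∃ a' b', {y | s ≤ (Set.Icc a b).indicator (fun y => Real.exp (-x * (b - y))) y} = Set.Icc a' b' := by
  refine ⟨max a (b + Real.log s / x), b, ?_⟩
  ext y
  by_cases hy : y ∈ Set.Icc a b
  · simp only [Set.mem_ofPred_eq, Set.indicator_of_mem hy, Set.mem_Icc, max_le_iff, hy.1, hy.2, true_and, and_true]
    rw [← Real.log_le_iff_le_exp hs, ← le_sub_iff_add_le', div_le_iff₀ hx]
    constructor <;> intro h <;> linarith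
  · simp only [Set.mem_ofPred_eq, Set.indicator_of_notMem hy]
    constructor
    · intro h; linarith
    · intro h; exact absurd ⟨(le_max_left _ _).trans h.1, h.2⟩ hy

lemma sing_superlevel (κ c p s : ℝ) (hκ : 0 < κ) (hp : 0 < p) (hs : 0 < s) :
    ∃ a' b', {y : ℝ | s ≤ (2 * κ ^ 2 + (y - c) ^ 2) ^ (-p)} = Set.Icc a' b' := by
  have key : ∀ y : ℝ, s ≤ (2 * κ ^ 2 + (y - c) ^ 2) ^ (-p) ↔ (y - c) ^ 2 ≤ s ^ (-(1/p)) - 2 * κ ^ 2 := by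
    intro y
    have hB : 0 < 2 * κ ^ 2 + (y - c) ^ 2 := by positivity
    have e : s = (s ^ (-(1/p))) ^ (-p) := by
      rw [← Real.rpow_mul hs.le]
      rw [show -(1/p) * -p = 1 by field_simp, Real.rpow_one]
    have hs' : 0 < s ^ (-(1/p)) := Real.rpow_pos_of_pos hs _
    nth_rewrite 1 [e]
    rw [Real.rpow_le_rpow_iff_of_neg hs' hB (by linarith)]
    constructor <;> intro h <;> linarith
  by_cases h : 0 ≤ s ^ (-(1/p)) - 2 * κ ^ 2
  · refine ⟨c - Real.sqrt (s ^ (-(1/p)) - 2 * κ ^ 2), c + Real.sqrt (s ^ (-(1/p)) - 2 * κ ^ 2), ?_⟩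
    ext y
    rw [Set.mem_ofPred_eq, key y, Real.sq_le h, Set.mem_Icc]
    constructor <;> rintro ⟨h1, h2⟩ <;> constructor <;> linarith
  · refine ⟨1, 0, ?_⟩
    rw [Set.Icc_eq_empty (a := (1:ℝ)) (b := 0) (by norm_num)]
    ext y
    simp only [Set.mem_ofPred_eq, key y, Set.mem_empty_iff_false, iff_false, not_le]
    nlinarith [sq_nonneg (y - c)]

end SNC


namespace SNC
open MeasureTheory Filter ProbabilityTheory
open scoped Topology ENNReal NNReal

/-- a.e. bounded functions -/
def AEB {Ω : Type} [MeasurableSpace Ω] (Q : Measure Ω) (G : Ω → ℝ) : Prop :=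
  ∃ K : ℝ, ∀ᵐ ω ∂Q, |G ω| ≤ K

section AEBlemmas
variable {Ω : Type} [MeasurableSpace Ω] {Q : Measure Ω} {G G' : Ω → ℝ}

lemma AEB.mul (h : AEB Q G) (h' : AEB Q G') : AEB Q (fun ω => G ω * G' ω) := by
  obtain ⟨K, hK⟩ := h
  obtain ⟨K', hK'⟩ := h'
  refine ⟨K * K', ?_⟩
  filter_upwards [hK, hK'] with ω h1 h2
  rw [abs_mul]
  exact mul_le_mul h1 h2 (abs_nonneg _) ((abs_nonneg _).trans h1)

lemma AEB.abs (h : AEB Q G) : AEB Q (fun ω => |G ω|) := by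
  obtain ⟨K, hK⟩ := h
  exact ⟨K, by simpa using hK⟩

lemma AEB.add (h : AEB Q G) (h' : AEB Q G') : AEB Q (fun ω => G ω + G' ω) := by
  obtain ⟨K, hK⟩ := h
  obtain ⟨K', hK'⟩ := h'
  refine ⟨K + K', ?_⟩
  filter_upwards [hK, hK'] with ω h1 h2
  exact (abs_add_le _ _).trans (add_le_add h1 h2)

lemma AEB.integrable [IsFiniteMeasure Q] (h : AEB Q G) (hm : Measurable G) : Integrable G Q := by
  obtain ⟨K, hK⟩ := h
  exact Integrable.of_bound hm.aestronglyMeasurable K hK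

lemma AEB.integrable_mul (h : AEB Q G) (hm : Measurable G) (h' : Integrable G' Q) :
    Integrable (fun ω => G ω * G' ω) Q := by
  obtain ⟨K, hK⟩ := h
  exact h'.bdd_mul hm.aestronglyMeasurable hK

lemma AEB.of_le (c : ℝ) (h : ∀ᵐ ω ∂Q, |G ω| ≤ c) : AEB Q G := ⟨c, h⟩
end AEBlemmas

/-- The data for the Berry-Esseen type estimate. -/
structure BEData {Ω : Type} [mΩ : MeasurableSpace Ω] (Q : Measure Ω) (n : ℕ)
    (F : ℕ → MeasurableSpace Ω) (ξ v : ℕ → Ω → ℝ) (ρ g δ : ℝ) : Prop where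
  F_mono : Monotone F
  F_le : ∀ k, F k ≤ mΩ
  xi_meas : ∀ k, k < n → Measurable[F (k + 1)] (ξ k)
  xi_int : ∀ k, k < n → Integrable (fun ω => |ξ k ω| ^ (2 + ρ)) Q
  v_meas : ∀ k, k < n → Measurable[F k] (v k)
  v_bd : ∀ k, k < n → ∀ᵐ ω ∂Q, 0 ≤ v k ω ∧ v k ω ≤ g ^ 2
  mean : ∀ k, k < n → ∀ G : Ω → ℝ, Measurable[F k] G → AEB Q G → ∫ ω, G ω * ξ k ω ∂Q = 0
  var : ∀ k, k < n → ∀ G : Ω → ℝ, Measurable[F k] G → AEB Q G →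
    |∫ ω, G ω * (ξ k ω ^ 2 - v k ω) ∂Q| ≤ g ^ ρ * ∫ ω, |G ω| * v k ω ∂Q
  mom : ∀ k, k < n → ∀ G : Ω → ℝ, Measurable[F k] G → AEB Q G →
    ∫ ω, |G ω| * |ξ k ω| ^ (2 + ρ) ∂Q ≤ g ^ ρ * ∫ ω, |G ω| * v k ω ∂Q
  sum : ∀ᵐ ω ∂Q, |∑ k ∈ Finset.range n, v k ω - 1| ≤ δ ^ 2

lemma abs_le_one_add_rpow {ρ : ℝ} (hρ : 0 < ρ) (u : ℝ) : |u| ≤ 1 + |u| ^ (2 + ρ) := by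
  rcases le_total |u| 1 with h | h
  · have : 0 ≤ |u| ^ (2 + ρ) := by positivity
    linarith
  · have : |u| ^ (1:ℝ) ≤ |u| ^ (2 + ρ) := Real.rpow_le_rpow_of_exponent_le h (by linarith)
    rw [Real.rpow_one] at this; linarith

lemma sq_le_one_add_rpow {ρ : ℝ} (hρ : 0 < ρ) (u : ℝ) : u ^ 2 ≤ 1 + |u| ^ (2 + ρ) := by
  rw [← sq_abs]
  rcases le_total |u| 1 with h | h
  · have : 0 ≤ |u| ^ (2 + ρ) := by positivity
    nlinarith [abs_nonneg u]
  · have : |u| ^ (2:ℝ) ≤ |u| ^ (2 + ρ) := Real.rpow_le_rpow_of_exponent_le h (by linarith)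
    rw [Real.rpow_two] at this; linarith

namespace BEData
variable {Ω : Type} [mΩ : MeasurableSpace Ω] {Q : Measure Ω} [IsProbabilityMeasure Q] {n : ℕ}
    {F : ℕ → MeasurableSpace Ω} {ξ v : ℕ → Ω → ℝ} {ρ g δ : ℝ}

lemma xi_meas' (D : BEData Q n F ξ v ρ g δ) {k : ℕ} (hk : k < n) : Measurable (ξ k) :=
  (D.xi_meas k hk).mono (D.F_le _) le_rfl

lemma v_meas' (D : BEData Q n F ξ v ρ g δ) {k : ℕ} (hk : k < n) : Measurable (v k) :=
  (D.v_meas k hk).mono (D.F_le _) le_rfl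

lemma xi_int1 (D : BEData Q n F ξ v ρ g δ) (hρ : 0 < ρ) {k : ℕ} (hk : k < n) : Integrable (ξ k) Q := by
  refine ((integrable_const (1:ℝ)).add (D.xi_int k hk)).mono' (D.xi_meas' hk).aestronglyMeasurable ?_
  exact ae_of_all _ fun ω => abs_le_one_add_rpow hρ _

lemma xi_int2 (D : BEData Q n F ξ v ρ g δ) (hρ : 0 < ρ) {k : ℕ} (hk : k < n) :
    Integrable (fun ω => ξ k ω ^ 2) Q := by
  refine ((integrable_const (1:ℝ)).add (D.xi_int k hk)).mono'
    ((D.xi_meas' hk).pow_const 2).aestronglyMeasurable ?_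
  exact ae_of_all _ fun ω => by
    rw [Real.norm_eq_abs, abs_of_nonneg (sq_nonneg _)]; exact sq_le_one_add_rpow hρ _

lemma v_aeb (D : BEData Q n F ξ v ρ g δ) {k : ℕ} (hk : k < n) : AEB Q (v k) := by
  refine ⟨g ^ 2, ?_⟩
  filter_upwards [D.v_bd k hk] with ω h
  rw [abs_of_nonneg h.1]; exact h.2

/-- the one step inequality -/
lemma one_step (D : BEData Q n F ξ v ρ g δ) (hρ : 0 < ρ) {k : ℕ} (hk : k < n)
    {f a0 a1 a2 R : Ω → ℝ} {c : ℝ} (hc : 0 ≤ c)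
    (m0 : Measurable[F k] a0) (m1 : Measurable[F k] a1) (m2 : Measurable[F k] a2)
    (mR : Measurable[F k] R) (b0 : AEB Q a0) (b1 : AEB Q a1) (b2 : AEB Q a2) (bR : AEB Q R)
    (hR : ∀ᵐ ω ∂Q, 0 ≤ R ω) (hf : Integrable f Q)
    (h : ∀ᵐ ω ∂Q, a0 ω + a1 ω * ξ k ω + a2 ω * ξ k ω ^ 2 - c * R ω * |ξ k ω| ^ (2 + ρ) ≤ f ω) :
    ∫ ω, a0 ω ∂Q + ∫ ω, a2 ω * v k ω ∂Q - g ^ ρ * ∫ ω, |a2 ω| * v k ω ∂Q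
      - c * (g ^ ρ * ∫ ω, R ω * v k ω ∂Q) ≤ ∫ ω, f ω ∂Q := by
  have M0 : Measurable a0 := m0.mono (D.F_le _) le_rfl
  have M1 : Measurable a1 := m1.mono (D.F_le _) le_rfl
  have M2 : Measurable a2 := m2.mono (D.F_le _) le_rfl
  have MR : Measurable R := mR.mono (D.F_le _) le_rfl
  have i0 := b0.integrable M0
  have i1 := b1.integrable_mul M1 (D.xi_int1 hρ hk)
  have i2 := b2.integrable_mul M2 (D.xi_int2 hρ hk)
  have i3 := bR.integrable_mul MR (D.xi_int k hk)
  have i2v := b2.integrable_mul M2 ((D.v_aeb hk).integrable (D.v_meas' hk))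
  have e1 := D.mean k hk a1 m1 b1
  have e2 := D.var k hk a2 m2 b2
  have e3 := D.mom k hk R mR bR
  have r1 : ∫ ω, |R ω| * |ξ k ω| ^ (2 + ρ) ∂Q = ∫ ω, R ω * |ξ k ω| ^ (2 + ρ) ∂Q := by
    apply integral_congr_ae; filter_upwards [hR] with ω h; rw [abs_of_nonneg h]
  have r2 : ∫ ω, |R ω| * v k ω ∂Q = ∫ ω, R ω * v k ω ∂Q := by
    apply integral_congr_ae; filter_upwards [hR] with ω h; rw [abs_of_nonneg h]
  rw [r1, r2] at e3
  have e4 : ∫ ω, a2 ω * (ξ k ω ^ 2 - v k ω) ∂Q = ∫ ω, a2 ω * ξ k ω ^ 2 ∂Q - ∫ ω, a2 ω * v k ω ∂Q := by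
    rw [← integral_sub i2 i2v]; congr 1; ext ω; ring
  rw [e4] at e2
  have main : ∫ ω, a0 ω ∂Q + ∫ ω, a1 ω * ξ k ω ∂Q + ∫ ω, a2 ω * ξ k ω ^ 2 ∂Q
      - c * ∫ ω, R ω * |ξ k ω| ^ (2 + ρ) ∂Q ≤ ∫ ω, f ω ∂Q := by
    have ii : Integrable (fun ω => a0 ω + a1 ω * ξ k ω + a2 ω * ξ k ω ^ 2
      - c * (R ω * |ξ k ω| ^ (2 + ρ))) Q := ((i0.fun_add i1).fun_add i2).sub (i3.const_mul c)
    have : ∫ ω, (a0 ω + a1 ω * ξ k ω + a2 ω * ξ k ω ^ 2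
      - c * (R ω * |ξ k ω| ^ (2 + ρ))) ∂Q = ∫ ω, a0 ω ∂Q + ∫ ω, a1 ω * ξ k ω ∂Q + ∫ ω, a2 ω * ξ k ω ^ 2 ∂Q
      - c * ∫ ω, R ω * |ξ k ω| ^ (2 + ρ) ∂Q := by
      rw [integral_sub ((i0.fun_add i1).fun_add i2) (i3.const_mul c), integral_add (i0.fun_add i1) i2,
        integral_add i0 i1, integral_const_mul]
    rw [← this]
    refine integral_mono_ae ii hf ?_
    filter_upwards [h] with ω hω
    linarith
  have e5 : c * ∫ ω, R ω * |ξ k ω| ^ (2 + ρ) ∂Q ≤ c * (g ^ ρ * ∫ ω, R ω * v k ω ∂Q) := by gcongr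
  rw [abs_le] at e2
  linarith [e2.1]

/-- partial sums -/
noncomputable def Y (ξ : ℕ → Ω → ℝ) (k : ℕ) (ω : Ω) : ℝ := ∑ i ∈ Finset.range k, ξ i ω

/-- remaining variance (plus smoothing) -/
noncomputable def T (v : ℕ → Ω → ℝ) (δ κ : ℝ) (k : ℕ) (ω : Ω) : ℝ :=
  1 + δ ^ 2 + κ ^ 2 - ∑ i ∈ Finset.range k, v i ω

lemma Y_succ (k : ℕ) (ω : Ω) : Y ξ (k + 1) ω = Y ξ k ω + ξ k ω := Finset.sum_range_succ _ _

lemma T_succ (κ : ℝ) (k : ℕ) (ω : Ω) : T v δ κ k ω = T v δ κ (k + 1) ω + v k ω := by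
  unfold T; rw [Finset.sum_range_succ]; ring

lemma Y_meas (D : BEData Q n F ξ v ρ g δ) {k : ℕ} (hk : k ≤ n) : Measurable[F k] (Y ξ k) := by
  unfold Y
  apply Finset.measurable_fun_sum
  intro i hi
  have hi' := Finset.mem_range.1 hi
  exact (D.xi_meas i (by omega)).mono (D.F_mono (by omega)) le_rfl

lemma T_meas (D : BEData Q n F ξ v ρ g δ) (κ : ℝ) {k : ℕ} (hk : k < n) :
    Measurable[F k] (T v δ κ (k + 1)) := by
  unfold T
  apply Measurable.const_sub
  apply Finset.measurable_fun_sum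
  intro i hi
  have hi' := Finset.mem_range.1 hi
  exact (D.v_meas i (by omega)).mono (D.F_mono (by omega)) le_rfl

lemma T_meas' (D : BEData Q n F ξ v ρ g δ) (κ : ℝ) {k : ℕ} (hk : k ≤ n) :
    Measurable (T v δ κ k) := by
  unfold T
  apply Measurable.const_sub
  apply Finset.measurable_fun_sum
  intro i hi
  have hi' := Finset.mem_range.1 hi
  exact D.v_meas' (by omega)

/-- a.e. range of `T` -/
lemma T_range (D : BEData Q n F ξ v ρ g δ) (hδ : 0 ≤ δ) (hδ1 : δ ≤ 1) (κ : ℝ) (hκ : 0 < κ) (hκ1 : κ ≤ 1) :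
    ∀ᵐ ω ∂Q, ∀ k ≤ n, κ ^ 2 ≤ T v δ κ k ω ∧ T v δ κ k ω ≤ 3 := by
  have hall : ∀ᵐ ω ∂Q, ∀ k, k < n → 0 ≤ v k ω ∧ v k ω ≤ g ^ 2 := by
    rw [ae_all_iff]; intro k; rw [ae_all_iff]; exact D.v_bd k
  filter_upwards [D.sum, hall] with ω hs hv k hk
  have h1 : ∑ i ∈ Finset.range k, v i ω ≤ ∑ i ∈ Finset.range n, v i ω := by
    apply Finset.sum_le_sum_of_subset_of_nonneg
    · intro i hi; simp at *; omega
    · intro i hi _; exact (hv i (Finset.mem_range.1 hi)).1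
  have h2 : 0 ≤ ∑ i ∈ Finset.range k, v i ω :=
    Finset.sum_nonneg fun i hi => (hv i (by have := Finset.mem_range.1 hi; omega)).1
  rw [abs_le] at hs
  unfold T
  constructor
  · linarith [hs.2]
  · nlinarith

lemma T_last (D : BEData Q n F ξ v ρ g δ) (κ : ℝ) :
    ∀ᵐ ω ∂Q, κ ^ 2 ≤ T v δ κ n ω ∧ T v δ κ n ω ≤ κ ^ 2 + 2 * δ ^ 2 := by
  filter_upwards [D.sum] with ω hs
  rw [abs_le] at hs
  unfold T
  constructor <;> linarith [hs.1, hs.2]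

/-- the weight -/
noncomputable def R (ξ v : ℕ → Ω → ℝ) (δ κ m c : ℝ) (k : ℕ) (ω : Ω) : ℝ :=
  (2 * T v δ κ (k + 1) ω + (Y ξ k ω - c) ^ 2) ^ (-m - 1)

lemma pair_meas (D : BEData Q n F ξ v ρ g δ) (κ c : ℝ) {k : ℕ} (hk : k < n) {f : ℝ × ℝ → ℝ}
    (hf : Measurable f) : Measurable[F k] (fun ω => f (T v δ κ (k + 1) ω, Y ξ k ω - c)) :=
  by
  have h2 : Measurable[F k] (fun ω => Y ξ k ω - c) := (D.Y_meas hk.le).sub_const c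
  have h : Measurable[F k] (fun ω => (T v δ κ (k + 1) ω, Y ξ k ω - c)) :=
    Measurable.prodMk (D.T_meas κ hk) h2
  exact hf.comp h

lemma pair_meas' (D : BEData Q n F ξ v ρ g δ) (κ c : ℝ) {k j : ℕ} (hk : k ≤ n) (hj : j ≤ n) {f : ℝ × ℝ → ℝ}
    (hf : Measurable f) : Measurable (fun ω => f (T v δ κ k ω, Y ξ j ω - c)) :=
  hf.comp ((D.T_meas' κ hk).prodMk
    (((D.Y_meas hj).mono (D.F_le _) le_rfl).sub_const c))

lemma pair_bd (D : BEData Q n F ξ v ρ g δ) (hδ : 0 ≤ δ) (hδ1 : δ ≤ 1) {κ : ℝ} (hκ : 0 < κ) (hκ1 : κ ≤ 1)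
    (c : ℝ) {k j : ℕ} (hk : k ≤ n) {f : ℝ × ℝ → ℝ} (K : ℝ)
    (h : ∀ t y, κ ^ 2 ≤ t → t ≤ 3 → |f (t, y)| ≤ K) :
    AEB Q (fun ω => f (T v δ κ k ω, Y ξ j ω - c)) := by
  refine ⟨K, ?_⟩
  filter_upwards [D.T_range hδ hδ1 κ hκ hκ1] with ω hω
  exact h _ _ (hω k hk).1 (hω k hk).2

end BEData
end SNC


set_option linter.unusedSectionVars false
set_option linter.unusedVariables false
namespace SNC
open MeasureTheory Filter ProbabilityTheory
open scoped Topology ENNReal NNReal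

lemma Bp_le {κ t y p : ℝ} (hκ : 0 < κ) (ht : κ ^ 2 ≤ t) (hp : p ≤ 0) :
    (2 * t + y ^ 2) ^ p ≤ (κ ^ 2) ^ p :=
  Real.rpow_le_rpow_of_nonpos (by positivity) (by nlinarith [sq_nonneg y, sq_nonneg κ]) hp

lemma sqrtB_ge {κ t y : ℝ} (hκ : 0 < κ) (ht : κ ^ 2 ≤ t) : κ ≤ Real.sqrt (2 * t + y ^ 2) :=
  Real.le_sqrt_of_sq_le (by nlinarith [sq_nonneg y, sq_nonneg κ])

lemma meas_BP (p : ℝ) : Measurable (fun q : ℝ × ℝ => (2 * q.1 + q.2 ^ 2) ^ p) := by fun_prop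
lemma meas_Hf (m : ℝ) : Measurable (fun q : ℝ × ℝ => Hf m q.1 q.2) := by unfold Hf; fun_prop
lemma meas_Hf1 (m : ℝ) : Measurable (fun q : ℝ × ℝ => Hf1 m q.1 q.2) := by unfold Hf1; fun_prop
lemma meas_Hf2 (m : ℝ) : Measurable (fun q : ℝ × ℝ => Hf2 m q.1 q.2 / 2) := by unfold Hf2; fun_prop
lemma meas_F0 : Measurable (fun q : ℝ × ℝ => stdNormalCDF (q.2 / Real.sqrt q.1)) :=
  cdf_cont.measurable.comp (by fun_prop)
lemma meas_phi : Measurable (fun q : ℝ × ℝ => phi (q.2 / Real.sqrt q.1)) :=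
  phi_cont.measurable.comp (by fun_prop)
lemma meas_F1 : Measurable (fun q : ℝ × ℝ => phi (q.2 / Real.sqrt q.1) / Real.sqrt q.1) :=
  meas_phi.div (by fun_prop)
lemma meas_F2 : Measurable (fun q : ℝ × ℝ =>
    (-(q.2 / Real.sqrt q.1) * phi (q.2 / Real.sqrt q.1) / q.1) / 2) :=
  ((Measurable.mul (by fun_prop) meas_phi).div (by fun_prop)).div_const 2

namespace BEData
variable {Ω : Type} [mΩ : MeasurableSpace Ω] {Q : Measure Ω} [IsProbabilityMeasure Q] {n : ℕ}
    {F : ℕ → MeasurableSpace Ω} {ξ v : ℕ → Ω → ℝ} {ρ g δ κ : ℝ}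

lemma R_meas (D : BEData Q n F ξ v ρ g δ) (κ m c : ℝ) {k : ℕ} (hk : k < n) :
    Measurable[F k] (R ξ v δ κ m c k) :=
  D.pair_meas κ c hk (meas_BP (-m - 1))

lemma R_aeb (D : BEData Q n F ξ v ρ g δ) (hδ : 0 ≤ δ) (hδ1 : δ ≤ 1) (hκ : 0 < κ) (hκ1 : κ ≤ 1)
    {m : ℝ} (hm : 0 < m) (c : ℝ) {k : ℕ} (hk : k < n) : AEB Q (R ξ v δ κ m c k) := by
  refine D.pair_bd hδ hδ1 hκ hκ1 c (f := fun q : ℝ × ℝ => (2 * q.1 + q.2 ^ 2) ^ (-m - 1))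
    (k := k + 1) (j := k) hk ((κ ^ 2) ^ (-m - 1)) fun t y h _ => ?_
  have : 0 < t := lt_of_lt_of_le (by positivity) h
  simp only
  rw [abs_of_nonneg (by positivity)]
  exact Bp_le hκ h (by linarith)

lemma R_nonneg (D : BEData Q n F ξ v ρ g δ) (hδ : 0 ≤ δ) (hδ1 : δ ≤ 1) (hκ : 0 < κ) (hκ1 : κ ≤ 1)
    (m c : ℝ) {k : ℕ} (hk : k < n) : ∀ᵐ ω ∂Q, 0 ≤ R ξ v δ κ m c k ω := by
  filter_upwards [D.T_range hδ hδ1 κ hκ hκ1] with ω hω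
  have h := (hω (k + 1) hk).1
  have : 0 < T v δ κ (k + 1) ω := lt_of_lt_of_le (by positivity) h
  unfold R
  positivity

lemma Rv_int (D : BEData Q n F ξ v ρ g δ) (hδ : 0 ≤ δ) (hδ1 : δ ≤ 1) (hκ : 0 < κ) (hκ1 : κ ≤ 1)
    {m : ℝ} (hm : 0 < m) (c : ℝ) {k : ℕ} (hk : k < n) :
    Integrable (fun ω => R ξ v δ κ m c k ω * v k ω) Q :=
  (D.R_aeb hδ hδ1 hκ hκ1 hm c hk).integrable_mul ((D.R_meas κ m c hk).mono (D.F_le _) le_rfl)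
    ((D.v_aeb hk).integrable (D.v_meas' hk))

lemma H_int (D : BEData Q n F ξ v ρ g δ) (hδ : 0 ≤ δ) (hδ1 : δ ≤ 1) (hκ : 0 < κ) (hκ1 : κ ≤ 1)
    {m : ℝ} (hm : 0 < m) (c : ℝ) {k j : ℕ} (hk : k ≤ n) (hj : j ≤ n) :
    AEB Q (fun ω => Hf m (T v δ κ k ω) (Y ξ j ω - c)) ∧
    Integrable (fun ω => Hf m (T v δ κ k ω) (Y ξ j ω - c)) Q := by
  have hb : AEB Q (fun ω => Hf m (T v δ κ k ω) (Y ξ j ω - c)) := by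
    refine D.pair_bd hδ hδ1 hκ hκ1 c (f := fun q : ℝ × ℝ => Hf m q.1 q.2)
      (k := k) (j := j) hk ((κ ^ 2) ^ (-m)) fun t y h _ => ?_
    have : 0 < t := lt_of_lt_of_le (by positivity) h
    simp only [Hf]
    rw [abs_of_nonneg (by positivity)]
    exact Bp_le hκ h (by linarith)
  exact ⟨hb, hb.integrable (D.pair_meas' κ c hk hj (meas_Hf m))⟩

lemma H_step (D : BEData Q n F ξ v ρ g δ) (hρ : 0 < ρ) (hρ' : ρ < 1) (hδ : 0 ≤ δ) (hδ1 : δ ≤ 1)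
    (hg : 0 < g) (hκ : 0 < κ) (hκ1 : κ ≤ 1) (hκg : 50 * g ^ 2 ≤ κ ^ 2) (hg32 : g ^ ρ ≤ 1 / 32)
    (hA : 4992 * (κ ^ (-ρ) * g ^ ρ) ≤ ρ / 16) (c : ℝ) {k : ℕ} (hk : k < n) :
    ∫ ω, Hf (ρ / 2) (T v δ κ k ω) (Y ξ k ω - c) ∂Q +
      ρ / 4 * ∫ ω, R ξ v δ κ (ρ / 2) c k ω * v k ω ∂Q ≤
      ∫ ω, Hf (ρ / 2) (T v δ κ (k + 1) ω) (Y ξ (k + 1) ω - c) ∂Q := by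
  set m := ρ / 2 with hm
  have hm0 : 0 < m := by positivity
  have hm1 : m < 1 / 2 := by rw [hm]; linarith
  have Rn := D.R_nonneg hδ hδ1 hκ hκ1 m c hk
  have iR := D.Rv_int hδ hδ1 hκ hκ1 hm0 c hk
  have hvi := (D.v_aeb hk).integrable (D.v_meas' hk)
  have b2 : AEB Q (fun ω => Hf2 m (T v δ κ (k + 1) ω) (Y ξ k ω - c) / 2) := by
    refine D.pair_bd hδ hδ1 hκ hκ1 c (f := fun q : ℝ × ℝ => Hf2 m q.1 q.2 / 2)
      (k := k + 1) (j := k) hk (8 * m * (κ ^ 2) ^ (-m - 1)) fun t y h _ => ?_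
    have ht : 0 < t := lt_of_lt_of_le (by positivity) h
    have h1 := Hf2_bd' (y := y) hm0 hm1.le ht
    have h2 := Bp_le (y := y) (p := -m - 1) hκ h (by linarith)
    simp only
    rw [abs_div, abs_two]
    have h3 : 8 * m * (2 * t + y ^ 2) ^ (-m - 1) ≤ 8 * m * (κ ^ 2) ^ (-m - 1) := by gcongr
    have := abs_nonneg (Hf2 m t y)
    linarith
  have b1 : AEB Q (fun ω => Hf1 m (T v δ κ (k + 1) ω) (Y ξ k ω - c)) := by
    refine D.pair_bd hδ hδ1 hκ hκ1 c (f := fun q : ℝ × ℝ => Hf1 m q.1 q.2)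
      (k := k + 1) (j := k) hk (384 * (κ ^ 2) ^ (-m) / κ) fun t y h _ => ?_
    have ht : 0 < t := lt_of_lt_of_le (by positivity) h
    refine (Hf1_bd (y := y) hm0 hm1.le ht).trans ?_
    have h2 := Bp_le (y := y) (p := -m) hκ h (by linarith)
    have h3 := sqrtB_ge (y := y) hκ h
    unfold Hf
    gcongr
  have m2 := D.pair_meas κ c hk (meas_Hf2 m)
  have os := D.one_step hρ hk (f := fun ω => Hf m (T v δ κ (k + 1) ω) (Y ξ (k + 1) ω - c))
    (c := 4992 * κ ^ (-ρ)) (by positivity)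
    (D.pair_meas κ c hk (meas_Hf m)) (D.pair_meas κ c hk (meas_Hf1 m))
    m2 (D.R_meas κ m c hk)
    (D.H_int hδ hδ1 hκ hκ1 hm0 c hk hk.le).1 b1 b2 (D.R_aeb hδ hδ1 hκ hκ1 hm0 c hk) Rn
    (D.H_int hδ hδ1 hκ hκ1 hm0 c hk hk).2 (by
      filter_upwards [D.T_range hδ hδ1 κ hκ hκ1, Rn] with ω hω hR
      have h := (hω (k + 1) hk).1
      have ht : 0 < T v δ κ (k + 1) ω := lt_of_lt_of_le (by positivity) h
      have := Hf_taylor (y := Y ξ k ω - c) (u := ξ k ω) hm0 hm1 ht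
      rw [show 2 + 2 * m = 2 + ρ by rw [hm]; ring] at this
      rw [Y_succ, show Y ξ k ω + ξ k ω - c = Y ξ k ω - c + ξ k ω by ring]
      refine le_trans ?_ this
      have h2 := Bp_le (y := Y ξ k ω - c) (p := -m) hκ h (by linarith)
      have h3 : (κ ^ 2) ^ (-m) = κ ^ (-ρ) := by
        rw [← Real.rpow_natCast, ← Real.rpow_mul hκ.le]; congr 1; rw [hm]; push_cast; ring
      rw [h3] at h2
      have h4 : (2 * T v δ κ (k + 1) ω + (Y ξ k ω - c) ^ 2) ^ (-m - 1) = R ξ v δ κ m c k ω := rfl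
      rw [h4]
      have : 4992 * ((2 * T v δ κ (k + 1) ω + (Y ξ k ω - c) ^ 2) ^ (-m) * R ξ v δ κ m c k ω) *
        |ξ k ω| ^ (2 + ρ) ≤ 4992 * (κ ^ (-ρ) * R ξ v δ κ m c k ω) * |ξ k ω| ^ (2 + ρ) := by gcongr
      linarith)
  have e1 : -m * ∫ ω, R ξ v δ κ m c k ω * v k ω ∂Q ≤
      ∫ ω, Hf2 m (T v δ κ (k + 1) ω) (Y ξ k ω - c) / 2 * v k ω ∂Q := by
    rw [← integral_const_mul]
    refine integral_mono_ae (iR.const_mul _) (b2.integrable_mul (m2.mono (D.F_le _) le_rfl) hvi) ?_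
    filter_upwards [D.T_range hδ hδ1 κ hκ hκ1, D.v_bd k hk] with ω hω hv
    have h := (hω (k + 1) hk).1
    have ht : 0 < T v δ κ (k + 1) ω := lt_of_lt_of_le (by positivity) h
    have h1 := Hf2_lower (y := Y ξ k ω - c) hm0 hm1.le ht
    have h4 : (2 * T v δ κ (k + 1) ω + (Y ξ k ω - c) ^ 2) ^ (-m - 1) = R ξ v δ κ m c k ω := rfl
    rw [h4] at h1
    have := mul_le_mul_of_nonneg_right h1 hv.1
    linarith
  have e2 : ∫ ω, |Hf2 m (T v δ κ (k + 1) ω) (Y ξ k ω - c) / 2| * v k ω ∂Q ≤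
      4 * m * ∫ ω, R ξ v δ κ m c k ω * v k ω ∂Q := by
    rw [← integral_const_mul]
    refine integral_mono_ae (b2.abs.integrable_mul (m2.mono (D.F_le _) le_rfl).abs hvi) (iR.const_mul _) ?_
    filter_upwards [D.T_range hδ hδ1 κ hκ hκ1, D.v_bd k hk] with ω hω hv
    have h := (hω (k + 1) hk).1
    have ht : 0 < T v δ κ (k + 1) ω := lt_of_lt_of_le (by positivity) h
    have h1 := Hf2_bd' (y := Y ξ k ω - c) hm0 hm1.le ht
    have h4 : (2 * T v δ κ (k + 1) ω + (Y ξ k ω - c) ^ 2) ^ (-m - 1) = R ξ v δ κ m c k ω := rfl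
    rw [h4] at h1
    have := mul_le_mul_of_nonneg_right h1 hv.1
    rw [abs_div, abs_two]
    linarith
  have e3 : ∫ ω, Hf m (T v δ κ k ω) (Y ξ k ω - c) ∂Q + 7 / 4 * m * ∫ ω, R ξ v δ κ m c k ω * v k ω ∂Q ≤
      ∫ ω, Hf m (T v δ κ (k + 1) ω) (Y ξ k ω - c) ∂Q := by
    have i1 := (D.H_int hδ hδ1 hκ hκ1 hm0 c hk.le hk.le).2
    rw [← integral_const_mul, ← integral_add i1 (iR.const_mul _)]
    refine integral_mono_ae (i1.add (iR.const_mul _)) (D.H_int hδ hδ1 hκ hκ1 hm0 c hk hk.le).2 ?_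
    filter_upwards [D.T_range hδ hδ1 κ hκ hκ1, D.v_bd k hk] with ω hω hv
    have h := (hω (k + 1) hk).1
    have ht : 0 < T v δ κ (k + 1) ω := lt_of_lt_of_le (by positivity) h
    have := Hf_time (y := Y ξ k ω - c) (v := v k ω) hm0 hm1 ht hv.1 (by
      nlinarith [sq_nonneg (Y ξ k ω - c)])
    rw [← T_succ] at this
    have h4 : (2 * T v δ κ (k + 1) ω + (Y ξ k ω - c) ^ 2) ^ (-m - 1) = R ξ v δ κ m c k ω := rfl
    rw [h4] at this
    linarith
  have I0 : 0 ≤ ∫ ω, R ξ v δ κ m c k ω * v k ω ∂Q := by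
    apply integral_nonneg_of_ae
    filter_upwards [Rn, D.v_bd k hk] with ω h1 h2
    exact mul_nonneg h1 h2.1
  set I := ∫ ω, R ξ v δ κ m c k ω * v k ω ∂Q
  have hgp : 0 < g ^ ρ := by positivity
  have e4 : g ^ ρ * ∫ ω, |Hf2 m (T v δ κ (k + 1) ω) (Y ξ k ω - c) / 2| * v k ω ∂Q ≤ m / 8 * I := by
    calc _ ≤ g ^ ρ * (4 * m * I) := by gcongr
      _ ≤ 1 / 32 * (4 * m * I) := by gcongr
      _ = _ := by ring
  have e5 : 4992 * κ ^ (-ρ) * (g ^ ρ * I) ≤ m / 8 * I := by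
    calc _ = 4992 * (κ ^ (-ρ) * g ^ ρ) * I := by ring
      _ ≤ ρ / 16 * I := by gcongr
      _ = _ := by rw [hm]; ring
  have e6 : ρ / 4 * I = m / 2 * I := by rw [hm]; ring
  rw [e6]
  nlinarith

lemma H_sum (D : BEData Q n F ξ v ρ g δ) (hρ : 0 < ρ) (hρ' : ρ < 1) (hδ : 0 ≤ δ) (hδ1 : δ ≤ 1)
    (hg : 0 < g) (hκ : 0 < κ) (hκ1 : κ ≤ 1) (hκg : 50 * g ^ 2 ≤ κ ^ 2) (hg32 : g ^ ρ ≤ 1 / 32)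
    (hA : 4992 * (κ ^ (-ρ) * g ^ ρ) ≤ ρ / 16) (c : ℝ) :
    ρ / 4 * ∑ k ∈ Finset.range n, ∫ ω, R ξ v δ κ (ρ / 2) c k ω * v k ω ∂Q ≤
      ∫ ω, (2 * κ ^ 2 + (Y ξ n ω - c) ^ 2) ^ (-(ρ / 2)) ∂Q := by
  have hm0 : 0 < ρ / 2 := by positivity
  have step : ∀ k ≤ n, ρ / 4 * ∑ k ∈ Finset.range k, ∫ ω, R ξ v δ κ (ρ / 2) c k ω * v k ω ∂Q ≤
      ∫ ω, Hf (ρ / 2) (T v δ κ k ω) (Y ξ k ω - c) ∂Q := by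
    intro k
    induction k with
    | zero =>
      intro _
      simp only [Finset.range_zero, Finset.sum_empty, mul_zero]
      apply integral_nonneg_of_ae
      filter_upwards [D.T_range hδ hδ1 κ hκ hκ1] with ω hω
      have h := (hω 0 (Nat.zero_le _)).1
      have ht : 0 < T v δ κ 0 ω := lt_of_lt_of_le (by positivity) h
      show 0 ≤ Hf _ _ _
      unfold Hf; positivity
    | succ k ih =>
      intro hk
      rw [Finset.sum_range_succ, mul_add]
      have := D.H_step hρ hρ' hδ hδ1 hg hκ hκ1 hκg hg32 hA c (k := k) hk
      linarith [ih (by omega)]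
  refine (step n le_rfl).trans ?_
  refine integral_mono_ae (D.H_int hδ hδ1 hκ hκ1 hm0 c le_rfl le_rfl).2 ?_ ?_
  · refine Integrable.of_bound (C := (κ ^ 2) ^ (-(ρ / 2))) ?_ (ae_of_all _ fun ω => ?_)
    · have : Measurable (Y ξ n) := (D.Y_meas le_rfl).mono (D.F_le _) le_rfl
      exact Measurable.aestronglyMeasurable (by fun_prop)
    · rw [Real.norm_eq_abs, abs_of_nonneg (by positivity)]
      exact Bp_le hκ le_rfl (by linarith)
  · filter_upwards [D.T_range hδ hδ1 κ hκ hκ1] with ω hω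
    have h := (hω n le_rfl).1
    unfold Hf
    exact Real.rpow_le_rpow_of_nonpos (by positivity) (by linarith) (by linarith)

lemma F_step (D : BEData Q n F ξ v ρ g δ) (hρ : 0 < ρ) (hρ' : ρ < 1) (hδ : 0 ≤ δ) (hδ1 : δ ≤ 1)
    (hg : 0 < g) (hκ : 0 < κ) (hκ1 : κ ≤ 1) (hκg : 50 * g ^ 2 ≤ κ ^ 2) (c : ℝ) {k : ℕ} (hk : k < n) :
    |∫ ω, stdNormalCDF ((Y ξ (k + 1) ω - c) / Real.sqrt (T v δ κ (k + 1) ω)) ∂Q -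
      ∫ ω, stdNormalCDF ((Y ξ k ω - c) / Real.sqrt (T v δ κ k ω)) ∂Q| ≤
      5325000 * g ^ ρ * ∫ ω, R ξ v δ κ (ρ / 2) c k ω * v k ω ∂Q := by
  set m := ρ / 2 with hm
  have hm0 : 0 < m := by positivity
  have hm1 : m < 1 / 2 := by rw [hm]; linarith
  have Rn := D.R_nonneg hδ hδ1 hκ hκ1 m c hk
  have iR := D.Rv_int hδ hδ1 hκ hκ1 hm0 c hk
  have hvi := (D.v_aeb hk).integrable (D.v_meas' hk)
  have hgp : 0 < g ^ ρ := by positivity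
  have b0 : ∀ i j : ℕ, AEB Q (fun ω => stdNormalCDF ((Y ξ j ω - c) / Real.sqrt (T v δ κ i ω))) := by
    intro i j
    exact ⟨1, ae_of_all _ fun ω => by
      rw [abs_of_nonneg (cdf_nonneg _)]; exact cdf_le_one _⟩
  have m0' : ∀ i ≤ n, ∀ j ≤ n, Measurable (fun ω => stdNormalCDF ((Y ξ j ω - c) / Real.sqrt (T v δ κ i ω))) :=
    fun i hi j hj => D.pair_meas' κ c hi hj meas_F0
  have m0 := D.pair_meas κ c hk meas_F0
  have m1 := D.pair_meas κ c hk meas_F1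
  have m2 := D.pair_meas κ c hk meas_F2
  have b1 : AEB Q (fun ω => phi ((Y ξ k ω - c) / Real.sqrt (T v δ κ (k+1) ω)) / Real.sqrt (T v δ κ (k+1) ω)) := by
    refine D.pair_bd hδ hδ1 hκ hκ1 c (f := fun q : ℝ × ℝ => phi (q.2 / Real.sqrt q.1) / Real.sqrt q.1)
      (k := k + 1) (j := k) hk (50000 / κ) fun t y h _ => ?_
    have ht : 0 < t := lt_of_lt_of_le (by positivity) h
    refine (F_bounds (y := y) ht).1.trans ?_
    have h3 := sqrtB_ge (y := y) hκ h
    gcongr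
  have b2 : AEB Q (fun ω => (-((Y ξ k ω - c) / Real.sqrt (T v δ κ (k+1) ω)) *
      phi ((Y ξ k ω - c) / Real.sqrt (T v δ κ (k+1) ω)) / (T v δ κ (k+1) ω)) / 2) := by
    refine D.pair_bd hδ hδ1 hκ hκ1 c (f := fun q : ℝ × ℝ =>
        (-(q.2 / Real.sqrt q.1) * phi (q.2 / Real.sqrt q.1) / q.1) / 2)
      (k := k + 1) (j := k) hk (50000 / κ ^ 2) fun t y h _ => ?_
    have ht : 0 < t := lt_of_lt_of_le (by positivity) h
    have h1 := (F_bounds (y := y) ht).2.1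
    have h3 := sqrtB_ge (y := y) hκ h
    have h4 : 50000 / Real.sqrt (2 * t + y ^ 2) ^ 2 ≤ 50000 / κ ^ 2 := by gcongr
    simp only
    rw [abs_div, abs_two]
    linarith [abs_nonneg (-(y / Real.sqrt t) * phi (y / Real.sqrt t) / t)]
  have i0 : ∀ i ≤ n, ∀ j ≤ n, Integrable (fun ω => stdNormalCDF ((Y ξ j ω - c) / Real.sqrt (T v δ κ i ω))) Q :=
    fun i hi j hj => (b0 i j).integrable (m0' i hi j hj)
  have tay : ∀ᵐ ω ∂Q, |stdNormalCDF ((Y ξ (k+1) ω - c) / Real.sqrt (T v δ κ (k+1) ω))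
      - stdNormalCDF ((Y ξ k ω - c) / Real.sqrt (T v δ κ (k+1) ω))
      - phi ((Y ξ k ω - c) / Real.sqrt (T v δ κ (k+1) ω)) / Real.sqrt (T v δ κ (k+1) ω) * ξ k ω
      - (-((Y ξ k ω - c) / Real.sqrt (T v δ κ (k+1) ω)) *
      phi ((Y ξ k ω - c) / Real.sqrt (T v δ κ (k+1) ω)) / (T v δ κ (k+1) ω)) / 2 * ξ k ω ^ 2| ≤
      5200000 * R ξ v δ κ m c k ω * |ξ k ω| ^ (2 + ρ) := by
    filter_upwards [D.T_range hδ hδ1 κ hκ hκ1] with ω hω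
    have h := (hω (k + 1) hk).1
    have ht : 0 < T v δ κ (k + 1) ω := lt_of_lt_of_le (by positivity) h
    have := F_taylor (y := Y ξ k ω - c) (u := ξ k ω) ht hρ hρ'
    rw [show (-1 - ρ / 2) = -m - 1 by rw [hm]; ring] at this
    rw [Y_succ, show Y ξ k ω + ξ k ω - c = Y ξ k ω - c + ξ k ω by ring]
    exact this
  have tim : ∀ᵐ ω ∂Q, |stdNormalCDF ((Y ξ k ω - c) / Real.sqrt (T v δ κ k ω))
      - stdNormalCDF ((Y ξ k ω - c) / Real.sqrt (T v δ κ (k+1) ω))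
      - (-((Y ξ k ω - c) / Real.sqrt (T v δ κ (k+1) ω)) *
      phi ((Y ξ k ω - c) / Real.sqrt (T v δ κ (k+1) ω)) / (T v δ κ (k+1) ω)) / 2 * v k ω| ≤
      50000 * g ^ ρ * (R ξ v δ κ m c k ω * v k ω) := by
    filter_upwards [D.T_range hδ hδ1 κ hκ hκ1, D.v_bd k hk] with ω hω hv
    have h := (hω (k + 1) hk).1
    have ht : 0 < T v δ κ (k + 1) ω := lt_of_lt_of_le (by positivity) h
    have := F_time (y := Y ξ k ω - c) ht hv.1
    rw [← T_succ] at this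
    refine this.trans ?_
    unfold R
    have hBg : g ^ 2 ≤ 2 * T v δ κ (k + 1) ω + (Y ξ k ω - c) ^ 2 := by
      nlinarith [sq_nonneg (Y ξ k ω - c)]
    set B := 2 * T v δ κ (k + 1) ω + (Y ξ k ω - c) ^ 2
    have hB : 0 < B := lt_of_lt_of_le (by positivity) hBg
    have h1 : v k ω ≤ g ^ ρ * B ^ (1 - m) := by
      have e : g ^ 2 = g ^ ρ * (g ^ 2) ^ (1 - m) := by
        rw [← Real.rpow_natCast, ← Real.rpow_mul hg.le, ← Real.rpow_add hg]
        congr 1; rw [hm]; push_cast; ring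
      calc v k ω ≤ g ^ 2 := hv.2
        _ = g ^ ρ * (g ^ 2) ^ (1 - m) := e
        _ ≤ _ := by gcongr; linarith
    have e2 : B ^ (1 - m) = B ^ 2 * B ^ (-m - 1) := by
      rw [← Real.rpow_natCast B 2, ← Real.rpow_add hB]; congr 1; push_cast; ring
    rw [e2] at h1
    have hB2 : 0 < B ^ 2 := by positivity
    rw [div_le_iff₀ hB2]
    calc 50000 * v k ω ^ 2 = 50000 * v k ω * v k ω := by ring
      _ ≤ 50000 * v k ω * (g ^ ρ * (B ^ 2 * B ^ (-m - 1))) := by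
        have := hv.1
        gcongr
      _ = _ := by ring
  have a2b : ∀ᵐ ω ∂Q, |(-((Y ξ k ω - c) / Real.sqrt (T v δ κ (k+1) ω)) *
      phi ((Y ξ k ω - c) / Real.sqrt (T v δ κ (k+1) ω)) / (T v δ κ (k+1) ω)) / 2| ≤
      75000 * R ξ v δ κ m c k ω := by
    filter_upwards [D.T_range hδ hδ1 κ hκ hκ1] with ω hω
    have h := (hω (k + 1) hk).1
    have ht : 0 < T v δ κ (k + 1) ω := lt_of_lt_of_le (by positivity) h
    have := F2_bound (y := Y ξ k ω - c) ht (hω (k + 1) hk).2 hρ hρ'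
    rw [show (-1 - ρ / 2) = -m - 1 by rw [hm]; ring] at this
    rw [abs_div, abs_two]
    unfold R
    linarith
  have I0 : 0 ≤ ∫ ω, R ξ v δ κ m c k ω * v k ω ∂Q := by
    apply integral_nonneg_of_ae
    filter_upwards [Rn, D.v_bd k hk] with ω h1 h2
    exact mul_nonneg h1 h2.1
  have M2 := m2.mono (D.F_le _) le_rfl
  set a0 := fun ω => stdNormalCDF ((Y ξ k ω - c) / Real.sqrt (T v δ κ (k+1) ω)) with ha0
  set a1 := fun ω => phi ((Y ξ k ω - c) / Real.sqrt (T v δ κ (k+1) ω)) / Real.sqrt (T v δ κ (k+1) ω) with ha1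
  set a2 := fun ω => (-((Y ξ k ω - c) / Real.sqrt (T v δ κ (k+1) ω)) *
      phi ((Y ξ k ω - c) / Real.sqrt (T v δ κ (k+1) ω)) / (T v δ κ (k+1) ω)) / 2 with ha2
  set f := fun ω => stdNormalCDF ((Y ξ (k + 1) ω - c) / Real.sqrt (T v δ κ (k + 1) ω)) with hf
  set f0 := fun ω => stdNormalCDF ((Y ξ k ω - c) / Real.sqrt (T v δ κ k ω)) with hf0
  have i2v : Integrable (fun ω => a2 ω * v k ω) Q := b2.integrable_mul M2 hvi
  have if_ : Integrable f Q := i0 _ hk _ hk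
  have if0 : Integrable f0 Q := i0 _ hk.le _ hk.le
  have ia0 : Integrable a0 Q := i0 _ hk _ hk.le
  have Ra := D.R_aeb hδ hδ1 hκ hκ1 hm0 c hk
  have lo := D.one_step hρ hk (f := f) (a0 := a0) (a1 := a1) (a2 := a2) (c := 5200000) (by norm_num)
    m0 m1 m2 (D.R_meas κ m c hk) (b0 _ _) b1 b2 Ra Rn if_ (by
      filter_upwards [tay] with ω h
      have := (abs_le.1 h).1
      simp only [ha0, ha1, ha2, hf]
      linarith)
  have neg : ∀ {G : Ω → ℝ}, AEB Q G → AEB Q (fun ω => - G ω) := by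
    rintro G ⟨K, hK⟩
    exact ⟨K, by simpa using hK⟩
  have hi := D.one_step hρ hk (f := fun ω => - f ω) (a0 := fun ω => - a0 ω) (a1 := fun ω => - a1 ω)
    (a2 := fun ω => - a2 ω) (c := 5200000) (by norm_num)
    m0.neg m1.neg m2.neg (D.R_meas κ m c hk) (neg (b0 _ _)) (neg b1) (neg b2) Ra Rn if_.neg (by
      filter_upwards [tay] with ω h
      have := (abs_le.1 h).2
      simp only [ha0, ha1, ha2, hf]
      linarith)
  simp only [abs_neg, neg_mul, integral_neg] at hi
  have e2 : ∫ ω, |a2 ω| * v k ω ∂Q ≤ 75000 * ∫ ω, R ξ v δ κ m c k ω * v k ω ∂Q := by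
    rw [← integral_const_mul]
    refine integral_mono_ae (b2.abs.integrable_mul M2.abs hvi) (iR.const_mul _) ?_
    filter_upwards [a2b, D.v_bd k hk] with ω h hv
    have := mul_le_mul_of_nonneg_right h hv.1
    simp only [ha2]
    linarith
  have e3 : |∫ ω, f0 ω ∂Q - ∫ ω, a0 ω ∂Q - ∫ ω, a2 ω * v k ω ∂Q| ≤
      50000 * g ^ ρ * ∫ ω, R ξ v δ κ m c k ω * v k ω ∂Q := by
    have id : Integrable (fun ω => f0 ω - a0 ω) Q := if0.sub ia0
    rw [← integral_sub if0 ia0, ← integral_sub id i2v, ← integral_const_mul]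
    refine (abs_integral_le_integral_abs).trans ?_
    refine integral_mono_ae (id.sub i2v).abs (iR.const_mul _) ?_
    exact tim
  set I := ∫ ω, R ξ v δ κ m c k ω * v k ω ∂Q
  have e4 : g ^ ρ * ∫ ω, |a2 ω| * v k ω ∂Q ≤ g ^ ρ * (75000 * I) := by gcongr
  rw [abs_le] at e3 ⊢
  constructor <;> linarith [e3.1, e3.2]

lemma core (D : BEData Q n F ξ v ρ g δ) (hρ : 0 < ρ) (hρ' : ρ < 1) (hδ : 0 ≤ δ) (hδ1 : δ ≤ 1)
    (hg : 0 < g) (hκ : 0 < κ) (hκ1 : κ ≤ 1) (hκg : 50 * g ^ 2 ≤ κ ^ 2) (hg32 : g ^ ρ ≤ 1 / 32)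
    (hA : 4992 * (κ ^ (-ρ) * g ^ ρ) ≤ ρ / 16) (c : ℝ) :
    |∫ ω, stdNormalCDF ((Y ξ n ω - c) / Real.sqrt (T v δ κ n ω)) ∂Q -
      stdNormalCDF (-c / Real.sqrt (1 + δ ^ 2 + κ ^ 2))| ≤
      (21300000 / ρ) * g ^ ρ * ∫ ω, (2 * κ ^ 2 + (Y ξ n ω - c) ^ 2) ^ (-(ρ / 2)) ∂Q := by
  have step : ∀ k ≤ n, |∫ ω, stdNormalCDF ((Y ξ k ω - c) / Real.sqrt (T v δ κ k ω)) ∂Q -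
      stdNormalCDF (-c / Real.sqrt (1 + δ ^ 2 + κ ^ 2))| ≤
      5325000 * g ^ ρ * ∑ k ∈ Finset.range k, ∫ ω, R ξ v δ κ (ρ / 2) c k ω * v k ω ∂Q := by
    intro k
    induction k with
    | zero =>
      intro _
      simp [Y, T]
    | succ k ih =>
      intro hk
      rw [Finset.sum_range_succ, mul_add]
      have h1 := D.F_step hρ hρ' hδ hδ1 hg hκ hκ1 hκg c (k := k) hk
      have h2 := ih (by omega)
      rw [abs_le] at h1 h2 ⊢
      constructor <;> linarith [h1.1, h1.2, h2.1, h2.2]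
  refine (step n le_rfl).trans ?_
  have := D.H_sum hρ hρ' hδ hδ1 hg hκ hκ1 hκg hg32 hA c
  have hgp : 0 < g ^ ρ := by positivity
  have h4 : 0 < ρ / 4 := by positivity
  have h3 := (le_div_iff₀' h4).2 this
  calc _ ≤ 5325000 * g ^ ρ * ((∫ ω, (2 * κ ^ 2 + (Y ξ n ω - c) ^ 2) ^ (-(ρ / 2)) ∂Q) / (ρ / 4)) := by
        gcongr
    _ = _ := by field_simp; ring

end BEData
end SNC


set_option linter.unusedSectionVars false
set_option linter.unusedVariables false
namespace SNC
open MeasureTheory Filter ProbabilityTheory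
open scoped Topology ENNReal NNReal

lemma cdf_time_one {y w : ℝ} (hw : 0 ≤ w) (hw2 : w ≤ 2) :
    |stdNormalCDF (y / Real.sqrt (1 + w)) - stdNormalCDF y| ≤ 37500 * w := by
  have h1 := F_time (t := 1) (y := y) one_pos hw
  have h2 := (F_bounds (t := 1) (y := y) one_pos).2.1
  rw [Real.sq_sqrt (by positivity)] at h2
  rw [Real.sqrt_one] at h1 h2
  simp only [div_one, mul_one] at h1 h2
  have h3 : 50000 / (2 + y ^ 2) ≤ 25000 := by
    rw [div_le_iff₀ (by positivity)]; nlinarith [sq_nonneg y]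
  have h4 : 50000 * w ^ 2 / (2 + y ^ 2) ^ 2 ≤ 25000 * w := by
    rw [div_le_iff₀ (by positivity)]
    have : (4:ℝ) ≤ (2 + y ^ 2) ^ 2 := by nlinarith [sq_nonneg y]
    nlinarith [mul_le_mul_of_nonneg_left this hw]
  have h5 : |(-y * phi y) / 2 * w| ≤ 12500 * w := by
    rw [abs_mul, abs_div, abs_two, abs_of_nonneg hw]
    nlinarith
  rw [abs_le] at *
  constructor <;> linarith [h1.1, h1.2, h5.1, h5.2]

lemma exp_neg_aux : Real.exp (1 / 2 - 4) ≤ 1 / 16 := by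
  have : Real.exp (1/2 - 4) = (Real.exp 1)⁻¹ ^ 3 * Real.exp (-(1/2)) := by
    rw [← Real.exp_neg, ← Real.exp_nat_mul, ← Real.exp_add]; norm_num
  rw [this]
  have h1 : (Real.exp 1)⁻¹ ≤ 1 / 2.718 := by
    rw [inv_eq_one_div]; gcongr; linarith [Real.exp_one_gt_d9]
  have h2 : Real.exp (-(1/2)) ≤ 1 := Real.exp_le_one_iff.2 (by norm_num)
  have h0 : 0 < (Real.exp 1)⁻¹ := by positivity
  calc (Real.exp 1)⁻¹ ^ 3 * Real.exp (-(1/2)) ≤ (1/2.718) ^ 3 * 1 := by gcongr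
    _ ≤ 1 / 16 := by norm_num

lemma smooth_pt {y a b r T : ℝ} (hr : 0 < r) (hab : a ≤ b) (hT : 0 < T) (hTr : Real.sqrt T ≤ r) :
    (Set.Icc a b).indicator (fun _ => (1:ℝ)) y ≤
      stdNormalCDF ((y - (a - 4 * r)) / Real.sqrt T) - stdNormalCDF ((y - (b + 4 * r)) / Real.sqrt T)
      + 1 / 16 * ((Set.Icc a b).indicator (fun y => Real.exp (-(1 / r) * (y - a))) y
        + (Set.Icc a b).indicator (fun y => Real.exp (-(1 / r) * (b - y))) y) := by
  have hs : 0 < Real.sqrt T := Real.sqrt_pos.2 hT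
  by_cases hy : y ∈ Set.Icc a b
  · simp only [Set.indicator_of_mem hy]
    have key : ∀ z, 0 ≤ z → 1 - stdNormalCDF ((z + 4 * r) / Real.sqrt T) ≤ 1 / 16 * Real.exp (-(1 / r) * z) := by
      intro z hz
      have h1 : z / r + 4 ≤ (z + 4 * r) / Real.sqrt T := by
        rw [show z / r + 4 = (z + 4 * r) / r by field_simp]
        gcongr
      have h2 := cdf_mono h1
      have h3 := chernoff (z / r + 4)
      rw [show 1 / 2 - (z / r + 4) = (1 / 2 - 4) + (-(1 / r) * z) by ring, Real.exp_add] at h3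
      have h4 := mul_le_mul_of_nonneg_right exp_neg_aux (Real.exp_pos (-(1 / r) * z)).le
      linarith
    have k1 := key (y - a) (by linarith [hy.1])
    have k2 := key (b - y) (by linarith [hy.2])
    rw [show y - (a - 4 * r) = y - a + 4 * r by ring,
      show (y - (b + 4 * r)) / Real.sqrt T = -((b - y + 4 * r) / Real.sqrt T) by ring, cdf_neg]
    linarith
  · simp only [Set.indicator_of_notMem hy]
    have : (y - (b + 4 * r)) / Real.sqrt T ≤ (y - (a - 4 * r)) / Real.sqrt T := by
      gcongr; linarith
    linarith [cdf_mono this]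

namespace BEData
variable {Ω : Type} [mΩ : MeasurableSpace Ω] {Q : Measure Ω} [IsProbabilityMeasure Q] {n : ℕ}
    {F : ℕ → MeasurableSpace Ω} {ξ v : ℕ → Ω → ℝ} {ρ g δ κ : ℝ}

lemma improve (D : BEData Q n F ξ v ρ g δ) (hρ : 0 < ρ) (hρ' : ρ < 1) (hδ : 0 ≤ δ) (hδ1 : δ ≤ 1)
    (hg : 0 < g) (hκ : 0 < κ) (hκ1 : κ ≤ 1) (hκg : 50 * g ^ 2 ≤ κ ^ 2) (hg32 : g ^ ρ ≤ 1 / 32)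
    (hA : 4992 * (κ ^ (-ρ) * g ^ ρ) ≤ ρ / 16) (hA2 : (21300000 / ρ) * (κ ^ (-ρ) * g ^ ρ) ≤ 1 / 16)
    {C D0 : ℝ} (hC0 : 0 < C) (hC : ∀ κ c : ℝ, 0 < κ → ∫ y, (2 * κ ^ 2 + (y - c) ^ 2) ^ (-(ρ / 2)) ∂gam ≤ C)
    (hD0 : 0 ≤ D0) (hCB : CB Q (Y ξ n) D0) :
    CB Q (Y ξ n) (D0 / 4 + (2 * (21300000 / ρ) * C * g ^ ρ + 75020 * (κ + 2 * δ))) := by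
  have hgp : 0 < g ^ ρ := by positivity
  intro a b
  rcases lt_or_ge b a with hab | hab
  · have : {ω | a ≤ Y ξ n ω ∧ Y ξ n ω ≤ b} = ∅ := by
      ext ω; simp only [Set.mem_ofPred_eq, Set.mem_empty_iff_false, iff_false]; intro h; linarith [h.1, h.2]
    rw [this, measureReal_empty]
    have : 0 ≤ gam.real (Set.Icc a b) := measureReal_nonneg
    positivity
  have hYm : Measurable (Y ξ n) := (D.Y_meas le_rfl).mono (D.F_le _) le_rfl
  set r := Real.sqrt (κ ^ 2 + 2 * δ ^ 2) with hr
  have hr0 : 0 < r := Real.sqrt_pos.2 (by positivity)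
  have hrle : r ≤ κ + 2 * δ := by
    rw [hr, Real.sqrt_le_left (by positivity)]; nlinarith [mul_nonneg hκ.le hδ]
  set K := 21300000 / ρ with hK
  have hK0 : 0 < K := by positivity
  -- singular integral
  have sing : ∀ c, K * g ^ ρ * ∫ ω, (2 * κ ^ 2 + (Y ξ n ω - c) ^ 2) ^ (-(ρ / 2)) ∂Q ≤ K * C * g ^ ρ + D0 / 16 := by
    intro c
    have h1 := layer_cake hYm hCB (f := fun y => (2 * κ ^ 2 + (y - c) ^ 2) ^ (-(ρ / 2)))
      (by fun_prop) (M := κ ^ (-ρ)) (by positivity) (fun y => by positivity)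
      (fun y => by
        refine (Bp_le hκ le_rfl (by linarith)).trans (le_of_eq ?_)
        rw [← Real.rpow_natCast, ← Real.rpow_mul hκ.le]; congr 1; push_cast; ring)
      (fun s hs => sing_superlevel κ c (ρ / 2) s hκ (by positivity) hs)
    have h2 := hC κ c hκ
    calc _ ≤ K * g ^ ρ * (C + κ ^ (-ρ) * D0) := by gcongr; linarith
      _ = K * C * g ^ ρ + K * (κ ^ (-ρ) * g ^ ρ) * D0 := by ring
      _ ≤ K * C * g ^ ρ + 1 / 16 * D0 := by gcongr
      _ = _ := by ring
  have c1 := (D.core hρ hρ' hδ hδ1 hg hκ hκ1 hκg hg32 hA (a - 4 * r)).trans (sing _)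
  have c2 := (D.core hρ hρ' hδ hδ1 hg hκ hκ1 hκg hg32 hA (b + 4 * r)).trans (sing _)
  have hw2 : δ ^ 2 + κ ^ 2 ≤ 2 := by nlinarith
  have t1 := cdf_time_one (y := -(a - 4 * r)) (w := δ ^ 2 + κ ^ 2) (by positivity) hw2
  have t2 := cdf_time_one (y := -(b + 4 * r)) (w := δ ^ 2 + κ ^ 2) (by positivity) hw2
  rw [← add_assoc] at t1 t2
  -- exponentials
  have lb : ∀ y, (Set.Icc a b).indicator (fun y => Real.exp (-(1 / r) * (y - a))) y ≤ 1 := by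
    intro y
    by_cases hy : y ∈ Set.Icc a b
    · rw [Set.indicator_of_mem hy, Real.exp_le_one_iff]
      have : 0 ≤ 1 / r * (y - a) := mul_nonneg (by positivity) (by linarith [hy.1])
      linarith
    · rw [Set.indicator_of_notMem hy]; norm_num
  have rb : ∀ y, (Set.Icc a b).indicator (fun y => Real.exp (-(1 / r) * (b - y))) y ≤ 1 := by
    intro y
    by_cases hy : y ∈ Set.Icc a b
    · rw [Set.indicator_of_mem hy, Real.exp_le_one_iff]
      have : 0 ≤ 1 / r * (b - y) := mul_nonneg (by positivity) (by linarith [hy.2])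
      linarith
    · rw [Set.indicator_of_notMem hy]; norm_num
  have l0 : ∀ y, 0 ≤ (Set.Icc a b).indicator (fun y => Real.exp (-(1 / r) * (y - a))) y :=
    fun y => Set.indicator_nonneg (fun _ _ => (Real.exp_pos _).le) y
  have r0 : ∀ y, 0 ≤ (Set.Icc a b).indicator (fun y => Real.exp (-(1 / r) * (b - y))) y :=
    fun y => Set.indicator_nonneg (fun _ _ => (Real.exp_pos _).le) y
  have lm : Measurable ((Set.Icc a b).indicator (fun y => Real.exp (-(1 / r) * (y - a)))) :=
    Measurable.indicator (by fun_prop) measurableSet_Icc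
  have rm : Measurable ((Set.Icc a b).indicator (fun y => Real.exp (-(1 / r) * (b - y)))) :=
    Measurable.indicator (by fun_prop) measurableSet_Icc
  have L := layer_cake hYm hCB lm zero_le_one l0 lb
    (fun s hs => expo_superlevel_left a b (1 / r) s (by positivity) hs)
  have Rr := layer_cake hYm hCB rm zero_le_one r0 rb
    (fun s hs => expo_superlevel_right a b (1 / r) s (by positivity) hs)
  have L2 := expo_int_left a b r hr0
  have R2 := expo_int_right a b r hr0
  rw [show (fun y : ℝ => Real.exp (-(y - a) / r)) = fun y => Real.exp (-(1 / r) * (y - a)) by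
    ext y; congr 1; ring] at L2
  rw [show (fun y : ℝ => Real.exp (-(b - y) / r)) = fun y => Real.exp (-(1 / r) * (b - y)) by
    ext y; congr 1; ring] at R2
  -- integrability
  have bdi : ∀ {f : Ω → ℝ}, Measurable f → (∀ ω, 0 ≤ f ω) → (∀ ω, f ω ≤ 1) → Integrable f Q := by
    intro f hf h0 h1
    exact Integrable.of_bound hf.aestronglyMeasurable 1 (ae_of_all _ fun ω => by
      rw [Real.norm_eq_abs, abs_of_nonneg (h0 ω)]; exact h1 ω)
  have ic : ∀ c, Integrable (fun ω => stdNormalCDF ((Y ξ n ω - c) / Real.sqrt (T v δ κ n ω))) Q := fun c =>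
    bdi (D.pair_meas' κ c le_rfl le_rfl meas_F0) (fun ω => cdf_nonneg _) (fun ω => cdf_le_one _)
  have il := bdi (lm.comp hYm) (fun ω => l0 _) (fun ω => lb _)
  have ir := bdi (rm.comp hYm) (fun ω => r0 _) (fun ω => rb _)
  have iind : Integrable (fun ω => (Set.Icc a b).indicator (fun _ => (1:ℝ)) (Y ξ n ω)) Q := by
    refine bdi ((Measurable.indicator measurable_const measurableSet_Icc).comp hYm) (fun ω => ?_) (fun ω => ?_)
    · exact Set.indicator_nonneg (fun _ _ => zero_le_one) _
    · exact Set.indicator_le_self' (f := fun _ => (1:ℝ)) (fun _ _ => zero_le_one) _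
  have eQ : Q.real {ω | a ≤ Y ξ n ω ∧ Y ξ n ω ≤ b} =
      ∫ ω, (Set.Icc a b).indicator (fun _ => (1:ℝ)) (Y ξ n ω) ∂Q := by
    have hms : MeasurableSet {ω | a ≤ Y ξ n ω ∧ Y ξ n ω ≤ b} := hYm measurableSet_Icc
    rw [← integral_indicator_one hms]
    rfl
  have main : ∫ ω, (Set.Icc a b).indicator (fun _ => (1:ℝ)) (Y ξ n ω) ∂Q ≤
      ∫ ω, stdNormalCDF ((Y ξ n ω - (a - 4 * r)) / Real.sqrt (T v δ κ n ω)) ∂Q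
      - ∫ ω, stdNormalCDF ((Y ξ n ω - (b + 4 * r)) / Real.sqrt (T v δ κ n ω)) ∂Q
      + 1 / 16 * (∫ ω, (Set.Icc a b).indicator (fun y => Real.exp (-(1 / r) * (y - a))) (Y ξ n ω) ∂Q
        + ∫ ω, (Set.Icc a b).indicator (fun y => Real.exp (-(1 / r) * (b - y))) (Y ξ n ω) ∂Q) := by
    have il' : Integrable (fun ω => (Set.Icc a b).indicator (fun y => Real.exp (-(1 / r) * (y - a))) (Y ξ n ω)) Q := il
    have ir' : Integrable (fun ω => (Set.Icc a b).indicator (fun y => Real.exp (-(1 / r) * (b - y))) (Y ξ n ω)) Q := ir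
    have is1 : Integrable (fun ω => stdNormalCDF ((Y ξ n ω - (a - 4 * r)) / Real.sqrt (T v δ κ n ω))
      - stdNormalCDF ((Y ξ n ω - (b + 4 * r)) / Real.sqrt (T v δ κ n ω))) Q :=
      (ic (a - 4 * r)).sub (ic (b + 4 * r))
    have is2 : Integrable (fun ω => 1 / 16 * ((Set.Icc a b).indicator (fun y => Real.exp (-(1 / r) * (y - a))) (Y ξ n ω)
        + (Set.Icc a b).indicator (fun y => Real.exp (-(1 / r) * (b - y))) (Y ξ n ω))) Q :=
      (il'.add ir').const_mul (1 / 16)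
    rw [← integral_add il' ir', ← integral_const_mul, ← integral_sub (ic _) (ic _), ← integral_add is1 is2]
    refine integral_mono_ae iind (is1.add is2) ?_
    filter_upwards [D.T_last κ] with ω hω
    exact smooth_pt hr0 hab (lt_of_lt_of_le (by positivity) hω.1) (by
      rw [hr]; exact Real.sqrt_le_sqrt hω.2)
  rw [eQ, gam_Icc hab]
  have lip1 := cdf_lip (a := b) (b := b + 4 * r) (by linarith)
  have lip2 := cdf_lip (a := a - 4 * r) (b := a) (by linarith)
  rw [cdf_neg (a - 4 * r)] at t1
  rw [cdf_neg (b + 4 * r)] at t2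
  have hw3 : δ ^ 2 + κ ^ 2 ≤ κ + δ := by nlinarith
  rw [abs_le] at c1 c2 t1 t2
  linarith [c1.1, c1.2, c2.1, c2.2, t1.1, t1.2, t2.1, t2.2]

end BEData

/-- The Berry-Esseen type theorem. -/
theorem berry_esseen (ρ : ℝ) (hρ : 0 < ρ) (hρ' : ρ < 1) :
    ∃ C g0 : ℝ, 0 < C ∧ 0 < g0 ∧ ∀ {Ω : Type} [mΩ : MeasurableSpace Ω] {Q : Measure Ω}
      [IsProbabilityMeasure Q] {n : ℕ} {F : ℕ → MeasurableSpace Ω} {ξ v : ℕ → Ω → ℝ} {g δ : ℝ}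
      (_ : BEData Q n F ξ v ρ g δ), 0 < g → g ≤ g0 → 0 ≤ δ → δ ≤ 1 →
      CB Q (fun ω => ∑ i ∈ Finset.range n, ξ i ω) (C * (g ^ ρ + δ)) := by
  obtain ⟨C, hC0, hC⟩ := sing_int ρ hρ hρ'
  set K := 21300000 / ρ with hK
  have hK0 : 0 < K := by positivity
  set M := max (16 * K) (79872 / ρ) with hM
  have hM0 : 0 < M := lt_of_lt_of_le (by positivity) (le_max_left _ _)
  set A := max 8 (M ^ (1 / ρ)) with hA
  have hA8 : 8 ≤ A := le_max_left _ _
  have hA0 : 0 < A := by linarith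
  have hAM : M ≤ A ^ ρ := by
    have h1 : M = (M ^ (1 / ρ)) ^ ρ := by
      rw [← Real.rpow_mul hM0.le]; rw [one_div, inv_mul_cancel₀ hρ.ne', Real.rpow_one]
    calc M = (M ^ (1 / ρ)) ^ ρ := h1
      _ ≤ _ := by gcongr; exact le_max_right _ _
  have hAp : 0 < A ^ ρ := by positivity
  refine ⟨2 * (2 * K * C + 75020 * (A + 2)), min (1 / A) ((1 / 32) ^ (1 / ρ)), by positivity, by positivity, ?_⟩
  intro Ω mΩ Q _ n F ξ v g δ D hg hg0 hδ hδ1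
  have hgA : g ≤ 1 / A := hg0.trans (min_le_left _ _)
  have hg1 : g ≤ 1 := hgA.trans (by rw [div_le_one hA0]; linarith)
  have hg32 : g ^ ρ ≤ 1 / 32 := by
    have h1 : g ≤ (1 / 32) ^ (1 / ρ) := hg0.trans (min_le_right _ _)
    calc g ^ ρ ≤ ((1 / 32) ^ (1 / ρ)) ^ ρ := by gcongr
      _ = 1 / 32 := by rw [← Real.rpow_mul (by norm_num), one_div ρ, inv_mul_cancel₀ hρ.ne', Real.rpow_one]
  set κ := A * g with hκd
  have hκ : 0 < κ := by positivity
  have hκ1 : κ ≤ 1 := by rw [hκd, mul_comm]; exact (le_div_iff₀ hA0).1 hgA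
  have e1 : κ ^ (-ρ) * g ^ ρ = (A ^ ρ)⁻¹ := by
    rw [Real.rpow_neg hκ.le, hκd, Real.mul_rpow hA0.le hg.le]
    have : 0 < g ^ ρ := by positivity
    field_simp
  have h50 : 50 * g ^ 2 ≤ κ ^ 2 := by
    rw [hκd, mul_pow]; gcongr; nlinarith
  have a1 : 4992 * (κ ^ (-ρ) * g ^ ρ) ≤ ρ / 16 := by
    rw [e1, ← div_eq_mul_inv, div_le_iff₀ hAp]
    have h1 : 79872 / ρ ≤ A ^ ρ := (le_max_right _ _).trans hAM
    rw [div_le_iff₀ hρ] at h1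
    linarith
  have a2 : K * (κ ^ (-ρ) * g ^ ρ) ≤ 1 / 16 := by
    rw [e1, ← div_eq_mul_inv, div_le_iff₀ hAp]
    have h1 : 16 * K ≤ A ^ ρ := (le_max_left _ _).trans hAM
    linarith
  set E := 2 * K * C * g ^ ρ + 75020 * (κ + 2 * δ) with hE
  have hE0 : 0 ≤ E := by positivity
  have it : ∀ k : ℕ, CB Q (BEData.Y ξ n) ((1 / 4) ^ k + 2 * E) := by
    intro k
    induction k with
    | zero =>
      intro a b
      have h1 : Q.real {ω | a ≤ BEData.Y ξ n ω ∧ BEData.Y ξ n ω ≤ b} ≤ 1 := measureReal_le_one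
      have h2 : 0 ≤ gam.real (Set.Icc a b) := measureReal_nonneg
      rw [pow_zero]; linarith
    | succ k ih =>
      have := D.improve hρ hρ' hδ hδ1 hg hκ hκ1 h50 hg32 a1 a2 hC0 hC (by positivity) ih
      intro a b
      refine (this a b).trans ?_
      rw [pow_succ]
      have hp : (0:ℝ) ≤ (1/4)^k := by positivity
      linarith
  have hfin : CB Q (BEData.Y ξ n) (2 * E) := by
    intro a b
    have ht : Tendsto (fun k : ℕ => gam.real (Set.Icc a b) + ((1 / 4 : ℝ) ^ k + 2 * E)) atTop
        (𝓝 (gam.real (Set.Icc a b) + (0 + 2 * E))) :=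
      tendsto_const_nhds.add ((tendsto_pow_atTop_nhds_zero_of_lt_one (by norm_num) (by norm_num)).add
        tendsto_const_nhds)
    rw [zero_add] at ht
    exact ge_of_tendsto' ht fun k => it k a b
  intro a b
  refine (hfin a b).trans ?_
  have hgg : g ≤ g ^ ρ := by
    calc g = g ^ (1:ℝ) := (Real.rpow_one g).symm
      _ ≤ g ^ ρ := Real.rpow_le_rpow_of_exponent_ge hg hg1 hρ'.le
  have : E ≤ (2 * K * C + 75020 * (A + 2)) * (g ^ ρ + δ) := by
    rw [hE]
    have h1 : κ ≤ A * g ^ ρ := by rw [hκd]; gcongr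
    have h2 : 0 ≤ g ^ ρ := by positivity
    have h3 : 0 ≤ K * C * δ := by positivity
    have h4 : 0 ≤ A * δ := by positivity
    nlinarith
  linarith

end SNC


set_option linter.unusedSectionVars false
set_option linter.unusedVariables false
namespace SNC
open MeasureTheory Filter ProbabilityTheory
open scoped Topology ENNReal NNReal

/-- conditional expectation of a function of `U k` -/
noncomputable def cw {Ω : Type} [mΩ : MeasurableSpace Ω] (P : Measure Ω) (F : ℕ → MeasurableSpace Ω)
    (U : ℕ → Ω → ℝ) (ψ : ℝ → ℝ) (k : ℕ) : Ω → ℝ := P[fun ω => ψ (U k ω)|F k]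

/-- conditional variances -/
noncomputable def vv {Ω : Type} [mΩ : MeasurableSpace Ω] (P : Measure Ω) (F : ℕ → MeasurableSpace Ω)
    (U : ℕ → Ω → ℝ) (k : ℕ) : Ω → ℝ := P[fun ω => U k ω ^ 2|F k]

/-- conditional absolute moments -/
noncomputable def bb {Ω : Type} [mΩ : MeasurableSpace Ω] (P : Measure Ω) (F : ℕ → MeasurableSpace Ω)
    (U : ℕ → Ω → ℝ) (ρ : ℝ) (k : ℕ) : Ω → ℝ := P[fun ω => |U k ω| ^ (2 + ρ)|F k]

/-- martingale difference data, to be tilted -/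
structure TD {Ω : Type} [mΩ : MeasurableSpace Ω] (P : Measure Ω) (n : ℕ)
    (F : ℕ → MeasurableSpace Ω) (U : ℕ → Ω → ℝ) (ρ g Λ N δ : ℝ) : Prop where
  rho_pos : 0 < ρ
  rho_lt : ρ < 1
  g_pos : 0 < g
  g_le : g ≤ 1
  F_mono : Monotone F
  F_le : ∀ k, F k ≤ mΩ
  meas : ∀ k, k < n → Measurable[F (k + 1)] (U k)
  int : ∀ k, k < n → Integrable (fun ω => |U k ω| ^ (2 + ρ)) P
  mean : ∀ k, k < n → P[U k|F k] =ᵐ[P] 0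
  bet : ∀ k, k < n → ∀ᵐ ω ∂P, bb P F U ρ k ω ≤ g ^ ρ * vv P F U k ω
  lam : ∀ᵐ ω ∂P, ∑ k ∈ Finset.range n, bb P F U ρ k ω ≤ Λ
  var : ∀ᵐ ω ∂P, |∑ k ∈ Finset.range n, vv P F U k ω - N| ≤ N * δ ^ 2

namespace TD
variable {Ω : Type} [mΩ : MeasurableSpace Ω] {P : Measure Ω} [IsProbabilityMeasure P] {n : ℕ}
    {F : ℕ → MeasurableSpace Ω} {U : ℕ → Ω → ℝ} {ρ g Λ N δ : ℝ}

lemma meas' (D : TD P n F U ρ g Λ N δ) {k : ℕ} (hk : k < n) : Measurable (U k) :=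
  (D.meas k hk).mono (D.F_le _) le_rfl

lemma int1 (D : TD P n F U ρ g Λ N δ) {k : ℕ} (hk : k < n) : Integrable (U k) P := by
  refine ((integrable_const (1:ℝ)).add (D.int k hk)).mono' (D.meas' hk).aestronglyMeasurable ?_
  exact ae_of_all _ fun ω => abs_le_one_add_rpow D.rho_pos _

lemma int2 (D : TD P n F U ρ g Λ N δ) {k : ℕ} (hk : k < n) :
    Integrable (fun ω => U k ω ^ 2) P := by
  refine ((integrable_const (1:ℝ)).add (D.int k hk)).mono'
    ((D.meas' hk).pow_const 2).aestronglyMeasurable ?_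
  exact ae_of_all _ fun ω => by
    rw [Real.norm_eq_abs, abs_of_nonneg (sq_nonneg _)]; exact sq_le_one_add_rpow D.rho_pos _

lemma lin_int (D : TD P n F U ρ g Λ N δ) {k : ℕ} (hk : k < n) (c0 c1 c2 c3 : ℝ) :
    Integrable (fun ω => c0 + c1 * U k ω + c2 * U k ω ^ 2 + c3 * |U k ω| ^ (2 + ρ)) P :=
  (((integrable_const c0).add ((D.int1 hk).const_mul c1)).add ((D.int2 hk).const_mul c2)).add
    ((D.int k hk).const_mul c3)

lemma lin (D : TD P n F U ρ g Λ N δ) {k : ℕ} (hk : k < n) (c0 c1 c2 c3 : ℝ) :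
    P[fun ω => c0 + c1 * U k ω + c2 * U k ω ^ 2 + c3 * |U k ω| ^ (2 + ρ)|F k] =ᵐ[P]
      fun ω => c0 + c2 * vv P F U k ω + c3 * bb P F U ρ k ω := by
  have i0 : Integrable (fun _ : Ω => c0) P := integrable_const c0
  have i1 : Integrable (c1 • U k) P := (D.int1 hk).const_mul c1
  have i2 : Integrable (c2 • fun ω => U k ω ^ 2) P := (D.int2 hk).const_mul c2
  have i3 : Integrable (c3 • fun ω => |U k ω| ^ (2 + ρ)) P := (D.int k hk).const_mul c3
  have h1 := condExp_add ((i0.add i1).add i2) i3 (F k)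
  have h2 := condExp_add (i0.add i1) i2 (F k)
  have h3 := condExp_add i0 i1 (F k)
  have s1 := condExp_smul c1 (U k) (F k) (μ := P)
  have s2 := condExp_smul c2 (fun ω => U k ω ^ 2) (F k) (μ := P)
  have s3 := condExp_smul c3 (fun ω => |U k ω| ^ (2 + ρ)) (F k) (μ := P)
  have hc : P[fun _ : Ω => c0|F k] = fun _ => c0 := condExp_const (D.F_le k) c0
  have hm := D.mean k hk
  have hE : (fun ω => c0 + c1 * U k ω + c2 * U k ω ^ 2 + c3 * |U k ω| ^ (2 + ρ)) =
      (((fun _ : Ω => c0) + c1 • U k) + c2 • fun ω => U k ω ^ 2) +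
        c3 • fun ω => |U k ω| ^ (2 + ρ) := by
    funext ω; simp
  rw [hE]
  filter_upwards [h1, h2, h3, s1, s2, s3, hm] with ω h1 h2 h3 s1 s2 s3 hm
  rw [h1, Pi.add_apply, h2, Pi.add_apply, h3, Pi.add_apply, s1, s2, s3, hc]
  simp only [Pi.smul_apply, smul_eq_mul, hm, Pi.zero_apply, mul_zero, add_zero]
  rfl

lemma psi_int (D : TD P n F U ρ g Λ N δ) {k : ℕ} (hk : k < n) {ψ : ℝ → ℝ} (hψ : Measurable ψ)
    {c0 c1 c2 C : ℝ} (h : ∀ u, |ψ u - c0 - c1 * u - c2 * u ^ 2| ≤ C * |u| ^ (2 + ρ)) :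
    Integrable (fun ω => ψ (U k ω)) P := by
  refine ((D.lin_int hk c0 c1 c2 0).norm.add (D.lin_int hk 0 0 0 C)).mono'
    (hψ.comp (D.meas' hk)).aestronglyMeasurable ?_
  refine ae_of_all _ fun ω => ?_
  have := h (U k ω)
  simp only [Pi.add_apply, Real.norm_eq_abs, zero_mul, add_zero, zero_add]
  have h2 := abs_add_le (c0 + c1 * U k ω + c2 * U k ω ^ 2)
    (ψ (U k ω) - c0 - c1 * U k ω - c2 * U k ω ^ 2)
  rw [show c0 + c1 * U k ω + c2 * U k ω ^ 2 + (ψ (U k ω) - c0 - c1 * U k ω - c2 * U k ω ^ 2)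
    = ψ (U k ω) by ring] at h2
  linarith

lemma key (D : TD P n F U ρ g Λ N δ) {k : ℕ} (hk : k < n) {ψ : ℝ → ℝ} (hψ : Measurable ψ)
    {c0 c1 c2 C : ℝ} (h : ∀ u, |ψ u - c0 - c1 * u - c2 * u ^ 2| ≤ C * |u| ^ (2 + ρ)) :
    ∀ᵐ ω ∂P, |cw P F U ψ k ω - c0 - c2 * vv P F U k ω| ≤ C * bb P F U ρ k ω := by
  have hi := D.psi_int hk hψ h
  have u1 := condExp_mono (m := F k) hi (D.lin_int hk c0 c1 c2 C) (ae_of_all _ fun ω => by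
    have := (abs_le.1 (h (U k ω))).2
    simp only; linarith)
  have l1 := condExp_mono (m := F k) (D.lin_int hk c0 c1 c2 (-C)) hi (ae_of_all _ fun ω => by
    have := (abs_le.1 (h (U k ω))).1
    simp only; linarith)
  filter_upwards [u1, l1, D.lin hk c0 c1 c2 C, D.lin hk c0 c1 c2 (-C)] with ω h1 h2 h3 h4
  rw [h3] at h1; rw [h4] at h2
  rw [abs_le]
  simp only [cw]
  constructor <;> linarith

lemma v_nonneg (D : TD P n F U ρ g Λ N δ) (k : ℕ) : ∀ᵐ ω ∂P, 0 ≤ vv P F U k ω :=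
  condExp_nonneg (ae_of_all _ fun ω => sq_nonneg _)

lemma b_nonneg (D : TD P n F U ρ g Λ N δ) (k : ℕ) : ∀ᵐ ω ∂P, 0 ≤ bb P F U ρ k ω :=
  condExp_nonneg (ae_of_all _ fun ω => by positivity)

lemma jensen (D : TD P n F U ρ g Λ N δ) {k : ℕ} (hk : k < n) :
    ∀ᵐ ω ∂P, vv P F U k ω ^ (1 + ρ / 2) ≤ bb P F U ρ k ω := by
  have hρ := D.rho_pos
  have hE : (fun t : ℝ => t ^ (1 + ρ / 2)) ∘ (fun ω => U k ω ^ 2) = fun ω => |U k ω| ^ (2 + ρ) := by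
    funext ω
    simp only [Function.comp]
    rw [← sq_abs, ← Real.rpow_natCast, ← Real.rpow_mul (abs_nonneg _)]
    congr 1; push_cast; ring
  have h := ConvexOn.map_condExp_le (μ := P) (D.F_le k) (φ := fun t : ℝ => t ^ (1 + ρ / 2))
    (f := fun ω => U k ω ^ 2) (s := Set.Ici 0)
    (convexOn_rpow (by linarith))
    ((Real.continuous_rpow_const (by linarith)).lowerSemicontinuous.lowerSemicontinuousOn _)
    (ae_of_all _ fun ω => Set.mem_Ici.2 (sq_nonneg _)) isClosed_Ici (D.int2 hk) (by rw [hE]; exact D.int k hk)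
  rw [hE] at h
  exact h

/-- basic a.e. facts -/
lemma basic (D : TD P n F U ρ g Λ N δ) {k : ℕ} (hk : k < n) :
    ∀ᵐ ω ∂P, 0 ≤ vv P F U k ω ∧ 0 ≤ bb P F U ρ k ω ∧ vv P F U k ω ≤ g ^ 2 ∧
      bb P F U ρ k ω ≤ g ^ ρ * vv P F U k ω ∧ vv P F U k ω ^ 2 ≤ bb P F U ρ k ω ∧
      bb P F U ρ k ω ≤ g ^ 2 := by
  have hρ := D.rho_pos
  have hg := D.g_pos
  filter_upwards [D.v_nonneg k, D.b_nonneg k, D.bet k hk, D.jensen hk] with ω h1 h2 h3 h4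
  have hg1 : g ^ ρ ≤ 1 := Real.rpow_le_one hg.le D.g_le hρ.le
  have hv : vv P F U k ω ≤ g ^ 2 := by
    rcases h1.eq_or_lt with h | h
    · rw [← h]; positivity
    · have h5 : vv P F U k ω ^ (1 + ρ / 2) ≤ g ^ ρ * vv P F U k ω := h4.trans h3
      rw [Real.rpow_add h, Real.rpow_one, mul_comm] at h5
      have h6 := le_of_mul_le_mul_right h5 h
      have h7 : g ^ ρ = (g ^ 2) ^ (ρ / 2) := by
        rw [← Real.rpow_natCast, ← Real.rpow_mul hg.le]; congr 1; push_cast; ring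
      rw [h7] at h6
      exact (Real.rpow_le_rpow_iff h1 (by positivity) (by linarith)).1 h6
  have hv1 : vv P F U k ω ≤ 1 := hv.trans (by have := D.g_le; nlinarith)
  have hb : bb P F U ρ k ω ≤ g ^ 2 := by
    have : g ^ ρ * vv P F U k ω ≤ 1 * vv P F U k ω := mul_le_mul_of_nonneg_right hg1 h1
    linarith
  refine ⟨h1, h2, hv, h3, ?_, hb⟩
  refine le_trans ?_ h4
  rcases h1.eq_or_lt with h | h
  · rw [← h, Real.zero_rpow (by linarith)]; norm_num
  · rw [← Real.rpow_natCast]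
    exact Real.rpow_le_rpow_of_exponent_ge h hv1 (by push_cast; have := D.rho_lt; linarith)

lemma v_meas (D : TD P n F U ρ g Λ N δ) (k : ℕ) : Measurable[F k] (vv P F U k) :=
  stronglyMeasurable_condExp.measurable
lemma cw_meas (P : Measure Ω) (F : ℕ → MeasurableSpace Ω) (U : ℕ → Ω → ℝ) (ψ : ℝ → ℝ) (k : ℕ) :
    Measurable[F k] (cw P F U ψ k) :=
  stronglyMeasurable_condExp.measurable

/-- taking out what is known -/
lemma step_int (D : TD P n F U ρ g Λ N δ) {k : ℕ} {ψ : ℝ → ℝ} {G : Ω → ℝ}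
    (hi : Integrable (fun ω => ψ (U k ω)) P)
    (hG : Measurable[F k] G) (bG : AEB P G) :
    ∫ ω, G ω * ψ (U k ω) ∂P = ∫ ω, G ω * cw P F U ψ k ω ∂P := by
  have hG' : Measurable G := hG.mono (D.F_le k) le_rfl
  have h := condExp_mul_of_stronglyMeasurable_left (μ := P) (m := F k) (f := G)
    (g := fun ω => ψ (U k ω)) hG.stronglyMeasurable (bG.integrable_mul hG' hi) hi
  have h2 := integral_condExp (μ := P) (D.F_le k) (f := G * fun ω => ψ (U k ω))
  rw [integral_congr_ae h] at h2
  exact h2.symm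
end TD
end SNC


set_option linter.unusedSectionVars false
set_option linter.unusedVariables false
namespace SNC
open MeasureTheory Filter ProbabilityTheory
open scoped Topology ENNReal NNReal

/-- good weights -/
structure GoodW (w : ℝ → ℝ) (ρ a q K : ℝ) : Prop where
  meas : Measurable w
  nonneg : ∀ u, 0 ≤ w u
  dec : ∀ u, w u * (1 + |u|) ^ 6 ≤ K
  tay : ∀ u, |w u - 1 - a * u - q * u ^ 2| ≤ K * |u| ^ (2 + ρ)
  a_le : |a| ≤ 3
  q_le : |q| ≤ 6
  K_ge : 1 ≤ K

lemma rpow_ge_cube {ρ u : ℝ} (hρ' : ρ < 1) (h : |u| ≤ 1) (hρ : 0 < ρ) : |u| ^ 3 ≤ |u| ^ (2 + ρ) := by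
  rcases (abs_nonneg u).eq_or_lt with h0 | h0
  · rw [← h0, Real.zero_rpow (by linarith)]; norm_num
  · rw [← Real.rpow_natCast]
    exact Real.rpow_le_rpow_of_exponent_ge h0 h (by push_cast; linarith)

lemma rpow_ge_sq {ρ u : ℝ} (hρ : 0 < ρ) (h : 1 ≤ |u|) : |u| ^ 2 ≤ |u| ^ (2 + ρ) := by
  rw [← Real.rpow_natCast]
  exact Real.rpow_le_rpow_of_exponent_le h (by push_cast; linarith)

namespace GoodW
variable {w : ℝ → ℝ} {ρ a q K : ℝ}

lemma le_pow (W : GoodW w ρ a q K) (u : ℝ) {m : ℕ} (hm : m ≤ 6) : w u * |u| ^ m ≤ K := by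
  refine le_trans (mul_le_mul_of_nonneg_left ?_ (W.nonneg u)) (W.dec u)
  calc |u| ^ m ≤ (1 + |u|) ^ m := pow_le_pow_left₀ (abs_nonneg _) (by linarith) _
    _ ≤ (1 + |u|) ^ 6 := pow_le_pow_right₀ (by linarith [abs_nonneg u]) hm

lemma le_K (W : GoodW w ρ a q K) (u : ℝ) : w u ≤ K := by
  have := W.le_pow u (m := 0) (by norm_num); simpa using this

lemma sub_one (W : GoodW w ρ a q K) (hρ : 0 < ρ) (hρ' : ρ < 1) {u : ℝ} (hu : |u| ≤ 1) :
    |w u - 1| ≤ (9 + K) * |u| := by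
  have h := W.tay u
  have hK := W.K_ge
  have h1 : |u| ^ (2 + ρ) ≤ |u| := by
    rcases (abs_nonneg u).eq_or_lt with h0 | h0
    · rw [← h0, Real.zero_rpow (by linarith)]
    · calc |u| ^ (2 + ρ) ≤ |u| ^ (1:ℝ) := Real.rpow_le_rpow_of_exponent_ge h0 hu (by linarith)
        _ = |u| := Real.rpow_one _
  have h2 : |a * u| ≤ 3 * |u| := by
    rw [abs_mul]; exact mul_le_mul_of_nonneg_right W.a_le (abs_nonneg _)
  have h3 : |q * u ^ 2| ≤ 6 * |u| := by
    rw [abs_mul, abs_pow]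
    have := W.q_le
    have : |u| ^ 2 ≤ |u| := by nlinarith [abs_nonneg u]
    exact mul_le_mul W.q_le this (by positivity) (by norm_num)
  have h4 : K * |u| ^ (2 + ρ) ≤ K * |u| := mul_le_mul_of_nonneg_left h1 (by linarith)
  have e : w u - 1 = (w u - 1 - a * u - q * u ^ 2) + a * u + q * u ^ 2 := by ring
  rw [e]
  refine (abs_add_le _ _).trans ?_
  have := abs_add_le (w u - 1 - a * u - q * u ^ 2) (a * u)
  linarith

lemma wu2 (W : GoodW w ρ a q K) (hρ : 0 < ρ) (hρ' : ρ < 1) (u : ℝ) :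
    |w u * u ^ 2 - 0 - 0 * u - 1 * u ^ 2| ≤ (9 + K) * |u| ^ (2 + ρ) := by
  have hK := W.K_ge
  rcases le_total |u| 1 with hu | hu
  · have h := W.sub_one hρ hρ' hu
    have h3 := rpow_ge_cube hρ' hu hρ
    rw [show w u * u ^ 2 - 0 - 0 * u - 1 * u ^ 2 = (w u - 1) * u ^ 2 by ring, abs_mul, abs_pow]
    calc |w u - 1| * |u| ^ 2 ≤ (9 + K) * |u| * |u| ^ 2 := by gcongr
      _ = (9 + K) * |u| ^ 3 := by ring
      _ ≤ _ := by gcongr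
  · have h := W.le_pow u (m := 2) (by norm_num)
    have h2 := rpow_ge_sq hρ hu
    have h3 : 1 ≤ |u| ^ 2 := one_le_pow₀ hu
    rw [sq_abs] at h h2 h3
    have h0 := W.nonneg u
    have h5 : 0 ≤ w u * u ^ 2 := by positivity
    rw [abs_le]
    constructor <;> nlinarith

lemma wu4 (W : GoodW w ρ a q K) (hρ : 0 < ρ) (hρ' : ρ < 1) (u : ℝ) :
    |w u * u ^ 4 - 0 - 0 * u - 0 * u ^ 2| ≤ K * |u| ^ (2 + ρ) := by
  have hK := W.K_ge
  have h0 := W.nonneg u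
  rw [show w u * u ^ 4 - 0 - 0 * u - 0 * u ^ 2 = w u * u ^ 4 by ring, abs_mul, abs_pow,
    abs_of_nonneg h0]
  rcases le_total |u| 1 with hu | hu
  · have h3 := rpow_ge_cube hρ' hu hρ
    have h4 : |u| ^ 4 ≤ |u| ^ 3 := pow_le_pow_of_le_one (abs_nonneg _) hu (by norm_num)
    have := W.le_K u
    gcongr
    exact h4.trans h3
  · have h := W.le_pow u (m := 4) (by norm_num)
    have h2 := rpow_ge_sq hρ hu
    have h3 : 1 ≤ |u| ^ 2 := one_le_pow₀ hu
    nlinarith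

/-- the function `f` in the exponent -/
noncomputable def ff (a u : ℝ) : ℝ := u - a / 2 * u ^ 2

lemma ff_meas (a : ℝ) : Measurable (ff a) := by unfold ff; fun_prop

lemma ff_small {a u : ℝ} (ha : 0 ≤ a) (ha' : a ≤ 1) (hu : |u| ≤ 1) : |ff a u| ≤ 3 / 2 * |u| := by
  unfold ff
  have e : u - a / 2 * u ^ 2 = u * (1 - a / 2 * u) := by ring
  rw [e, abs_mul, mul_comm]
  refine mul_le_mul_of_nonneg_right ?_ (abs_nonneg _)
  have := abs_le.1 hu
  rw [abs_le]; constructor <;> nlinarith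

lemma ff_large {a u : ℝ} (ha : 0 ≤ a) (ha' : a ≤ 1) (hu : 1 ≤ |u|) : |ff a u| ≤ 3 / 2 * |u| ^ 2 := by
  unfold ff
  refine (abs_sub _ _).trans ?_
  rw [abs_mul, abs_pow, abs_of_nonneg (by linarith : 0 ≤ a / 2)]
  nlinarith [sq_nonneg |u|]

lemma wf1 (W : GoodW w ρ a 0 K) (hρ : 0 < ρ) (hρ' : ρ < 1) (ha : 0 ≤ a) (ha' : a ≤ 1) (u : ℝ) :
    |w u * ff a u - 0 - 1 * u - (a / 2) * u ^ 2| ≤ (2 * K + 2) * |u| ^ (2 + ρ) := by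
  have hK := W.K_ge
  have h0 := W.nonneg u
  rcases le_total |u| 1 with hu | hu
  · have h3 := rpow_ge_cube hρ' hu hρ
    have ht := W.tay u
    have e : w u * ff a u - 0 - 1 * u - (a / 2) * u ^ 2
        = (w u - 1 - a * u - 0 * u ^ 2) * ff a u + -(a ^ 2 / 2 * u ^ 3) := by unfold ff; ring
    have hf : |ff a u| ≤ 3 / 2 := (ff_small ha ha' hu).trans (by linarith)
    rw [e]
    refine (abs_add_le _ _).trans ?_
    rw [abs_neg, abs_mul, abs_mul, abs_pow, abs_of_nonneg (by positivity : 0 ≤ a ^ 2 / 2)]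
    have h5 : |w u - 1 - a * u - 0 * u ^ 2| * |ff a u| ≤ K * |u| ^ (2 + ρ) * (3 / 2) :=
      mul_le_mul ht hf (abs_nonneg _) (by positivity)
    have h6 : a ^ 2 / 2 * |u| ^ 3 ≤ 1 * |u| ^ (2 + ρ) := by
      refine mul_le_mul ?_ h3 (by positivity) (by norm_num); nlinarith
    have : 0 ≤ |u| ^ (2 + ρ) := by positivity
    nlinarith
  · have h := W.le_pow u (m := 2) (by norm_num)
    have h2 := rpow_ge_sq hρ hu
    have h3 : 1 ≤ |u| ^ 2 := one_le_pow₀ hu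
    have h4 := ff_large ha ha' hu
    have h5 : |w u * ff a u| ≤ 3 / 2 * K := by
      rw [abs_mul, abs_of_nonneg h0]
      calc w u * |ff a u| ≤ w u * (3 / 2 * |u| ^ 2) := by gcongr
        _ = 3 / 2 * (w u * |u| ^ 2) := by ring
        _ ≤ _ := by gcongr
    have h6 : |1 * u| ≤ |u| ^ 2 := by rw [one_mul]; nlinarith
    have h7 : |a / 2 * u ^ 2| ≤ 1 / 2 * |u| ^ 2 := by
      rw [abs_mul, abs_pow, abs_of_nonneg (by linarith : 0 ≤ a / 2)]
      gcongr; 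
    rw [sub_zero]
    refine (abs_sub _ _).trans ?_
    have := abs_sub (w u * ff a u) (1 * u)
    nlinarith

lemma wf2 (W : GoodW w ρ a 0 K) (hρ : 0 < ρ) (hρ' : ρ < 1) (ha : 0 ≤ a) (ha' : a ≤ 1) (u : ℝ) :
    |w u * ff a u ^ 2 - 0 - 0 * u - 1 * u ^ 2| ≤ (3 * K + 24) * |u| ^ (2 + ρ) := by
  have hK := W.K_ge
  have h0 := W.nonneg u
  rcases le_total |u| 1 with hu | hu
  · have h3 := rpow_ge_cube hρ' hu hρ
    have ht := W.sub_one hρ hρ' hu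
    have e : w u * ff a u ^ 2 - 0 - 0 * u - 1 * u ^ 2
        = (w u - 1) * ff a u ^ 2 + u ^ 3 * (-a + a ^ 2 / 4 * u) := by unfold ff; ring
    have hf : |ff a u| ^ 2 ≤ 9 / 4 * |u| ^ 2 := by
      have := pow_le_pow_left₀ (abs_nonneg _) (ff_small ha ha' hu) 2
      linarith
    rw [e]
    refine (abs_add_le _ _).trans ?_
    rw [abs_mul, abs_mul, abs_pow, abs_pow]
    have h5 : |w u - 1| * |ff a u| ^ 2 ≤ ((9 + K) * |u|) * (9 / 4 * |u| ^ 2) :=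
      mul_le_mul ht hf (by positivity) (by positivity)
    have h6 : |-a + a ^ 2 / 4 * u| ≤ 5 / 4 := by
      have := abs_le.1 hu
      rw [abs_le]; constructor <;> nlinarith
    have h7 : |u| ^ 3 * |-a + a ^ 2 / 4 * u| ≤ |u| ^ 3 * (5 / 4) := by gcongr
    have : 0 ≤ |u| ^ 3 := by positivity
    nlinarith
  · have h := W.le_pow u (m := 4) (by norm_num)
    have h2 := rpow_ge_sq hρ hu
    have h3 : 1 ≤ |u| ^ 2 := one_le_pow₀ hu
    have h4 := pow_le_pow_left₀ (abs_nonneg _) (ff_large ha ha' hu) 2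
    have h5 : w u * ff a u ^ 2 ≤ 9 / 4 * K := by
      rw [← sq_abs]
      calc w u * |ff a u| ^ 2 ≤ w u * (3 / 2 * |u| ^ 2) ^ 2 := by gcongr
        _ = 9 / 4 * (w u * |u| ^ 4) := by ring
        _ ≤ _ := by gcongr
    have h6 : 0 ≤ w u * ff a u ^ 2 := by positivity
    rw [sq_abs] at h2 h3
    rw [abs_le]
    constructor <;> nlinarith

lemma wf3 (W : GoodW w ρ a 0 K) (hρ : 0 < ρ) (hρ' : ρ < 1) (ha : 0 ≤ a) (ha' : a ≤ 1) (u : ℝ) :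
    |w u * |ff a u| ^ (2 + ρ) - 0 - 0 * u - 0 * u ^ 2| ≤ (4 * K) * |u| ^ (2 + ρ) := by
  have hK := W.K_ge
  have h0 := W.nonneg u
  rw [show w u * |ff a u| ^ (2 + ρ) - 0 - 0 * u - 0 * u ^ 2 = w u * |ff a u| ^ (2 + ρ) by ring,
    abs_of_nonneg (by positivity)]
  have h15 : (3 / 2 : ℝ) ^ (2 + ρ) ≤ 4 := by
    calc (3 / 2 : ℝ) ^ (2 + ρ) ≤ (3 / 2 : ℝ) ^ (3:ℝ) :=
          Real.rpow_le_rpow_of_exponent_le (by norm_num) (by linarith)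
      _ ≤ 4 := by
          rw [show (3:ℝ) = ((3:ℕ):ℝ) by norm_num, Real.rpow_natCast]; norm_num
  rcases le_total |u| 1 with hu | hu
  · have := W.le_K u
    have h4 : |ff a u| ^ (2 + ρ) ≤ 4 * |u| ^ (2 + ρ) := by
      calc |ff a u| ^ (2 + ρ) ≤ (3 / 2 * |u|) ^ (2 + ρ) :=
            Real.rpow_le_rpow (abs_nonneg _) (ff_small ha ha' hu) (by linarith)
        _ = (3 / 2) ^ (2 + ρ) * |u| ^ (2 + ρ) := Real.mul_rpow (by norm_num) (abs_nonneg _)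
        _ ≤ _ := by gcongr
    calc w u * |ff a u| ^ (2 + ρ) ≤ K * (4 * |u| ^ (2 + ρ)) := by gcongr
      _ = _ := by ring
  · have h := W.le_pow u (m := 6) (by norm_num)
    have h2 := rpow_ge_sq hρ hu
    have h3 : 1 ≤ |u| ^ 2 := one_le_pow₀ hu
    have h4 : |ff a u| ^ (2 + ρ) ≤ 4 * |u| ^ 6 := by
      calc |ff a u| ^ (2 + ρ) ≤ (3 / 2 * |u| ^ 2) ^ (2 + ρ) :=
            Real.rpow_le_rpow (abs_nonneg _) (ff_large ha ha' hu) (by linarith)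
        _ ≤ (3 / 2 * |u| ^ 2) ^ (3:ℝ) :=
            Real.rpow_le_rpow_of_exponent_le (by linarith) (by linarith)
        _ = (3 / 2 * |u| ^ 2) ^ 3 := by
            rw [show (3:ℝ) = ((3:ℕ):ℝ) by norm_num, Real.rpow_natCast]
        _ = 27 / 8 * |u| ^ 6 := by ring
        _ ≤ _ := by gcongr; norm_num
    calc w u * |ff a u| ^ (2 + ρ) ≤ w u * (4 * |u| ^ 6) := by gcongr
      _ = 4 * (w u * |u| ^ 6) := by ring
      _ ≤ 4 * K * 1 := by linarith
      _ ≤ _ := by gcongr; linarith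

end GoodW
end SNC


set_option linter.unusedSectionVars false
set_option linter.unusedVariables false
namespace SNC
open MeasureTheory Filter ProbabilityTheory
open scoped Topology ENNReal NNReal

/-- normalising factor -/
noncomputable def Dn {Ω : Type} [mΩ : MeasurableSpace Ω] (P : Measure Ω) (F : ℕ → MeasurableSpace Ω)
    (U : ℕ → Ω → ℝ) (w : ℝ → ℝ) (k : ℕ) (ω : Ω) : ℝ := max (cw P F U w k ω) (1 / 2)

/-- one factor of the density -/
noncomputable def rr {Ω : Type} [mΩ : MeasurableSpace Ω] (P : Measure Ω) (F : ℕ → MeasurableSpace Ω)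
    (U : ℕ → Ω → ℝ) (w : ℝ → ℝ) (k : ℕ) (ω : Ω) : ℝ := w (U k ω) / Dn P F U w k ω

namespace TD
variable {Ω : Type} [mΩ : MeasurableSpace Ω] {P : Measure Ω} [IsProbabilityMeasure P] {n : ℕ}
    {F : ℕ → MeasurableSpace Ω} {U : ℕ → Ω → ℝ} {ρ g Λ N δ : ℝ} {w : ℝ → ℝ} {a q K : ℝ}

lemma Dn_ge (k : ℕ) (ω : Ω) : 1 / 2 ≤ Dn P F U w k ω := le_max_right _ _
lemma Dn_pos (k : ℕ) (ω : Ω) : 0 < Dn P F U w k ω := lt_of_lt_of_le (by norm_num) (Dn_ge k ω)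
lemma Dn_meas (k : ℕ) : Measurable[F k] (Dn P F U w k) :=
  (cw_meas P F U w k).max measurable_const

lemma Dn_key (D : TD P n F U ρ g Λ N δ) (W : GoodW w ρ a q K) (hg : (6 + K) * g ^ 2 ≤ 1 / 2)
    {k : ℕ} (hk : k < n) :
    ∀ᵐ ω ∂P, Dn P F U w k ω = cw P F U w k ω ∧
      |Dn P F U w k ω - 1 - q * vv P F U k ω| ≤ K * bb P F U ρ k ω := by
  filter_upwards [D.key hk W.meas W.tay, D.basic hk] with ω h1 h2
  obtain ⟨hv, hb, hv2, hb2, _, hb3⟩ := h2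
  have hK := W.K_ge
  have hD : 1 / 2 ≤ cw P F U w k ω := by
    have h3 := (abs_le.1 h1).1
    have h4 : |q * vv P F U k ω| ≤ 6 * g ^ 2 := by
      rw [abs_mul, abs_of_nonneg hv]
      exact mul_le_mul W.q_le hv2 hv (by norm_num)
    have h5 : K * bb P F U ρ k ω ≤ K * g ^ 2 := mul_le_mul_of_nonneg_left hb3 (by linarith)
    have := (abs_le.1 h4).1
    linarith
  have hE : Dn P F U w k ω = cw P F U w k ω := max_eq_left hD
  refine ⟨hE, ?_⟩
  rw [hE]; exact h1

lemma w_int (D : TD P n F U ρ g Λ N δ) (W : GoodW w ρ a q K) {k : ℕ} (hk : k < n) :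
    Integrable (fun ω => w (U k ω)) P := D.psi_int hk W.meas W.tay

lemma rr_meas (D : TD P n F U ρ g Λ N δ) (W : GoodW w ρ a q K) {k : ℕ} (hk : k < n) :
    Measurable[F (k + 1)] (rr P F U w k) :=
  (W.meas.comp (D.meas k hk)).div ((Dn_meas k).mono (D.F_mono (Nat.le_succ k)) le_rfl)

lemma rr_nonneg (W : GoodW w ρ a q K) (k : ℕ) (ω : Ω) : 0 ≤ rr P F U w k ω :=
  div_nonneg (W.nonneg _) (Dn_pos k ω).le

lemma div_Dn_le {t L : ℝ} (k : ℕ) (ω : Ω) (hL : |t| ≤ L) :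
    |t / Dn P F U w k ω| ≤ 2 * L := by
  rw [abs_div, abs_of_pos (Dn_pos k ω), div_le_iff₀ (Dn_pos k ω)]
  have := Dn_ge (P := P) (F := F) (U := U) (w := w) k ω
  have := (abs_nonneg t).trans hL
  nlinarith

lemma rr_le (W : GoodW w ρ a q K) (k : ℕ) (ω : Ω) : |rr P F U w k ω| ≤ 2 * K :=
  div_Dn_le k ω (by rw [abs_of_nonneg (W.nonneg _)]; exact W.le_K _)

lemma prod_meas (D : TD P n F U ρ g Λ N δ) (W : GoodW w ρ a q K) (j : ℕ) {m : ℕ} (hm : m ≤ n) :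
    Measurable[F m] (fun ω => ∏ i ∈ Finset.Ico j m, rr P F U w i ω) := by
  refine Finset.measurable_fun_prod _ fun i hi => ?_
  have hi' := Finset.mem_Ico.1 hi
  exact (D.rr_meas W (by omega)).mono (D.F_mono (by omega)) le_rfl

lemma prod_nonneg' (W : GoodW w ρ a q K) (s : Finset ℕ) (ω : Ω) :
    0 ≤ ∏ i ∈ s, rr P F U w i ω := Finset.prod_nonneg fun i _ => rr_nonneg W i ω

lemma prod_aeb (W : GoodW w ρ a q K) (s : Finset ℕ) :
    AEB P (fun ω => ∏ i ∈ s, rr P F U w i ω) := by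
  refine ⟨(2 * K) ^ s.card, ae_of_all _ fun ω => ?_⟩
  rw [Finset.abs_prod]
  rw [← Finset.prod_const]
  exact Finset.prod_le_prod (fun i _ => abs_nonneg _) fun i _ => rr_le W i ω

lemma inv_aeb (k : ℕ) : AEB P (fun ω => (Dn P F U w k ω)⁻¹) := by
  refine ⟨2, ae_of_all _ fun ω => ?_⟩
  have := div_Dn_le (P := P) (F := F) (U := U) (w := w) (t := 1) (L := 1) k ω (by simp)
  simpa using this

lemma tail_int (D : TD P n F U ρ g Λ N δ) (W : GoodW w ρ a q K) (hg : (6 + K) * g ^ 2 ≤ 1 / 2)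
    {j m : ℕ} (hjm : j ≤ m) (hm : m ≤ n) {M : Ω → ℝ} (hM : Measurable[F j] M) (bM : AEB P M) :
    ∫ ω, M ω * ∏ i ∈ Finset.Ico j m, rr P F U w i ω ∂P = ∫ ω, M ω ∂P := by
  induction m, hjm using Nat.le_induction with
  | base => simp
  | succ m hjm ih =>
    rw [← ih (by omega)]
    have hmn : m < n := by omega
    set G : Ω → ℝ := fun ω => (M ω * ∏ i ∈ Finset.Ico j m, rr P F U w i ω) * (Dn P F U w m ω)⁻¹
      with hG
    have mG : Measurable[F m] G :=
      ((hM.mono (D.F_mono hjm) le_rfl).mul (D.prod_meas W j hmn.le)).mul (Dn_meas m).inv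
    have bG : AEB P G := (bM.mul (prod_aeb W _)).mul (inv_aeb m)
    have h := D.step_int (D.w_int W hmn) mG bG
    calc ∫ ω, M ω * ∏ i ∈ Finset.Ico j (m + 1), rr P F U w i ω ∂P
        = ∫ ω, G ω * w (U m ω) ∂P := by
          refine integral_congr_ae (ae_of_all _ fun ω => ?_)
          simp only [hG]
          rw [Finset.prod_Ico_succ_top hjm, rr, div_eq_mul_inv]; ring
      _ = _ := h
      _ = _ := by
          refine integral_congr_ae ?_
          filter_upwards [D.Dn_key W hg hmn] with ω hω
          simp only [hG]
          rw [← hω.1, mul_assoc, inv_mul_cancel₀ (Dn_pos m ω).ne', mul_one]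

lemma prodDn (D : TD P n F U ρ g Λ N δ) (W : GoodW w ρ a q K) (hg : (6 + K) * g ^ 2 ≤ 1 / 2) :
    ∀ᵐ ω ∂P, ∏ k ∈ Finset.range n, Dn P F U w k ω ≤
      Real.exp (q * N + |q| * (N * δ ^ 2) + K * Λ) := by
  have h : ∀ᵐ ω ∂P, ∀ k ∈ Finset.range n,
      |Dn P F U w k ω - 1 - q * vv P F U k ω| ≤ K * bb P F U ρ k ω := by
    rw [Filter.eventually_all_finset]
    intro k hk
    filter_upwards [D.Dn_key W hg (Finset.mem_range.1 hk)] with ω hω using hω.2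
  filter_upwards [h, D.lam, D.var] with ω h1 h2 h3
  have hK := W.K_ge
  calc ∏ k ∈ Finset.range n, Dn P F U w k ω
      ≤ ∏ k ∈ Finset.range n, Real.exp (q * vv P F U k ω + K * bb P F U ρ k ω) := by
        refine Finset.prod_le_prod (fun i _ => (Dn_pos i ω).le) fun i hi => ?_
        have := (abs_le.1 (h1 i hi)).2
        have := Real.add_one_le_exp (q * vv P F U i ω + K * bb P F U ρ i ω)
        linarith
    _ = Real.exp (q * ∑ k ∈ Finset.range n, vv P F U k ω + K * ∑ k ∈ Finset.range n, bb P F U ρ k ω) := by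
        rw [← Real.exp_sum, Finset.sum_add_distrib, Finset.mul_sum, Finset.mul_sum]
    _ ≤ _ := by
        apply Real.exp_le_exp.2
        have h4 : K * ∑ k ∈ Finset.range n, bb P F U ρ k ω ≤ K * Λ :=
          mul_le_mul_of_nonneg_left h2 (by linarith)
        have h5 : |q * (∑ k ∈ Finset.range n, vv P F U k ω - N)| ≤ |q| * (N * δ ^ 2) := by
          rw [abs_mul]; exact mul_le_mul_of_nonneg_left h3 (abs_nonneg _)
        have := (abs_le.1 h5).2
        linarith

lemma prodw (ω : Ω) : ∏ k ∈ Finset.range n, w (U k ω) =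
    (∏ k ∈ Finset.range n, rr P F U w k ω) * ∏ k ∈ Finset.range n, Dn P F U w k ω := by
  rw [← Finset.prod_mul_distrib]
  refine Finset.prod_congr rfl fun k _ => ?_
  rw [rr, div_mul_cancel₀ _ (Dn_pos k ω).ne']

noncomputable def QQ (P : Measure Ω) (F : ℕ → MeasurableSpace Ω) (U : ℕ → Ω → ℝ) (w : ℝ → ℝ)
    (n : ℕ) : Measure Ω :=
  P.withDensity fun ω => ENNReal.ofReal (∏ k ∈ Finset.range n, rr P F U w k ω)

lemma Z_meas (D : TD P n F U ρ g Λ N δ) (W : GoodW w ρ a q K) :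
    Measurable (fun ω => ∏ k ∈ Finset.range n, rr P F U w k ω) := by
  have := (D.prod_meas W 0 le_rfl).mono (D.F_le n) le_rfl
  simpa only [← Finset.range_eq_Ico] using this

lemma QQ_ac : QQ P F U w n ≪ P := withDensity_absolutelyContinuous _ _

lemma QQ_int (D : TD P n F U ρ g Λ N δ) (W : GoodW w ρ a q K) (f : Ω → ℝ) :
    ∫ ω, f ω ∂(QQ P F U w n) = ∫ ω, f ω * ∏ k ∈ Finset.range n, rr P F U w k ω ∂P := by
  unfold QQ
  rw [integral_withDensity_eq_integral_toReal_smul (D.Z_meas W).ennreal_ofReal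
    (ae_of_all _ fun _ => ENNReal.ofReal_lt_top)]
  refine integral_congr_ae (ae_of_all _ fun ω => ?_)
  simp only [smul_eq_mul]
  rw [ENNReal.toReal_ofReal (prod_nonneg' W _ ω), mul_comm]

lemma QQ_integrable (D : TD P n F U ρ g Λ N δ) (W : GoodW w ρ a q K) {f : Ω → ℝ}
    (hf : Integrable (fun ω => f ω * ∏ k ∈ Finset.range n, rr P F U w k ω) P) :
    Integrable f (QQ P F U w n) := by
  unfold QQ
  have hm : Measurable (fun ω => Real.toNNReal (∏ k ∈ Finset.range n, rr P F U w k ω)) :=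
    (D.Z_meas W).real_toNNReal
  have h := (integrable_withDensity_iff_integrable_smul hm (μ := P) (g := f)).2 (by
    refine hf.congr (ae_of_all _ fun ω => ?_)
    simp only [NNReal.smul_def, smul_eq_mul]
    rw [Real.coe_toNNReal _ (prod_nonneg' W _ ω), mul_comm])
  exact h

lemma QQ_prob (D : TD P n F U ρ g Λ N δ) (W : GoodW w ρ a q K) (hg : (6 + K) * g ^ 2 ≤ 1 / 2) :
    IsProbabilityMeasure (QQ P F U w n) := by
  constructor
  unfold QQ
  rw [withDensity_apply _ MeasurableSet.univ, Measure.restrict_univ,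
    ← ofReal_integral_eq_lintegral_ofReal ((prod_aeb W _).integrable (D.Z_meas W))
      (ae_of_all _ fun ω => prod_nonneg' W _ ω)]
  have h := D.tail_int W hg (Nat.zero_le n) le_rfl (M := fun _ => 1) measurable_const
    ⟨1, by simp⟩
  rw [← Finset.range_eq_Ico] at h
  simp only [one_mul, integral_const, smul_eq_mul, mul_one, probReal_univ] at h
  rw [h]; simp

/-- the basic formula under the tilted measure -/
lemma Qint (D : TD P n F U ρ g Λ N δ) (W : GoodW w ρ a q K) (hg : (6 + K) * g ^ 2 ≤ 1 / 2)
    {k : ℕ} (hk : k < n) {G : Ω → ℝ} (hG : Measurable[F k] G) (bG : AEB P G)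
    {h : ℝ → ℝ} (hh : Measurable h) {L : ℝ} (hL : ∀ u, |w u * h u| ≤ L) :
    ∫ ω, G ω * h (U k ω) ∂(QQ P F U w n) =
      ∫ ω, G ω * (cw P F U (fun u => w u * h u) k ω / Dn P F U w k ω) ∂(QQ P F U w n) := by
  rw [D.QQ_int W, D.QQ_int W]
  have hk1 : k + 1 ≤ n := hk
  have hspl : ∀ ω, ∏ i ∈ Finset.range n, rr P F U w i ω = (∏ i ∈ Finset.Ico 0 k, rr P F U w i ω) *
      ∏ i ∈ Finset.Ico k n, rr P F U w i ω := fun ω => by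
    rw [Finset.prod_Ico_consecutive _ (Nat.zero_le _) hk.le, Finset.range_eq_Ico]
  have hspl2 : ∀ ω, ∏ i ∈ Finset.range n, rr P F U w i ω = (∏ i ∈ Finset.Ico 0 k, rr P F U w i ω) *
      rr P F U w k ω * ∏ i ∈ Finset.Ico (k + 1) n, rr P F U w i ω := fun ω => by
    rw [hspl ω, Finset.prod_eq_prod_Ico_succ_bot hk, mul_assoc]
  set G1 : Ω → ℝ := fun ω => (G ω * ∏ i ∈ Finset.Ico 0 k, rr P F U w i ω) * (Dn P F U w k ω)⁻¹ with hG1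
  have mG1 : Measurable[F k] G1 := (hG.mul (D.prod_meas W 0 hk.le)).mul (Dn_meas k).inv
  have bG1 : AEB P G1 := (bG.mul (prod_aeb W _)).mul (inv_aeb k)
  have mwh : Measurable (fun u => w u * h u) := W.meas.mul hh
  have mM : Measurable[F (k + 1)] (fun ω => w (U k ω) * h (U k ω)) := mwh.comp (D.meas k hk)
  have bM : AEB P (fun ω => w (U k ω) * h (U k ω)) := ⟨L, ae_of_all _ fun ω => hL _⟩
  have iM : Integrable (fun ω => w (U k ω) * h (U k ω)) P :=
    bM.integrable (mM.mono (D.F_le _) le_rfl)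
  have e1 := D.tail_int W hg hk1 le_rfl (M := fun ω => G1 ω * (w (U k ω) * h (U k ω)))
    ((mG1.mono (D.F_mono (Nat.le_succ k)) le_rfl).mul mM) (bG1.mul bM)
  have bc : AEB P (cw P F U (fun u => w u * h u) k) :=
    ⟨L, ae_bdd_abs_condExp_of_ae_bdd_abs (ae_of_all _ fun ω => hL _)⟩
  have e2 := D.tail_int W hg hk.le le_rfl (M := fun ω => G1 ω * cw P F U (fun u => w u * h u) k ω)
    (mG1.mul (cw_meas _ _ _ _ _)) (bG1.mul bc)
  have e3 := D.step_int (ψ := fun u => w u * h u) iM mG1 bG1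
  calc ∫ ω, G ω * h (U k ω) * ∏ i ∈ Finset.range n, rr P F U w i ω ∂P
      = ∫ ω, G1 ω * (w (U k ω) * h (U k ω)) * ∏ i ∈ Finset.Ico (k + 1) n, rr P F U w i ω ∂P := by
        refine integral_congr_ae (ae_of_all _ fun ω => ?_)
        simp only [hG1]
        rw [hspl2 ω, rr, div_eq_mul_inv]; ring
    _ = _ := e1
    _ = _ := e3
    _ = _ := e2.symm
    _ = _ := by
        refine integral_congr_ae (ae_of_all _ fun ω => ?_)
        simp only [hG1]
        rw [hspl ω, div_eq_mul_inv]; ring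

end TD
end SNC


set_option linter.unusedSectionVars false
set_option linter.unusedVariables false
namespace SNC
open MeasureTheory Filter ProbabilityTheory
open scoped Topology ENNReal NNReal

lemma AEB.mono_ac {Ω : Type} [MeasurableSpace Ω] {P Q : Measure Ω} {G : Ω → ℝ} (h : AEB P G)
    (hQ : Q ≪ P) : AEB Q G := by
  obtain ⟨K, hK⟩ := h
  exact ⟨K, hQ.ae_le hK⟩

lemma clamp_ex {Ω : Type} {m : MeasurableSpace Ω} [mΩ : MeasurableSpace Ω] {P Q : Measure Ω} {G : Ω → ℝ}
    (hG : Measurable[m] G) (h : AEB Q G) :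
    ∃ G' : Ω → ℝ, Measurable[m] G' ∧ AEB P G' ∧ G =ᵐ[Q] G' := by
  obtain ⟨K, hK⟩ := h
  refine ⟨fun ω => max (-|K|) (min (G ω) |K|), ?_, ⟨|K|, ae_of_all _ fun ω => ?_⟩, ?_⟩
  · exact measurable_const.max (hG.min measurable_const)
  · rw [abs_le]
    refine ⟨le_max_left _ _, max_le ?_ (min_le_right _ _)⟩
    linarith [abs_nonneg K]
  · filter_upwards [hK] with ω hω
    have := abs_le.1 (hω.trans (le_abs_self K))
    rw [min_eq_left this.2, max_eq_right this.1]

lemma rpow_sub_le {ρ x y : ℝ} (hρ : 0 < ρ) (hρ' : ρ < 1) :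
    |x - y| ^ (2 + ρ) ≤ 8 * (|x| ^ (2 + ρ) + |y| ^ (2 + ρ)) := by
  have h8 : (2:ℝ) ^ (2 + ρ) ≤ 8 := by
    calc (2:ℝ) ^ (2 + ρ) ≤ (2:ℝ) ^ (3:ℝ) :=
          Real.rpow_le_rpow_of_exponent_le (by norm_num) (by linarith)
      _ = 8 := by rw [show (3:ℝ) = ((3:ℕ):ℝ) by norm_num, Real.rpow_natCast]; norm_num
  have h1 : |x - y| ≤ 2 * max |x| |y| := by
    have := abs_sub x y
    have := le_max_left |x| |y|
    have := le_max_right |x| |y|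
    linarith
  have h0 : 0 ≤ max |x| |y| := le_max_of_le_left (abs_nonneg _)
  have hx : 0 ≤ |x| ^ (2 + ρ) := by positivity
  have hy : 0 ≤ |y| ^ (2 + ρ) := by positivity
  calc |x - y| ^ (2 + ρ) ≤ (2 * max |x| |y|) ^ (2 + ρ) :=
        Real.rpow_le_rpow (abs_nonneg _) h1 (by linarith)
    _ = 2 ^ (2 + ρ) * max |x| |y| ^ (2 + ρ) := Real.mul_rpow (by norm_num) h0
    _ ≤ 8 * max |x| |y| ^ (2 + ρ) := by gcongr
    _ ≤ _ := by
        gcongr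
        rcases max_choice |x| |y| with h | h <;> rw [h] <;> linarith

/-- conditional mean under the tilted measure -/
noncomputable def mu {Ω : Type} [mΩ : MeasurableSpace Ω] (P : Measure Ω) (F : ℕ → MeasurableSpace Ω)
    (U : ℕ → Ω → ℝ) (w : ℝ → ℝ) (a : ℝ) (k : ℕ) (ω : Ω) : ℝ :=
  cw P F U (fun u => w u * GoodW.ff a u) k ω / Dn P F U w k ω

namespace TD
variable {Ω : Type} [mΩ : MeasurableSpace Ω] {P : Measure Ω} [IsProbabilityMeasure P] {n : ℕ}
    {F : ℕ → MeasurableSpace Ω} {U : ℕ → Ω → ℝ} {ρ g Λ N δ : ℝ} {w : ℝ → ℝ} {a q K : ℝ}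

lemma Q_intble (D : TD P n F U ρ g Λ N δ) (W : GoodW w ρ a q K)
    {k : ℕ} (hk : k < n) {h : ℝ → ℝ} (hh : Measurable h) {L : ℝ} (hL : ∀ u, |w u * h u| ≤ L) :
    Integrable (fun ω => h (U k ω)) (QQ P F U w n) := by
  apply D.QQ_integrable W
  have mh : Measurable (fun ω => h (U k ω)) := hh.comp (D.meas' hk)
  refine AEB.integrable ?_ (mh.mul (D.Z_meas W))
  have hb : AEB P (fun ω => (w (U k ω) * h (U k ω)) * (Dn P F U w k ω)⁻¹ *
      ∏ i ∈ (Finset.range n).erase k, rr P F U w i ω) :=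
    ((AEB.of_le L (ae_of_all _ fun ω => hL _)).mul (inv_aeb k)).mul (prod_aeb W _)
  obtain ⟨C, hC⟩ := hb
  refine ⟨C, ?_⟩
  filter_upwards [hC] with ω hω
  rw [← Finset.mul_prod_erase _ _ (Finset.mem_range.2 hk)]
  refine le_trans (le_of_eq ?_) hω
  congr 1
  rw [rr, div_eq_mul_inv]; ring

lemma f_bd (W : GoodW w ρ a 0 K) (ha : 0 ≤ a) (ha' : a ≤ 1) (u : ℝ) :
    |GoodW.ff a u| ≤ 2 * (1 + |u|) ^ 2 := by
  have := abs_nonneg u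
  rcases le_total |u| 1 with hu | hu
  · have := GoodW.ff_small ha ha' hu; nlinarith
  · have := GoodW.ff_large ha ha' hu; nlinarith

lemma b1 (W : GoodW w ρ a 0 K) (ha : 0 ≤ a) (ha' : a ≤ 1) (u : ℝ) :
    |w u * GoodW.ff a u| ≤ 2 * K := by
  have h := f_bd W ha ha' u
  have h1 : (1:ℝ) ≤ 1 + |u| := by linarith [abs_nonneg u]
  have h0 := W.nonneg u
  rw [abs_mul, abs_of_nonneg h0]
  calc w u * |GoodW.ff a u| ≤ w u * (2 * (1 + |u|) ^ 2) := by gcongr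
    _ ≤ w u * (2 * (1 + |u|) ^ 6) := by
        gcongr
        norm_num
    _ = 2 * (w u * (1 + |u|) ^ 6) := by ring
    _ ≤ _ := by have := W.dec u; linarith

lemma b2 (W : GoodW w ρ a 0 K) (ha : 0 ≤ a) (ha' : a ≤ 1) (u : ℝ) :
    |w u * GoodW.ff a u ^ 2| ≤ 4 * K := by
  have h := pow_le_pow_left₀ (abs_nonneg _) (f_bd W ha ha' u) 2
  have h1 : (1:ℝ) ≤ 1 + |u| := by linarith [abs_nonneg u]
  have h0 := W.nonneg u
  rw [abs_mul, abs_pow, abs_of_nonneg h0]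
  calc w u * |GoodW.ff a u| ^ 2 ≤ w u * (2 * (1 + |u|) ^ 2) ^ 2 := by gcongr
    _ = w u * (4 * (1 + |u|) ^ 4) := by ring
    _ ≤ w u * (4 * (1 + |u|) ^ 6) := by
        gcongr
        norm_num
    _ = 4 * (w u * (1 + |u|) ^ 6) := by ring
    _ ≤ _ := by have := W.dec u; linarith

lemma b3 (W : GoodW w ρ a 0 K) (hρ : 0 < ρ) (hρ' : ρ < 1) (ha : 0 ≤ a) (ha' : a ≤ 1) (u : ℝ) :
    |w u * |GoodW.ff a u| ^ (2 + ρ)| ≤ 8 * K := by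
  have h1 : (1:ℝ) ≤ 1 + |u| := by linarith [abs_nonneg u]
  have h0 := W.nonneg u
  have h : |GoodW.ff a u| ^ (2 + ρ) ≤ 8 * (1 + |u|) ^ 6 := by
    calc |GoodW.ff a u| ^ (2 + ρ) ≤ (2 * (1 + |u|) ^ 2) ^ (2 + ρ) :=
          Real.rpow_le_rpow (abs_nonneg _) (f_bd W ha ha' u) (by linarith)
      _ ≤ (2 * (1 + |u|) ^ 2) ^ (3:ℝ) :=
          Real.rpow_le_rpow_of_exponent_le (by nlinarith) (by linarith)
      _ = (2 * (1 + |u|) ^ 2) ^ 3 := by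
          rw [show (3:ℝ) = ((3:ℕ):ℝ) by norm_num, Real.rpow_natCast]
      _ = _ := by ring
  rw [abs_of_nonneg (by positivity)]
  calc w u * |GoodW.ff a u| ^ (2 + ρ) ≤ w u * (8 * (1 + |u|) ^ 6) := by gcongr
    _ = 8 * (w u * (1 + |u|) ^ 6) := by ring
    _ ≤ _ := by have := W.dec u; linarith

lemma mu_meas (k : ℕ) : Measurable[F k] (mu P F U w a k) := (cw_meas _ _ _ _ _).div (Dn_meas k)

set_option maxHeartbeats 800000 in
/-- a.e. facts about the conditional moments -/
lemma tilt_basic (D : TD P n F U ρ g Λ N δ) (W : GoodW w ρ a 0 K) (hg : (6 + K) * g ^ 2 ≤ 1 / 2)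
    (ha : 0 ≤ a) (ha' : a ≤ 1) {k : ℕ} (hk : k < n) :
    ∀ᵐ ω ∂P, |mu P F U w a k ω - a / 2 * vv P F U k ω| ≤ 9 * K * bb P F U ρ k ω ∧
      |mu P F U w a k ω| ≤ 10 * K * vv P F U k ω ∧
      |cw P F U (fun u => w u * GoodW.ff a u ^ 2) k ω / Dn P F U w k ω - vv P F U k ω
        - mu P F U w a k ω ^ 2| ≤ 156 * K ^ 2 * (g ^ ρ * vv P F U k ω) ∧
      8 * (cw P F U (fun u => w u * |GoodW.ff a u| ^ (2 + ρ)) k ω / Dn P F U w k ω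
        + |mu P F U w a k ω| ^ (2 + ρ)) ≤ 10000 * K ^ 3 * (g ^ ρ * vv P F U k ω) := by
  have hρ := D.rho_pos
  have hρ' := D.rho_lt
  have hK := W.K_ge
  have k1 := D.key hk (W.meas.mul (GoodW.ff_meas a)) (W.wf1 hρ hρ' ha ha')
  have k2 := D.key hk (W.meas.mul ((GoodW.ff_meas a).pow_const 2)) (W.wf2 hρ hρ' ha ha')
  have k3 := D.key hk (ψ := fun u => w u * |GoodW.ff a u| ^ (2 + ρ))
    (W.meas.mul ((GoodW.ff_meas a).norm.pow_const (2 + ρ))) (W.wf3 hρ hρ' ha ha')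
  filter_upwards [D.basic hk, D.Dn_key W hg hk, k1, k2, k3] with ω hb hD k1 k2 k3
  obtain ⟨hv, hb0, hv2, hbg, hvb, hb3⟩ := hb
  have hDge := Dn_ge (P := P) (F := F) (U := U) (w := w) k ω
  have hD2 := hD.2
  have hbd := fun t L => div_Dn_le (P := P) (F := F) (U := U) (w := w) (t := t) (L := L) k ω
  have hDp := Dn_pos (P := P) (F := F) (U := U) (w := w) k ω
  unfold mu
  generalize hd : Dn P F U w k ω = d at *
  generalize hv' : vv P F U k ω = v at *
  generalize hb' : bb P F U ρ k ω = b at *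
  have k1' : |cw P F U (fun u => w u * GoodW.ff a u) k ω - 0 - a / 2 * v| ≤ (2 * K + 2) * b := k1
  have k2' : |cw P F U (fun u => w u * GoodW.ff a u ^ 2) k ω - 0 - 1 * v| ≤ (3 * K + 24) * b := k2
  generalize cw P F U (fun u => w u * GoodW.ff a u) k ω = c1 at *
  generalize cw P F U (fun u => w u * GoodW.ff a u ^ 2) k ω = c2 at *
  generalize cw P F U (fun u => w u * |GoodW.ff a u| ^ (2 + ρ)) k ω = c3 at *
  have hg1 : g ^ ρ ≤ 1 := Real.rpow_le_one D.g_pos.le D.g_le hρ.le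
  have hv1 : v ≤ 1 := hv2.trans (by have := D.g_le; have := D.g_pos; nlinarith)
  have hbv : b ≤ v := hbg.trans (by nlinarith)
  rw [zero_mul, sub_zero] at hD2
  have hKb : 0 ≤ K * b := by positivity
  have vd : |v * (1 - d) / d| ≤ 2 * (K * b) := by
    apply hbd
    rw [abs_mul, abs_sub_comm, abs_of_nonneg hv]
    calc v * |d - 1| ≤ 1 * (K * b) := mul_le_mul hv1 hD2 (abs_nonneg _) (by norm_num)
      _ = _ := by ring
  have m1 : |c1 / d - a / 2 * v| ≤ 9 * K * b := by
    have e : c1 / d - a / 2 * v = (c1 - 0 - a / 2 * v) / d + a / 2 * (v * (1 - d) / d) := by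
      field_simp; ring
    have h1 := hbd _ _ k1'
    have h2 : |a / 2 * (v * (1 - d) / d)| ≤ 1 / 2 * (2 * (K * b)) := by
      rw [abs_mul, abs_of_nonneg (by linarith : 0 ≤ a / 2)]
      exact mul_le_mul (by linarith) vd (abs_nonneg _) (by norm_num)
    have h3 : b ≤ K * b := by nlinarith
    rw [e]
    refine (abs_add_le _ _).trans ?_
    nlinarith
  have m2 : |c1 / d| ≤ 10 * K * v := by
    have e : c1 / d = (c1 / d - a / 2 * v) + a / 2 * v := by ring
    rw [e]
    refine (abs_add_le _ _).trans ?_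
    rw [abs_of_nonneg (by positivity : 0 ≤ a / 2 * v)]
    have : a / 2 * v ≤ K * v := by gcongr; linarith
    have : 9 * K * b ≤ 9 * K * v := by gcongr
    linarith
  have hK2 : K ≤ K ^ 2 := by nlinarith
  have hK3 : K ^ 2 ≤ K ^ 3 := by nlinarith
  refine ⟨m1, m2, ?_, ?_⟩
  · have e : c2 / d - v - (c1 / d) ^ 2 = (c2 - 0 - 1 * v) / d + v * (1 - d) / d - (c1 / d) ^ 2 := by
      field_simp; ring
    have h1 := hbd _ _ k2'
    have h2 : (c1 / d) ^ 2 ≤ 100 * K ^ 2 * b := by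
      have := pow_le_pow_left₀ (abs_nonneg _) m2 2
      rw [sq_abs] at this
      calc (c1 / d) ^ 2 ≤ (10 * K * v) ^ 2 := this
        _ = 100 * K ^ 2 * v ^ 2 := by ring
        _ ≤ _ := by gcongr
    rw [e]
    refine (abs_sub _ _).trans ?_
    rw [abs_of_nonneg (sq_nonneg (c1 / d))]
    have h3 := abs_add_le ((c2 - 0 - 1 * v) / d) (v * (1 - d) / d)
    have h4 : K * b ≤ K ^ 2 * b := by gcongr
    have h5 : 1 * b ≤ K ^ 2 * b := by gcongr; linarith
    have h6 : 156 * K ^ 2 * b ≤ 156 * K ^ 2 * (g ^ ρ * v) := by gcongr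
    linarith
  · have h1 : c3 / d ≤ 8 * K * b := by
      have k3' : |c3| ≤ 4 * K * b := by simpa using k3
      have := hbd _ _ k3'
      have := (abs_le.1 this).2
      linarith
    have h2 : |c1 / d| ^ (2 + ρ) ≤ 1000 * K ^ 3 * b := by
      calc |c1 / d| ^ (2 + ρ) ≤ (10 * K * v) ^ (2 + ρ) :=
            Real.rpow_le_rpow (abs_nonneg _) m2 (by linarith)
        _ = (10 * K) ^ (2 + ρ) * v ^ (2 + ρ) := Real.mul_rpow (by positivity) hv
        _ ≤ (10 * K) ^ (3:ℝ) * v ^ 2 := by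
            have hx : (10 * K) ^ (2 + ρ) ≤ (10 * K) ^ (3:ℝ) :=
              Real.rpow_le_rpow_of_exponent_le (by linarith) (by linarith)
            have hy : v ^ (2 + ρ) ≤ v ^ 2 := by
              rcases hv.eq_or_lt with h | h
              · rw [← h, Real.zero_rpow (by linarith)]; norm_num
              · rw [← Real.rpow_natCast]
                exact Real.rpow_le_rpow_of_exponent_ge h hv1 (by push_cast; linarith)
            gcongr
        _ = 1000 * K ^ 3 * v ^ 2 := by
            rw [show (3:ℝ) = ((3:ℕ):ℝ) by norm_num, Real.rpow_natCast]; ring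
        _ ≤ _ := by gcongr
    have h4 : K * b ≤ K ^ 3 * b := by gcongr; linarith
    have h6 : 10000 * K ^ 3 * b ≤ 10000 * K ^ 3 * (g ^ ρ * v) := by gcongr
    have h7 : 0 ≤ K ^ 3 * b := by positivity
    linarith

end TD
end SNC


set_option linter.unusedSectionVars false
set_option linter.unusedVariables false
namespace SNC
open MeasureTheory Filter ProbabilityTheory
open scoped Topology ENNReal NNReal
namespace TD
variable {Ω : Type} [mΩ : MeasurableSpace Ω] {P : Measure Ω} [IsProbabilityMeasure P] {n : ℕ}
    {F : ℕ → MeasurableSpace Ω} {U : ℕ → Ω → ℝ} {ρ g Λ N δ : ℝ} {w : ℝ → ℝ} {a q K : ℝ}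

lemma v_aeb (D : TD P n F U ρ g Λ N δ) {k : ℕ} (hk : k < n) : AEB P (vv P F U k) := by
  refine ⟨g ^ 2, ?_⟩
  filter_upwards [D.basic hk] with ω h
  rw [abs_of_nonneg h.1]; exact h.2.2.1

lemma cw_aeb {h : ℝ → ℝ} {L : ℝ} (hL : ∀ u, |h u| ≤ L) (k : ℕ) : AEB P (cw P F U h k) :=
  ⟨L, ae_bdd_abs_condExp_of_ae_bdd_abs (ae_of_all _ fun ω => hL _)⟩

lemma cwd_aeb {h : ℝ → ℝ} {L : ℝ} (hL : ∀ u, |h u| ≤ L) (k : ℕ) :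
    AEB P (fun ω => cw P F U h k ω / Dn P F U w k ω) := by
  have := (cw_aeb (P := P) (F := F) (U := U) hL k).mul (inv_aeb (P := P) (F := F) (U := U) (w := w) k)
  simpa only [div_eq_mul_inv] using this

lemma mu_aeb (W : GoodW w ρ a 0 K) (ha : 0 ≤ a) (ha' : a ≤ 1) (k : ℕ) : AEB P (mu P F U w a k) :=
  cwd_aeb (b1 W ha ha') k

lemma tilted_BE (D : TD P n F U ρ g Λ N δ) (W : GoodW w ρ a 0 K) (hg : (6 + K) * g ^ 2 ≤ 1 / 2)
    (ha : 0 ≤ a) (ha' : a ≤ 1) {s : ℝ} (hs : 1 ≤ s) (hN : N = s ^ 2) :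
    BEData (QQ P F U w n) n F (fun k ω => (GoodW.ff a (U k ω) - mu P F U w a k ω) / s)
      (fun k ω => vv P F U k ω / s ^ 2) ρ ((10000 * K ^ 3) ^ (1 / ρ) * g) δ := by
  have hρ := D.rho_pos
  have hρ' := D.rho_lt
  have hK := W.K_ge
  have hK1 : (1:ℝ) ≤ K ^ 3 := one_le_pow₀ hK
  have hK2 : (1:ℝ) ≤ 10000 * K ^ 3 := by linarith
  have hg0 := D.g_pos
  have hs0 : 0 < s := by linarith
  have := D.QQ_prob W hg
  have hac : QQ P F U w n ≪ P := QQ_ac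
  have hgp : ((10000 * K ^ 3) ^ (1 / ρ) * g) ^ ρ = 10000 * K ^ 3 * g ^ ρ := by
    rw [Real.mul_rpow (by positivity) hg0.le, ← Real.rpow_mul (by positivity),
      one_div_mul_cancel hρ.ne', Real.rpow_one]
  have mff : ∀ k, k < n → Measurable (fun ω => GoodW.ff a (U k ω)) := fun k hk =>
    (GoodW.ff_meas a).comp (D.meas' hk)
  have mmu : ∀ k, Measurable (mu P F U w a k) := fun k => (mu_meas k).mono (D.F_le k) le_rfl
  have mvv : ∀ k, Measurable (vv P F U k) := fun k => (D.v_meas k).mono (D.F_le k) le_rfl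
  have if1 : ∀ k, k < n → Integrable (fun ω => GoodW.ff a (U k ω)) (QQ P F U w n) := fun k hk =>
    D.Q_intble W hk (GoodW.ff_meas a) (b1 W ha ha')
  have if2 : ∀ k, k < n → Integrable (fun ω => GoodW.ff a (U k ω) ^ 2) (QQ P F U w n) := fun k hk =>
    D.Q_intble W hk (h := fun u => GoodW.ff a u ^ 2) ((GoodW.ff_meas a).pow_const 2) (b2 W ha ha')
  have m3 : Measurable (fun u => |GoodW.ff a u| ^ (2 + ρ)) := (GoodW.ff_meas a).norm.pow_const (2 + ρ)
  have if3 : ∀ k, k < n → Integrable (fun ω => |GoodW.ff a (U k ω)| ^ (2 + ρ)) (QQ P F U w n) :=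
    fun k hk => D.Q_intble W hk (h := fun u => |GoodW.ff a u| ^ (2 + ρ)) m3 (b3 W hρ hρ' ha ha')
  have bmu : ∀ k, AEB P (mu P F U w a k) := fun k => mu_aeb W ha ha' k
  have mm3 : ∀ k, Measurable (fun ω => |mu P F U w a k ω| ^ (2 + ρ)) := fun k =>
    (mmu k).norm.pow_const (2 + ρ)
  have bm3 : ∀ k, AEB P (fun ω => |mu P F U w a k ω| ^ (2 + ρ)) := fun k => by
    obtain ⟨C, hC⟩ := bmu k
    refine ⟨C ^ (2 + ρ), ?_⟩
    filter_upwards [hC] with ω hω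
    rw [abs_of_nonneg (by positivity)]
    exact Real.rpow_le_rpow (abs_nonneg _) hω (by linarith)
  have ixi : ∀ k, k < n → Integrable
      (fun ω => |(GoodW.ff a (U k ω) - mu P F U w a k ω) / s| ^ (2 + ρ)) (QQ P F U w n) := by
    intro k hk
    have hi := ((if3 k hk).add (((bm3 k).mono_ac hac).integrable (mm3 k))).const_mul 8
    refine hi.mono' ((((mff k hk).sub (mmu k)).div_const s).norm.pow_const (2 + ρ)).aestronglyMeasurable
      (ae_of_all _ fun ω => ?_)
    rw [Real.norm_eq_abs, abs_of_nonneg (by positivity)]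
    refine le_trans ?_ (rpow_sub_le hρ hρ')
    refine Real.rpow_le_rpow (abs_nonneg _) ?_ (by linarith)
    rw [abs_div, abs_of_pos hs0]
    exact div_le_self (abs_nonneg _) hs
  refine ⟨D.F_mono, D.F_le, ?_, ixi, ?_, ?_, ?_, ?_, ?_, ?_⟩
  · intro k hk
    exact (((GoodW.ff_meas a).comp (D.meas k hk)).sub
      ((mu_meas k).mono (D.F_mono (Nat.le_succ k)) le_rfl)).div_const s
  · intro k hk
    exact (D.v_meas k).div_const _
  · intro k hk
    filter_upwards [hac.ae_le (D.basic hk)] with ω h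
    refine ⟨div_nonneg h.1 (by positivity), ?_⟩
    calc vv P F U k ω / s ^ 2 ≤ vv P F U k ω := div_le_self h.1 (one_le_pow₀ hs)
      _ ≤ g ^ 2 := h.2.2.1
      _ ≤ _ := by
        gcongr
        have : 1 ≤ (10000 * K ^ 3) ^ (1 / ρ) := Real.one_le_rpow hK2 (by positivity)
        nlinarith
  · intro k hk G0 hG0 bG0
    obtain ⟨G, hG, bG, hGe⟩ := clamp_ex (P := P) hG0 bG0
    have mG : Measurable G := hG.mono (D.F_le k) le_rfl
    have h1 := D.Qint W hg hk hG bG (GoodW.ff_meas a) (b1 W ha ha')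
    have bGQ := bG.mono_ac hac
    have i1 : Integrable (fun ω => G ω * GoodW.ff a (U k ω)) (QQ P F U w n) :=
      bGQ.integrable_mul mG (if1 k hk)
    have i2 : Integrable (fun ω => G ω * mu P F U w a k ω) (QQ P F U w n) :=
      (bGQ.mul ((bmu k).mono_ac hac)).integrable (mG.mul (mmu k))
    have h2 : ∫ ω, (G ω * GoodW.ff a (U k ω) - G ω * mu P F U w a k ω) ∂(QQ P F U w n) = 0 := by
      rw [integral_sub i1 i2, h1]; exact sub_self _
    calc ∫ ω, G0 ω * ((GoodW.ff a (U k ω) - mu P F U w a k ω) / s) ∂(QQ P F U w n)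
        = ∫ ω, (1 / s) * (G ω * GoodW.ff a (U k ω) - G ω * mu P F U w a k ω) ∂(QQ P F U w n) := by
          refine integral_congr_ae ?_
          filter_upwards [hGe] with ω hω
          rw [hω]; ring
      _ = 0 := by rw [integral_const_mul, h2, mul_zero]
  · intro k hk G0 hG0 bG0
    obtain ⟨G, hG, bG, hGe⟩ := clamp_ex (P := P) hG0 bG0
    have mG : Measurable G := hG.mono (D.F_le k) le_rfl
    have bGQ := bG.mono_ac hac
    have mm : Measurable (fun u => GoodW.ff a u ^ 2) := (GoodW.ff_meas a).pow_const 2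
    have h2 := D.Qint W hg hk hG bG mm (b2 W ha ha')
    have h1 := D.Qint W hg hk (G := fun ω => G ω * mu P F U w a k ω) (hG.mul (mu_meas k))
      (bG.mul (bmu k)) (GoodW.ff_meas a) (b1 W ha ha')
    set c2 : Ω → ℝ := fun ω =>
      cw P F U (fun u => w u * GoodW.ff a u ^ 2) k ω / Dn P F U w k ω with hc2
    have bc2 : AEB (QQ P F U w n) c2 := (cwd_aeb (b2 W ha ha') k).mono_ac hac
    have mc2 : Measurable c2 := ((cw_meas P F U _ k).div (Dn_meas k)).mono (D.F_le k) le_rfl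
    have bmQ := (bmu k).mono_ac hac
    have bvQ := (D.v_aeb hk).mono_ac hac
    have i2 : Integrable (fun ω => G ω * GoodW.ff a (U k ω) ^ 2) (QQ P F U w n) :=
      bGQ.integrable_mul mG (if2 k hk)
    have i1 : Integrable (fun ω => G ω * mu P F U w a k ω * GoodW.ff a (U k ω)) (QQ P F U w n) :=
      (bGQ.mul bmQ).integrable_mul (mG.mul (mmu k)) (if1 k hk)
    have i0 : Integrable (fun ω => G ω * mu P F U w a k ω * mu P F U w a k ω) (QQ P F U w n) :=
      ((bGQ.mul bmQ).mul bmQ).integrable ((mG.mul (mmu k)).mul (mmu k))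
    have iv : Integrable (fun ω => G ω * vv P F U k ω) (QQ P F U w n) :=
      (bGQ.mul bvQ).integrable (mG.mul (mvv k))
    have ic : Integrable (fun ω => G ω * c2 ω) (QQ P F U w n) :=
      (bGQ.mul bc2).integrable (mG.mul mc2)
    have e1 : ∫ ω, G0 ω * (((GoodW.ff a (U k ω) - mu P F U w a k ω) / s) ^ 2 - vv P F U k ω / s ^ 2)
        ∂(QQ P F U w n) = (1 / s ^ 2) * ∫ ω, G ω * (c2 ω - vv P F U k ω - mu P F U w a k ω ^ 2)
        ∂(QQ P F U w n) := by
      have j1 : ∫ ω, G0 ω * (((GoodW.ff a (U k ω) - mu P F U w a k ω) / s) ^ 2 - vv P F U k ω / s ^ 2)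
        ∂(QQ P F U w n) = (1 / s ^ 2) * ∫ ω, (G ω * GoodW.ff a (U k ω) ^ 2
          - 2 * (G ω * mu P F U w a k ω * GoodW.ff a (U k ω))
          + G ω * mu P F U w a k ω * mu P F U w a k ω - G ω * vv P F U k ω) ∂(QQ P F U w n) := by
        rw [← integral_const_mul]
        refine integral_congr_ae ?_
        filter_upwards [hGe] with ω hω
        rw [hω]; field_simp; ring
      have j2 : ∫ ω, G ω * (c2 ω - vv P F U k ω - mu P F U w a k ω ^ 2) ∂(QQ P F U w n)
          = ∫ ω, (G ω * c2 ω - G ω * mu P F U w a k ω * mu P F U w a k ω - G ω * vv P F U k ω)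
            ∂(QQ P F U w n) := by
        refine integral_congr_ae (ae_of_all _ fun ω => ?_)
        simp only; ring
      have ia : Integrable (fun ω => G ω * GoodW.ff a (U k ω) ^ 2
          - 2 * (G ω * mu P F U w a k ω * GoodW.ff a (U k ω))) (QQ P F U w n) :=
        i2.sub (i1.const_mul 2)
      have ib : Integrable (fun ω => G ω * GoodW.ff a (U k ω) ^ 2
          - 2 * (G ω * mu P F U w a k ω * GoodW.ff a (U k ω))
          + G ω * mu P F U w a k ω * mu P F U w a k ω) (QQ P F U w n) := ia.add i0
      have id' : Integrable (fun ω => G ω * c2 ω - G ω * mu P F U w a k ω * mu P F U w a k ω)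
        (QQ P F U w n) := ic.sub i0
      rw [j1, j2, integral_sub ib iv, integral_add ia i0, integral_sub i2 (i1.const_mul 2),
        integral_const_mul, h2, h1, integral_sub id' iv, integral_sub ic i0]
      simp only [← mu.eq_1]
      ring
    rw [e1, abs_mul, abs_of_pos (by positivity : 0 < 1 / s ^ 2), hgp]
    have e2 : ∫ ω, |G0 ω| * (vv P F U k ω / s ^ 2) ∂(QQ P F U w n) =
        (1 / s ^ 2) * ∫ ω, |G ω| * vv P F U k ω ∂(QQ P F U w n) := by
      rw [← integral_const_mul]
      refine integral_congr_ae ?_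
      filter_upwards [hGe] with ω hω
      rw [hω]; ring
    rw [e2, mul_left_comm]
    refine mul_le_mul_of_nonneg_left ?_ (by positivity)
    have iav : Integrable (fun ω => |G ω| * vv P F U k ω) (QQ P F U w n) :=
      (bGQ.abs.mul bvQ).integrable (mG.norm.mul (mvv k))
    rw [← integral_const_mul]
    refine (abs_integral_le_integral_abs).trans ?_
    refine integral_mono_of_nonneg (ae_of_all _ fun ω => abs_nonneg _) (iav.const_mul _) ?_
    filter_upwards [hac.ae_le (D.tilt_basic W hg ha ha' hk), hac.ae_le (D.basic hk)] with ω hω hb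
    rw [abs_mul]
    have h3 := hω.2.2.1
    have hgv : 0 ≤ g ^ ρ * vv P F U k ω := mul_nonneg (by positivity) hb.1
    have hKK : 156 * K ^ 2 ≤ 10000 * K ^ 3 := by nlinarith [sq_nonneg K]
    calc |G ω| * |c2 ω - vv P F U k ω - mu P F U w a k ω ^ 2|
        ≤ |G ω| * (156 * K ^ 2 * (g ^ ρ * vv P F U k ω)) := by gcongr
      _ ≤ |G ω| * (10000 * K ^ 3 * (g ^ ρ * vv P F U k ω)) := by gcongr
      _ = _ := by ring
  · intro k hk G0 hG0 bG0
    obtain ⟨G1, hG1, bG1, hGe1⟩ := clamp_ex (P := P) hG0 bG0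
    set G : Ω → ℝ := fun ω => |G1 ω| with hGdef
    have hG : Measurable[F k] G := measurable_norm.comp hG1
    have bG : AEB P G := bG1.abs
    have mG : Measurable G := hG.mono (D.F_le k) le_rfl
    have bGQ := bG.mono_ac hac
    have bvQ := (D.v_aeb hk).mono_ac hac
    have G0' : ∀ ω, 0 ≤ G ω := fun ω => abs_nonneg _
    have h3 := D.Qint W hg hk hG bG m3 (b3 W hρ hρ' ha ha')
    set c3 : Ω → ℝ := fun ω =>
      cw P F U (fun u => w u * |GoodW.ff a u| ^ (2 + ρ)) k ω / Dn P F U w k ω with hc3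
    have bc3 : AEB (QQ P F U w n) c3 := (cwd_aeb (b3 W hρ hρ' ha ha') k).mono_ac hac
    have mc3 : Measurable c3 := ((cw_meas P F U _ k).div (Dn_meas k)).mono (D.F_le k) le_rfl
    have i3 : Integrable (fun ω => G ω * |GoodW.ff a (U k ω)| ^ (2 + ρ)) (QQ P F U w n) :=
      bGQ.integrable_mul mG (if3 k hk)
    have im : Integrable (fun ω => G ω * |mu P F U w a k ω| ^ (2 + ρ)) (QQ P F U w n) :=
      (bGQ.mul ((bm3 k).mono_ac hac)).integrable (mG.mul (mm3 k))
    have ic : Integrable (fun ω => G ω * c3 ω) (QQ P F U w n) :=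
      (bGQ.mul bc3).integrable (mG.mul mc3)
    have iv : Integrable (fun ω => G ω * vv P F U k ω) (QQ P F U w n) :=
      (bGQ.mul bvQ).integrable (mG.mul (mvv k))
    have e2 : ∫ ω, |G0 ω| * (vv P F U k ω / s ^ 2) ∂(QQ P F U w n) =
        (1 / s ^ 2) * ∫ ω, G ω * vv P F U k ω ∂(QQ P F U w n) := by
      rw [← integral_const_mul]
      refine integral_congr_ae ?_
      filter_upwards [hGe1] with ω hω
      simp only [hGdef]
      rw [hω]; ring
    rw [e2, hgp]
    have e3 : ∫ ω, (1 / s ^ 2) * (8 * (G ω * |GoodW.ff a (U k ω)| ^ (2 + ρ)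
        + G ω * |mu P F U w a k ω| ^ (2 + ρ))) ∂(QQ P F U w n)
        = ∫ ω, (1 / s ^ 2) * (8 * (G ω * c3 ω + G ω * |mu P F U w a k ω| ^ (2 + ρ))) ∂(QQ P F U w n) := by
      rw [integral_const_mul, integral_const_mul, integral_const_mul, integral_const_mul,
        integral_add i3 im, integral_add ic im, h3]
    have i3m : Integrable (fun ω => (1 / s ^ 2) * (8 * (G ω * |GoodW.ff a (U k ω)| ^ (2 + ρ)
        + G ω * |mu P F U w a k ω| ^ (2 + ρ)))) (QQ P F U w n) :=
      ((i3.add im).const_mul 8).const_mul _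
    have icm : Integrable (fun ω => (1 / s ^ 2) * (8 * (G ω * c3 ω
        + G ω * |mu P F U w a k ω| ^ (2 + ρ)))) (QQ P F U w n) :=
      ((ic.add im).const_mul 8).const_mul _
    calc ∫ ω, |G0 ω| * |(GoodW.ff a (U k ω) - mu P F U w a k ω) / s| ^ (2 + ρ) ∂(QQ P F U w n)
        ≤ ∫ ω, (1 / s ^ 2) * (8 * (G ω * |GoodW.ff a (U k ω)| ^ (2 + ρ)
          + G ω * |mu P F U w a k ω| ^ (2 + ρ))) ∂(QQ P F U w n) := by
          refine integral_mono_of_nonneg (ae_of_all _ fun ω => ?_) i3m ?_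
          · exact mul_nonneg (abs_nonneg _) (by positivity)
          · filter_upwards [hGe1] with ω hω
            rw [hω, abs_div, Real.div_rpow (abs_nonneg _) (abs_nonneg _), abs_of_pos hs0]
            have hs2 : s ^ 2 ≤ s ^ (2 + ρ) := by
              rw [← Real.rpow_natCast]
              exact Real.rpow_le_rpow_of_exponent_le hs (by push_cast; linarith)
            have := rpow_sub_le (x := GoodW.ff a (U k ω)) (y := mu P F U w a k ω) hρ hρ'
            have hp : 0 ≤ |GoodW.ff a (U k ω) - mu P F U w a k ω| ^ (2 + ρ) := by positivity
            calc |G1 ω| * (|GoodW.ff a (U k ω) - mu P F U w a k ω| ^ (2 + ρ) / s ^ (2 + ρ))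
                ≤ |G1 ω| * ((8 * (|GoodW.ff a (U k ω)| ^ (2 + ρ) + |mu P F U w a k ω| ^ (2 + ρ))) / s ^ 2) := by
                  gcongr
              _ = _ := by simp only [hGdef]; ring
      _ = _ := e3
      _ ≤ ∫ ω, (10000 * K ^ 3 * g ^ ρ * (1 / s ^ 2)) * (G ω * vv P F U k ω) ∂(QQ P F U w n) := by
          refine integral_mono_ae icm (iv.const_mul _) ?_
          filter_upwards [hac.ae_le (D.tilt_basic W hg ha ha' hk)] with ω hω
          have h5 := hω.2.2.2
          calc (1 / s ^ 2) * (8 * (G ω * c3 ω + G ω * |mu P F U w a k ω| ^ (2 + ρ)))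
              = (1 / s ^ 2) * (G ω * (8 * (c3 ω + |mu P F U w a k ω| ^ (2 + ρ)))) := by ring
            _ ≤ (1 / s ^ 2) * (G ω * (10000 * K ^ 3 * (g ^ ρ * vv P F U k ω))) := by
                have := G0' ω
                gcongr
            _ = _ := by ring
      _ = _ := by rw [integral_const_mul]; ring
  · filter_upwards [hac.ae_le D.var] with ω hω
    rw [hN] at hω
    rw [← Finset.sum_div]
    have e : (∑ k ∈ Finset.range n, vv P F U k ω) / s ^ 2 - 1 =
        (∑ k ∈ Finset.range n, vv P F U k ω - s ^ 2) / s ^ 2 := by field_simp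
    rw [e, abs_div, abs_of_pos (by positivity : 0 < s ^ 2), div_le_iff₀ (by positivity)]
    linarith
end TD
end SNC


set_option linter.unusedSectionVars false
set_option linter.unusedVariables false
namespace SNC
open MeasureTheory Filter ProbabilityTheory
open scoped Topology ENNReal NNReal

lemma expo_tail {Ω : Type} [MeasurableSpace Ω] {Q : Measure Ω} [IsProbabilityMeasure Q]
    {Y : Ω → ℝ} (hY : Measurable Y) {D : ℝ} (hCB : CB Q Y D) {x h : ℝ} (hx : 0 ≤ x) :
    ∫ ω, (Set.Ici (-h)).indicator (fun y => Real.exp (-x * (y + h))) (Y ω) ∂Q ≤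
      Real.exp (-x * h) * (Real.exp (x ^ 2 / 2) * (1 - stdNormalCDF (x - h))) + D := by
  set f : ℕ → ℝ → ℝ := fun m => (Set.Icc (-h) (m:ℝ)).indicator (fun y => Real.exp (-x * (y - (-h))))
    with hf
  set f0 : ℝ → ℝ := (Set.Ici (-h)).indicator (fun y => Real.exp (-x * (y + h))) with hf0
  have mf : ∀ m, Measurable (f m) := fun m => by
    refine Measurable.indicator ?_ measurableSet_Icc; fun_prop
  have f0b : ∀ y, 0 ≤ f0 y ∧ f0 y ≤ 1 := by
    intro y
    simp only [hf0, Set.indicator]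
    split_ifs with hy
    · refine ⟨(Real.exp_pos _).le, Real.exp_le_one_iff.2 ?_⟩
      have : -h ≤ y := hy
      nlinarith
    · simp
  have ff0 : ∀ m y, f m y = if y ≤ m then f0 y else 0 := by
    intro m y
    simp only [hf, hf0, Set.indicator, Set.mem_Icc, Set.mem_Ici, sub_neg_eq_add]
    by_cases h1 : y ≤ m <;> by_cases h2 : -h ≤ y <;> simp [h1, h2]
  have fb : ∀ m y, 0 ≤ f m y ∧ f m y ≤ 1 := by
    intro m y; rw [ff0]; split_ifs
    · exact f0b y
    · simp
  have hle : ∀ m y, f m y ≤ f0 y := by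
    intro m y; rw [ff0]; split_ifs
    · exact le_rfl
    · exact (f0b y).1
  have iph : Integrable (fun y => phi y * Real.exp (-x * y)) := phi_exp_integrable x
  have hB : ∫ y, phi y * f0 y = Real.exp (-x * h) * (Real.exp (x ^ 2 / 2) * (1 - stdNormalCDF (x - h))) := by
    have e : (fun y => phi y * f0 y) =
        (Set.Ici (-h)).indicator (fun y => Real.exp (-x * h) * (phi y * Real.exp (-x * y))) := by
      funext y
      simp only [hf0, Set.indicator]
      split_ifs
      · rw [mul_left_comm, ← Real.exp_add]; congr 2; ring
      · simp
    rw [e, integral_indicator measurableSet_Ici, integral_Ici_eq_integral_Ioi, integral_const_mul,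
      gam_exp_tail]
    simp [sub_eq_add_neg]
  have iB : Integrable (fun y => phi y * f0 y) := by
    have e : (fun y => phi y * f0 y) =
        (Set.Ici (-h)).indicator (fun y => Real.exp (-x * h) * (phi y * Real.exp (-x * y))) := by
      funext y
      simp only [hf0, Set.indicator]
      split_ifs
      · rw [mul_left_comm, ← Real.exp_add]; congr 2; ring
      · simp
    rw [e]
    exact (iph.const_mul _).indicator measurableSet_Ici
  have hm : ∀ m, ∫ ω, f m (Y ω) ∂Q ≤ (∫ y, phi y * f0 y) + D := by
    intro m
    have h1 := layer_cake hY hCB (mf m) zero_le_one (fun y => (fb m y).1) (fun y => (fb m y).2)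
      (fun s hs => expo_superlevel_left (-h) m x s hx hs)
    rw [gam_integral, one_mul] at h1
    refine h1.trans (add_le_add_left ?_ _)
    refine integral_mono_of_nonneg (ae_of_all _ fun y => ?_) iB (ae_of_all _ fun y => ?_)
    · exact mul_nonneg (phi_pos y).le (fb m y).1
    · exact mul_le_mul_of_nonneg_left (hle m y) (phi_pos y).le
  rw [← hB]
  have hlim : Tendsto (fun m => ∫ ω, f m (Y ω) ∂Q) atTop (𝓝 (∫ ω, f0 (Y ω) ∂Q)) := by
    refine tendsto_integral_of_dominated_convergence (fun _ => 1)
      (fun m => ((mf m).comp hY).aestronglyMeasurable) (integrable_const _) ?_ ?_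
    · intro m
      exact ae_of_all _ fun ω => by
        rw [Real.norm_eq_abs, abs_of_nonneg (fb m _).1]; exact (fb m _).2
    · refine ae_of_all _ fun ω => ?_
      refine tendsto_const_nhds.congr' ?_
      obtain ⟨m0, hm0⟩ := exists_nat_ge (Y ω)
      filter_upwards [eventually_ge_atTop m0] with m hmm
      rw [ff0, if_pos]
      exact hm0.trans (by exact_mod_cast hmm)
  exact le_of_tendsto' hlim hm

lemma sqrt_dev {a s V η : ℝ} (ha : 0 ≤ a) (hs : 0 < s) (hV : 0 ≤ V) (hη : |V - s ^ 2| ≤ s ^ 2 * η) :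
    a / 2 * s ^ 2 * (1 - η ^ 2) ≤ a * s * Real.sqrt V - a / 2 * V := by
  set r := Real.sqrt V with hr
  have hr0 : 0 ≤ r := Real.sqrt_nonneg _
  have hrV : V = r ^ 2 := (Real.sq_sqrt hV).symm
  rw [hrV] at hη ⊢
  have h1 : |r - s| * s ≤ s ^ 2 * η := by
    have : |r ^ 2 - s ^ 2| = |r - s| * (r + s) := by
      rw [show r ^ 2 - s ^ 2 = (r - s) * (r + s) by ring, abs_mul, abs_of_nonneg (by linarith : 0 ≤ r + s)]
    rw [this] at hη
    nlinarith [abs_nonneg (r - s)]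
  have h2 : |r - s| ≤ s * η := by
    have : |r - s| * s ≤ (s * η) * s := by nlinarith
    exact le_of_mul_le_mul_right this hs
  have h3 : (r - s) ^ 2 ≤ s ^ 2 * η ^ 2 := by
    have := pow_le_pow_left₀ (abs_nonneg _) h2 2
    rw [sq_abs] at this; linarith
  nlinarith

set_option maxHeartbeats 1000000 in
theorem main_lemma (ρ : ℝ) (hρ : 0 < ρ) (hρ' : ρ < 1) (K : ℝ) (hK : 1 ≤ K) :
    ∃ C g1 : ℝ, 0 < C ∧ 0 < g1 ∧ ∀ {Ω : Type} [mΩ : MeasurableSpace Ω] {P : Measure Ω}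
      [IsProbabilityMeasure P] {n : ℕ} {F : ℕ → MeasurableSpace Ω} {U : ℕ → Ω → ℝ}
      {g Λ N δ a s η : ℝ} {w : ℝ → ℝ} {Ev : Set Ω}
      (_ : TD P n F U ρ g Λ N δ) (_ : GoodW w ρ a 0 K), 0 ≤ a → a ≤ 1 → 1 ≤ s → N = s ^ 2 →
      g ≤ g1 → 0 ≤ δ → δ ≤ 1 → 0 ≤ Λ → 0 ≤ η → MeasurableSet Ev →
      (∀ ω ∈ Ev, a * s * Real.sqrt (∑ k ∈ Finset.range n, U k ω ^ 2) ≤ ∑ k ∈ Finset.range n, U k ω) →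
      (∀ ω ∈ Ev, |∑ k ∈ Finset.range n, U k ω ^ 2 - s ^ 2| ≤ s ^ 2 * η) →
      (∀ ω ∈ Ev, Real.exp (a * ∑ k ∈ Finset.range n, GoodW.ff a (U k ω)) ≤
        ∏ k ∈ Finset.range n, w (U k ω)) →
      P.real Ev ≤ (1 - stdNormalCDF (a * s)) *
        Real.exp (C * (Λ + s ^ 2 * δ ^ 2 + s ^ 2 * η ^ 2 + s * (g ^ ρ + δ))) := by
  obtain ⟨CB0, g0, hCB0, hg0, hBE⟩ := berry_esseen ρ hρ hρ'
  set T := 10000 * K ^ 3 with hT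
  have hK3 : (1:ℝ) ≤ K ^ 3 := one_le_pow₀ hK
  have hT1 : 1 ≤ T := by rw [hT]; linarith
  have hTr : 0 < T ^ (1 / ρ) := by positivity
  refine ⟨1 + 280 * K + 15 + 30 * CB0 * T, min (g0 / T ^ (1 / ρ)) (1 / (2 * (6 + K))), by positivity,
    lt_min (by positivity) (by positivity), ?_⟩
  intro Ω mΩ P _ n F U g Λ N δ a s η w Ev D W ha ha' hs hN hg hδ hδ' hΛ hη mEv h1 h2 h3
  have hgp := D.g_pos
  have hg1 : (6 + K) * g ^ 2 ≤ 1 / 2 := by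
    have h4 : g ≤ 1 / (2 * (6 + K)) := hg.trans (min_le_right _ _)
    rw [le_div_iff₀ (by positivity)] at h4
    have := D.g_le
    nlinarith
  have hg2 : T ^ (1 / ρ) * g ≤ g0 := by
    have h4 : g ≤ g0 / T ^ (1 / ρ) := hg.trans (min_le_left _ _)
    rw [le_div_iff₀ hTr] at h4; linarith
  have BE := D.tilted_BE W hg1 ha ha' hs hN
  have := D.QQ_prob W hg1
  have hcb := hBE BE (by positivity) hg2 hδ hδ'
  have hgT : (T ^ (1 / ρ) * g) ^ ρ = T * g ^ ρ := by
    rw [Real.mul_rpow (by positivity) hgp.le, ← Real.rpow_mul (by positivity),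
      one_div_mul_cancel hρ.ne', Real.rpow_one]
  rw [← hT, hgT] at hcb
  set Y : Ω → ℝ := fun ω => ∑ k ∈ Finset.range n, (GoodW.ff a (U k ω) - mu P F U w a k ω) / s with hY
  have mY : Measurable Y := by
    refine Finset.measurable_fun_sum _ fun k hk => ?_
    exact (((GoodW.ff_meas a).comp (D.meas' (Finset.mem_range.1 hk))).sub
      ((TD.mu_meas k).mono (D.F_le k) le_rfl)).div_const s
  set x := a * s with hx
  have hs0 : 0 < s := by linarith
  have hx0 : 0 ≤ x := by positivity
  have hxs : x ≤ s := by rw [hx]; nlinarith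
  set h := a / 2 * s * (η ^ 2 + δ ^ 2) + 9 * K * Λ / s with hh
  have hh0 : 0 ≤ h := by positivity
  set Dd := CB0 * (T * g ^ ρ + δ) with hDd
  have hDd0 : 0 ≤ Dd := by positivity
  have htail := expo_tail mY hcb (h := h) hx0
  set f0 : ℝ → ℝ := (Set.Ici (-h)).indicator (fun y => Real.exp (-x * (y + h))) with hf0
  have mf0 : Measurable f0 := by
    refine Measurable.indicator ?_ measurableSet_Ici; fun_prop
  have f0b : ∀ y, 0 ≤ f0 y ∧ f0 y ≤ 1 := by
    intro y
    simp only [hf0, Set.indicator]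
    split_ifs with hy
    · refine ⟨(Real.exp_pos _).le, Real.exp_le_one_iff.2 ?_⟩
      have : -h ≤ y := hy
      nlinarith
    · simp
  -- the pointwise bound
  set E0 := -(x ^ 2) / 2 + x ^ 2 * δ ^ 2 / 2 + 10 * K * Λ + x * h with hE0
  have hmu : ∀ᵐ ω ∂P, ∀ k ∈ Finset.range n,
      |mu P F U w a k ω - a / 2 * vv P F U k ω| ≤ 9 * K * bb P F U ρ k ω := by
    rw [Filter.eventually_all_finset]
    intro k hk
    filter_upwards [D.tilt_basic W hg1 ha ha' (Finset.mem_range.1 hk)] with ω hω using hω.1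
  have hpt : ∀ᵐ ω ∂P, Ev.indicator (fun _ => (1:ℝ)) ω ≤
      (Real.exp E0 * f0 (Y ω)) * ∏ k ∈ Finset.range n, rr P F U w k ω := by
    filter_upwards [hmu, D.lam, D.var, D.prodDn W hg1] with ω q1 q2 q3 q4
    have hz := TD.prod_nonneg' (P := P) (F := F) (U := U) W (Finset.range n) ω
    by_cases hω : ω ∈ Ev
    swap
    · rw [Set.indicator_of_notMem hω]
      exact mul_nonneg (mul_nonneg (Real.exp_pos _).le (f0b _).1) hz
    rw [Set.indicator_of_mem hω]
    have r1 := h1 ω hω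
    have r2 := h2 ω hω
    have r3 := h3 ω hω
    rw [TD.prodw (P := P) (F := F)] at r3
    rw [zero_mul, abs_zero, zero_mul, add_zero, zero_add] at q4
    set V := ∑ k ∈ Finset.range n, U k ω ^ 2 with hV
    set S := ∑ k ∈ Finset.range n, U k ω with hS
    set Sf := ∑ k ∈ Finset.range n, GoodW.ff a (U k ω) with hSf
    have eSf : Sf = S - a / 2 * V := by
      rw [hSf, hS, hV, Finset.mul_sum, ← Finset.sum_sub_distrib]; rfl
    have hV0 : 0 ≤ V := Finset.sum_nonneg fun k _ => sq_nonneg _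
    have r4 := sqrt_dev ha hs0 hV0 r2
    have r5 : a / 2 * s ^ 2 * (1 - η ^ 2) ≤ Sf := by rw [eSf]; linarith
    set Sm := ∑ k ∈ Finset.range n, mu P F U w a k ω with hSm
    have r6 : |Sm - a / 2 * ∑ k ∈ Finset.range n, vv P F U k ω| ≤ 9 * K * Λ := by
      rw [hSm, Finset.mul_sum, ← Finset.sum_sub_distrib]
      refine (Finset.abs_sum_le_sum_abs _ _).trans ((Finset.sum_le_sum q1).trans ?_)
      rw [← Finset.mul_sum]; gcongr
    rw [hN] at q3
    have r7 : |a / 2 * (∑ k ∈ Finset.range n, vv P F U k ω - s ^ 2)| ≤ a / 2 * (s ^ 2 * δ ^ 2) := by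
      rw [abs_mul, abs_of_nonneg (by linarith : 0 ≤ a / 2)]; gcongr
    have r6u := abs_le.1 r6
    have r7u := abs_le.1 r7
    have eY : s * Y ω = Sf - Sm := by
      simp only [hY]
      rw [← Finset.sum_div, Finset.sum_sub_distrib, mul_comm, div_mul_cancel₀ _ hs0.ne']
    have r8 : -h ≤ Y ω := by
      have e : s * h = a / 2 * s ^ 2 * (η ^ 2 + δ ^ 2) + 9 * K * Λ := by rw [hh]; field_simp
      have : s * (-h) ≤ s * Y ω := by rw [eY, mul_neg, e]; linarith
      exact le_of_mul_le_mul_left this hs0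
    have ef : f0 (Y ω) = Real.exp (-x * (Y ω + h)) := Set.indicator_of_mem (Set.mem_Ici.2 r8) _
    rw [ef, ← Real.exp_add]
    have r9 : a * Sf = x * Y ω + a * Sm := by rw [hx, mul_assoc, eY]; ring
    have r10 : x ^ 2 / 2 - x ^ 2 * δ ^ 2 / 2 - 9 * K * Λ ≤ a * Sm := by
      have h5 : a / 2 * s ^ 2 * (1 - δ ^ 2) - 9 * K * Λ ≤ Sm := by linarith
      have h6 := mul_le_mul_of_nonneg_left h5 ha
      have h7 : a * (9 * K * Λ) ≤ 9 * K * Λ := mul_le_of_le_one_left (by positivity) ha'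
      have h8 : a * (a / 2 * s ^ 2 * (1 - δ ^ 2)) = x ^ 2 / 2 - x ^ 2 * δ ^ 2 / 2 := by rw [hx]; ring
      rw [mul_sub, h8] at h6
      linarith
    calc (1:ℝ) = Real.exp (-(a * Sf)) * Real.exp (a * Sf) := by rw [← Real.exp_add]; simp
      _ ≤ Real.exp (-(a * Sf)) * ((∏ k ∈ Finset.range n, rr P F U w k ω) *
            ∏ k ∈ Finset.range n, Dn P F U w k ω) := by gcongr
      _ ≤ Real.exp (-(a * Sf)) * ((∏ k ∈ Finset.range n, rr P F U w k ω) * Real.exp (K * Λ)) := by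
          gcongr
      _ = Real.exp (-(a * Sf) + K * Λ) * ∏ k ∈ Finset.range n, rr P F U w k ω := by
          rw [Real.exp_add]; ring
      _ ≤ _ := by
          refine mul_le_mul_of_nonneg_right (Real.exp_le_exp.2 ?_) hz
          rw [r9, hE0]; linarith
  have hInt : P.real Ev ≤ Real.exp E0 * ∫ ω, f0 (Y ω) ∂(TD.QQ P F U w n) := by
    rw [← integral_const_mul, D.QQ_int W]
    have e : P.real Ev = ∫ ω, Ev.indicator (fun _ => (1:ℝ)) ω ∂P := by
      rw [integral_indicator mEv]; simp
    rw [e]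
    refine integral_mono_ae ((integrable_const _).indicator mEv) ?_ hpt
    have b1 : AEB P (fun ω => Real.exp E0 * f0 (Y ω)) := ⟨Real.exp E0, ae_of_all _ fun ω => by
      rw [abs_of_nonneg (mul_nonneg (Real.exp_pos _).le (f0b _).1)]
      exact mul_le_of_le_one_right (Real.exp_pos _).le (f0b _).2⟩
    exact (b1.mul (TD.prod_aeb W _)).integrable (((mf0.comp mY).const_mul _).mul (D.Z_meas W))
  have hfin : P.real Ev ≤ Real.exp E0 * (Real.exp (-x * h) * (Real.exp (x ^ 2 / 2) *
      ((1 - stdNormalCDF x) * Real.exp (15 * (1 + x) * h))) + Dd) := by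
    refine hInt.trans (mul_le_mul_of_nonneg_left (htail.trans ?_) (Real.exp_pos _).le)
    gcongr
    exact tail_shift hx0 hh0
  refine hfin.trans ?_
  have hpos := one_sub_cdf_pos x
  have hml := mills_lower hx0
  set p := 1 - stdNormalCDF x with hp
  set A := x ^ 2 * δ ^ 2 / 2 + 10 * K * Λ with hA
  have t1 : Real.exp E0 * (Real.exp (-x * h) * (Real.exp (x ^ 2 / 2) * (p * Real.exp (15 * (1 + x) * h))))
      = p * Real.exp (A + 15 * (1 + x) * h) := by
    have : Real.exp E0 * Real.exp (-x * h) * Real.exp (x ^ 2 / 2) * Real.exp (15 * (1 + x) * h)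
        = Real.exp (A + 15 * (1 + x) * h) := by
      rw [← Real.exp_add, ← Real.exp_add, ← Real.exp_add]; congr 1; rw [hE0, hA]; ring
    rw [← this]; ring
  have t2 : Real.exp E0 * Dd ≤ p * (Real.exp (A + 15 * (1 + x) * h) * (15 * (1 + x) * Dd)) := by
    have e : Real.exp E0 = Real.exp (-(x ^ 2) / 2) * Real.exp (A + x * h) := by
      rw [← Real.exp_add]; congr 1; rw [hE0, hA]; ring
    rw [e]
    have h5 : Real.exp (A + x * h) ≤ Real.exp (A + 15 * (1 + x) * h) := by
      apply Real.exp_le_exp.2; nlinarith [mul_nonneg hx0 hh0]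
    calc Real.exp (-(x ^ 2) / 2) * Real.exp (A + x * h) * Dd
        ≤ (15 * (1 + x) * p) * Real.exp (A + 15 * (1 + x) * h) * Dd := by gcongr
      _ = _ := by ring
  rw [mul_add, t1]
  have t3 : 1 + 15 * (1 + x) * Dd ≤ Real.exp (15 * (1 + x) * Dd) := by
    have := Real.add_one_le_exp (15 * (1 + x) * Dd); linarith
  calc p * Real.exp (A + 15 * (1 + x) * h) + Real.exp E0 * Dd
      ≤ p * Real.exp (A + 15 * (1 + x) * h) +
        p * (Real.exp (A + 15 * (1 + x) * h) * (15 * (1 + x) * Dd)) := by gcongr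
    _ = p * Real.exp (A + 15 * (1 + x) * h) * (1 + 15 * (1 + x) * Dd) := by ring
    _ ≤ p * Real.exp (A + 15 * (1 + x) * h) * Real.exp (15 * (1 + x) * Dd) := by gcongr
    _ = p * Real.exp (A + 15 * (1 + x) * h + 15 * (1 + x) * Dd) := by
        rw [Real.exp_add (A + 15 * (1 + x) * h)]; ring
    _ ≤ _ := by
        gcongr
        have u1 : (1 + x) * h ≤ s ^ 2 * (η ^ 2 + δ ^ 2) + 18 * K * Λ := by
          have e : s * h = a / 2 * s ^ 2 * (η ^ 2 + δ ^ 2) + 9 * K * Λ := by rw [hh]; field_simp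
          have e2 : (1 + x) * h ≤ 2 * (s * h) := by nlinarith
          have e3 : a * (s ^ 2 * (η ^ 2 + δ ^ 2)) ≤ s ^ 2 * (η ^ 2 + δ ^ 2) :=
            mul_le_of_le_one_left (by positivity) ha'
          linarith
        have u2 : (1 + x) * Dd ≤ 2 * (CB0 * T * (s * (g ^ ρ + δ))) := by
          have v1 : Dd ≤ CB0 * T * (g ^ ρ + δ) := by
            rw [hDd]
            have : CB0 * δ ≤ CB0 * T * δ := by
              rw [mul_assoc]; gcongr; exact le_mul_of_one_le_left hδ hT1
            nlinarith
          calc (1 + x) * Dd ≤ (2 * s) * (CB0 * T * (g ^ ρ + δ)) := by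
                gcongr; linarith
            _ = _ := by ring
        have u3 : x ^ 2 * δ ^ 2 ≤ s ^ 2 * δ ^ 2 := by gcongr
        have w1 : 0 ≤ K * Λ := by positivity
        have w2 : 0 ≤ s ^ 2 * δ ^ 2 := by positivity
        have w3 : 0 ≤ s ^ 2 * η ^ 2 := by positivity
        have w4 : 0 ≤ s * (g ^ ρ + δ) := by positivity
        have w5 : 0 ≤ K * (s ^ 2 * δ ^ 2) := by positivity
        have w6 : 0 ≤ K * (s ^ 2 * η ^ 2) := by positivity
        have w7 : 0 ≤ K * (s * (g ^ ρ + δ)) := by positivity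
        have w8 : 0 ≤ CB0 * T * Λ := by positivity
        have w9 : 0 ≤ CB0 * T * (s ^ 2 * δ ^ 2) := by positivity
        have w10 : 0 ≤ CB0 * T * (s ^ 2 * η ^ 2) := by positivity
        have e : (1 + 280 * K + 15 + 30 * CB0 * T) *
          (Λ + s ^ 2 * δ ^ 2 + s ^ 2 * η ^ 2 + s * (g ^ ρ + δ)) =
          16 * Λ + 16 * (s ^ 2 * δ ^ 2) + 16 * (s ^ 2 * η ^ 2) + 16 * (s * (g ^ ρ + δ)) +
          280 * (K * Λ) + 280 * (K * (s ^ 2 * δ ^ 2)) + 280 * (K * (s ^ 2 * η ^ 2)) +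
          280 * (K * (s * (g ^ ρ + δ))) + 30 * (CB0 * T * Λ) + 30 * (CB0 * T * (s ^ 2 * δ ^ 2))
          + 30 * (CB0 * T * (s ^ 2 * η ^ 2)) + 30 * (CB0 * T * (s * (g ^ ρ + δ))) := by ring
        rw [e, hA]
        linarith
end SNC


set_option linter.unusedSectionVars false
set_option linter.unusedVariables false
namespace SNC
open MeasureTheory Filter ProbabilityTheory
open scoped Topology ENNReal NNReal

/-- tilted conditional second moment -/
noncomputable def nu {Ω : Type} [mΩ : MeasurableSpace Ω] (P : Measure Ω) (F : ℕ → MeasurableSpace Ω)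
    (U : ℕ → Ω → ℝ) (w : ℝ → ℝ) (k : ℕ) (ω : Ω) : ℝ :=
  cw P F U (fun u => w u * u ^ 2) k ω / Dn P F U w k ω

/-- centred quadratic variation under the tilted measure -/
noncomputable def MM {Ω : Type} [mΩ : MeasurableSpace Ω] (P : Measure Ω) (F : ℕ → MeasurableSpace Ω)
    (U : ℕ → Ω → ℝ) (w : ℝ → ℝ) (k : ℕ) (ω : Ω) : ℝ :=
  ∑ j ∈ Finset.range k, (U j ω ^ 2 - nu P F U w j ω)

/-- density process -/
noncomputable def ZZ {Ω : Type} [mΩ : MeasurableSpace Ω] (P : Measure Ω) (F : ℕ → MeasurableSpace Ω)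
    (U : ℕ → Ω → ℝ) (w : ℝ → ℝ) (k : ℕ) (ω : Ω) : ℝ :=
  ∏ j ∈ Finset.range k, rr P F U w j ω

namespace TD
variable {Ω : Type} [mΩ : MeasurableSpace Ω] {P : Measure Ω} [IsProbabilityMeasure P] {n : ℕ}
    {F : ℕ → MeasurableSpace Ω} {U : ℕ → Ω → ℝ} {ρ g Λ N δ : ℝ} {w : ℝ → ℝ} {a q K : ℝ}

lemma nu_meas (k : ℕ) : Measurable[F k] (nu P F U w k) :=
  (cw_meas P F U _ k).div (Dn_meas k)

lemma wm_le (W : GoodW w ρ a q K) {m : ℕ} (hm : m ≤ 6) (u : ℝ) : |w u * u ^ m| ≤ K := by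
  rw [abs_mul, abs_pow, abs_of_nonneg (W.nonneg u)]; exact W.le_pow u hm

lemma nu_aeb (W : GoodW w ρ a q K) (k : ℕ) : AEB P (nu P F U w k) :=
  cwd_aeb (wm_le W (by norm_num)) k

lemma ZZ_meas (D : TD P n F U ρ g Λ N δ) (W : GoodW w ρ a q K) {k : ℕ} (hk : k ≤ n) :
    Measurable[F k] (ZZ P F U w k) := by
  have h := D.prod_meas W 0 hk
  rw [← Finset.range_eq_Ico] at h
  exact h

lemma ZZ_aeb (W : GoodW w ρ a q K) (k : ℕ) : AEB P (ZZ P F U w k) := prod_aeb W _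
lemma ZZ_nonneg (W : GoodW w ρ a q K) (k : ℕ) (ω : Ω) : 0 ≤ ZZ P F U w k ω := prod_nonneg' W _ ω

lemma MM_meas (D : TD P n F U ρ g Λ N δ) {k : ℕ} (hk : k ≤ n) :
    Measurable[F k] (MM P F U w k) := by
  refine Finset.measurable_fun_sum _ fun j hj => ?_
  have hj' := Finset.mem_range.1 hj
  exact (((D.meas j (by omega)).mono (D.F_mono (by omega)) le_rfl).pow_const 2).sub
    ((nu_meas j).mono (D.F_mono (by omega)) le_rfl)

lemma ZM_succ (k : ℕ) (ω : Ω) : ZZ P F U w (k + 1) ω = ZZ P F U w k ω * rr P F U w k ω ∧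
    MM P F U w (k + 1) ω = MM P F U w k ω + (U k ω ^ 2 - nu P F U w k ω) :=
  ⟨Finset.prod_range_succ _ _, Finset.sum_range_succ _ _⟩

lemma rrm_aeb (W : GoodW w ρ a q K) {m : ℕ} (hm : m ≤ 6) (k : ℕ) :
    AEB P (fun ω => rr P F U w k ω * U k ω ^ m) := by
  refine ⟨2 * K, ae_of_all _ fun ω => ?_⟩
  have := div_Dn_le (P := P) (F := F) (U := U) (w := w) k ω (wm_le W hm (U k ω))
  simp only [rr, div_mul_eq_mul_div]; exact this

lemma ZM_aeb (W : GoodW w ρ a q K) (k : ℕ) :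
    AEB P (fun ω => ZZ P F U w k ω * MM P F U w k ω) ∧
    AEB P (fun ω => ZZ P F U w k ω * MM P F U w k ω ^ 2) := by
  induction k with
  | zero => constructor <;> exact ⟨0, ae_of_all _ fun ω => by simp [MM]⟩
  | succ k ih =>
    obtain ⟨h1, h2⟩ := ih
    have z := ZZ_aeb (P := P) (F := F) (U := U) W k
    have r0 : AEB P (fun ω => rr P F U w k ω) := ⟨2 * K, ae_of_all _ fun ω => rr_le W k ω⟩
    have r2 := rrm_aeb (P := P) (F := F) (U := U) W (m := 2) (by norm_num) k
    have r4 := rrm_aeb (P := P) (F := F) (U := U) W (m := 4) (by norm_num) k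
    have v := nu_aeb (P := P) (F := F) (U := U) W k
    have cm : AEB P (fun _ : Ω => (-1:ℝ)) := ⟨1, ae_of_all _ fun _ => by simp⟩
    have c2 : AEB P (fun _ : Ω => (2:ℝ)) := ⟨2, ae_of_all _ fun _ => by simp⟩
    have x1 := r2.add ((r0.mul v).mul cm)
    have x2 := (r4.add ((((r2.mul v).mul cm)).mul c2)).add ((r0.mul v).mul v)
    constructor
    · have := (h1.mul r0).add (z.mul x1)
      refine (congrArg (AEB P) (funext fun ω => ?_)).mp this
      rw [(ZM_succ k ω).1, (ZM_succ k ω).2]; ring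
    · have := ((h2.mul r0).add ((h1.mul x1).mul c2)).add (z.mul x2)
      refine (congrArg (AEB P) (funext fun ω => ?_)).mp this
      rw [(ZM_succ k ω).1, (ZM_succ k ω).2]; ring

lemma bb_meas (k : ℕ) : Measurable[F k] (bb P F U ρ k) := stronglyMeasurable_condExp.measurable

lemma bb_aeb (D : TD P n F U ρ g Λ N δ) {k : ℕ} (hk : k < n) : AEB P (bb P F U ρ k) := by
  refine ⟨g ^ 2, ?_⟩
  filter_upwards [D.basic hk] with ω h
  rw [abs_of_nonneg h.2.1]; exact h.2.2.2.2.2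

lemma nu_close (D : TD P n F U ρ g Λ N δ) (W : GoodW w ρ a q K) (hg : (6 + K) * g ^ 2 ≤ 1 / 2)
    {k : ℕ} (hk : k < n) :
    ∀ᵐ ω ∂P, |nu P F U w k ω - vv P F U k ω| ≤ 34 * K * bb P F U ρ k ω := by
  have hK := W.K_ge
  filter_upwards [D.key hk (ψ := fun u => w u * u ^ 2) (W.meas.mul (measurable_id.pow_const 2))
    (W.wu2 D.rho_pos D.rho_lt), D.Dn_key W hg hk, D.basic hk] with ω h1 h2 h3
  obtain ⟨hv, hb, hv2, _, hvb, _⟩ := h3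
  have hD := Dn_pos (P := P) (F := F) (U := U) (w := w) k ω
  have hD2 := Dn_ge (P := P) (F := F) (U := U) (w := w) k ω
  set dn := Dn P F U w k ω
  set v := vv P F U k ω
  set b := bb P F U ρ k ω
  set c := cw P F U (fun u => w u * u ^ 2) k ω
  have hv1 : v ≤ 1 := hv2.trans (by have := D.g_le; have := D.g_pos; nlinarith)
  have e : nu P F U w k ω - v = (c - v * dn) / dn := by
    rw [nu, sub_div, mul_div_cancel_right₀ _ hD.ne']
  rw [e]
  have h5 : |c - v * dn| ≤ 17 * K * b := by
    have e2 : c - v * dn = (c - 0 - 1 * v) - v * (dn - 1 - q * v) - q * v ^ 2 := by ring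
    rw [e2]
    have t1 : |v * (dn - 1 - q * v)| ≤ K * b := by
      rw [abs_mul, abs_of_nonneg hv]
      calc v * |dn - 1 - q * v| ≤ 1 * (K * b) := by gcongr; exact h2.2
        _ = _ := one_mul _
    have t2 : |q * v ^ 2| ≤ 6 * b := by
      rw [abs_mul, abs_of_nonneg (sq_nonneg v)]
      gcongr; exact W.q_le
    have := abs_sub (c - 0 - 1 * v - v * (dn - 1 - q * v)) (q * v ^ 2)
    have := abs_sub (c - 0 - 1 * v) (v * (dn - 1 - q * v))
    have : b ≤ K * b := le_mul_of_one_le_left hb hK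
    nlinarith
  have := div_Dn_le (P := P) (F := F) (U := U) (w := w) k ω h5
  linarith

lemma A_step (D : TD P n F U ρ g Λ N δ) (W : GoodW w ρ a q K) (hg : (6 + K) * g ^ 2 ≤ 1 / 2)
    {k : ℕ} (hk : k < n) :
    ∫ ω, ZZ P F U w (k + 1) ω * MM P F U w (k + 1) ω ^ 2 ∂P ≤
      (∫ ω, ZZ P F U w k ω * MM P F U w k ω ^ 2 ∂P) + 2 * K * ∫ ω, ZZ P F U w k ω * bb P F U ρ k ω ∂P := by
  have hK := W.K_ge
  set Z := ZZ P F U w k with hZ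
  set M := MM P F U w k with hM
  set v := nu P F U w k with hv
  set dn := Dn P F U w k with hdn
  have mZ : Measurable[F k] Z := D.ZZ_meas W hk.le
  have mM : Measurable[F k] M := D.MM_meas hk.le
  have mv : Measurable[F k] v := nu_meas k
  have md : Measurable[F k] dn := Dn_meas k
  have aZ : AEB P Z := ZZ_aeb W k
  obtain ⟨aM, aM2⟩ := ZM_aeb (P := P) (F := F) (U := U) W k
  have av : AEB P v := nu_aeb W k
  have ad : AEB P (fun ω => (dn ω)⁻¹) := inv_aeb k
  have cm : AEB P (fun _ : Ω => (-1:ℝ)) := ⟨1, ae_of_all _ fun _ => by simp⟩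
  have c2 : AEB P (fun _ : Ω => (2:ℝ)) := ⟨2, ae_of_all _ fun _ => by simp⟩
  set G1 : Ω → ℝ := fun ω => Z ω * (M ω - v ω) ^ 2 * (dn ω)⁻¹ with hG1
  set G2 : Ω → ℝ := fun ω => 2 * Z ω * (M ω - v ω) * (dn ω)⁻¹ with hG2
  set G3 : Ω → ℝ := fun ω => Z ω * (dn ω)⁻¹ with hG3
  have m1 : Measurable[F k] G1 := (mZ.mul ((mM.sub mv).pow_const 2)).mul md.inv
  have m2 : Measurable[F k] G2 := ((mZ.const_mul 2).mul (mM.sub mv)).mul md.inv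
  have m3 : Measurable[F k] G3 := mZ.mul md.inv
  have a1 : AEB P G1 := by
    have := ((aM2.add (((aM.mul av).mul cm).mul c2)).add ((aZ.mul av).mul av)).mul ad
    refine (congrArg (AEB P) (funext fun ω => ?_)).mp this
    simp only [hG1]; ring
  have a2 : AEB P G2 := by
    have := ((aM.add ((aZ.mul av).mul cm)).mul c2).mul ad
    refine (congrArg (AEB P) (funext fun ω => ?_)).mp this
    simp only [hG2]; ring
  have a3 : AEB P G3 := aZ.mul ad
  have mp : ∀ m : ℕ, Measurable (fun u => w u * u ^ m) := fun m => W.meas.mul (measurable_id.pow_const m)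
  have i1 : Integrable (fun ω => w (U k ω)) P := D.w_int W hk
  have i2 : Integrable (fun ω => w (U k ω) * U k ω ^ 2) P :=
    D.psi_int hk (mp 2) (W.wu2 D.rho_pos D.rho_lt)
  have i4 : Integrable (fun ω => w (U k ω) * U k ω ^ 4) P :=
    D.psi_int hk (mp 4) (W.wu4 D.rho_pos D.rho_lt)
  have s1 := D.step_int i1 m1 a1
  have s2 := D.step_int (ψ := fun u => w u * u ^ 2) i2 m2 a2
  have s3 := D.step_int (ψ := fun u => w u * u ^ 4) i4 m3 a3
  have lm : ∀ {G : Ω → ℝ}, Measurable[F k] G → Measurable G := fun h => h.mono (D.F_le k) le_rfl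
  have j1 : Integrable (fun ω => G1 ω * w (U k ω)) P := a1.integrable_mul (lm m1) i1
  have j2 : Integrable (fun ω => G2 ω * (w (U k ω) * U k ω ^ 2)) P := a2.integrable_mul (lm m2) i2
  have j3 : Integrable (fun ω => G3 ω * (w (U k ω) * U k ω ^ 4)) P := a3.integrable_mul (lm m3) i4
  have c1 : Integrable (cw P F U w k) P := integrable_condExp
  have cc2 : Integrable (cw P F U (fun u => w u * u ^ 2) k) P := integrable_condExp
  have cc4 : Integrable (cw P F U (fun u => w u * u ^ 4) k) P := integrable_condExp
  have l1 : Integrable (fun ω => G1 ω * cw P F U w k ω) P := a1.integrable_mul (lm m1) c1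
  have l2 : Integrable (fun ω => G2 ω * cw P F U (fun u => w u * u ^ 2) k ω) P :=
    a2.integrable_mul (lm m2) cc2
  have l3 : Integrable (fun ω => G3 ω * cw P F U (fun u => w u * u ^ 4) k ω) P :=
    a3.integrable_mul (lm m3) cc4
  have ab := D.bb_aeb hk
  have mb : Measurable[F k] (bb P F U ρ k) := bb_meas k
  have e1 : ∫ ω, ZZ P F U w (k + 1) ω * MM P F U w (k + 1) ω ^ 2 ∂P =
      (∫ ω, G1 ω * w (U k ω) ∂P) + (∫ ω, G2 ω * (w (U k ω) * U k ω ^ 2) ∂P) +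
        ∫ ω, G3 ω * (w (U k ω) * U k ω ^ 4) ∂P := by
    have j12 : Integrable (fun ω => G1 ω * w (U k ω) + G2 ω * (w (U k ω) * U k ω ^ 2)) P := j1.add j2
    rw [← integral_add j1 j2, ← integral_add j12 j3]
    refine integral_congr_ae (ae_of_all _ fun ω => ?_)
    simp only [(ZM_succ (P := P) (F := F) (U := U) (w := w) k ω).1, (ZM_succ (P := P) (F := F) (U := U) (w := w) k ω).2, rr, hG1, hG2, hG3, div_eq_mul_inv]
    ring
  have l12 : Integrable (fun ω => G1 ω * cw P F U w k ω + G2 ω * cw P F U (fun u => w u * u ^ 2) k ω) P :=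
    l1.add l2
  rw [e1, s1, s2, s3, ← integral_add l1 l2, ← integral_add l12 l3, ← integral_const_mul]
  have k1 : Integrable (fun ω => Z ω * M ω ^ 2) P :=
    aM2.integrable ((lm mZ).mul ((lm mM).pow_const 2))
  have k2 : Integrable (fun ω => 2 * K * (Z ω * bb P F U ρ k ω)) P :=
    ((aZ.mul ab).integrable ((lm mZ).mul (lm mb))).const_mul _
  rw [← integral_add k1 k2]
  refine integral_mono_ae (l12.add l3) (k1.add k2) ?_
  filter_upwards [D.Dn_key W hg hk, D.key hk (mp 4) (W.wu4 D.rho_pos D.rho_lt), D.basic hk] with ω h1 h2 h3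
  obtain ⟨_, hb, _⟩ := h3
  have hZ0 : 0 ≤ Z ω := ZZ_nonneg W k ω
  have hD : 0 < dn ω := Dn_pos k ω
  have e2 : cw P F U (fun u => w u * u ^ 2) k ω = v ω * dn ω := by
    simp only [hv, nu]; rw [div_mul_cancel₀ _ hD.ne']
  have e4 : cw P F U (fun u => w u * u ^ 4) k ω * (dn ω)⁻¹ ≤ 2 * K * bb P F U ρ k ω := by
    have h5 : |cw P F U (fun u => w u * u ^ 4) k ω| ≤ K * bb P F U ρ k ω := by simpa using h2
    have := div_Dn_le (P := P) (F := F) (U := U) (w := w) k ω h5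
    rw [← div_eq_mul_inv]
    refine (le_abs_self _).trans ?_
    linarith
  change G1 ω * cw P F U w k ω + G2 ω * cw P F U (fun u => w u * u ^ 2) k ω +
    G3 ω * cw P F U (fun u => w u * u ^ 4) k ω ≤ Z ω * M ω ^ 2 + 2 * K * (Z ω * bb P F U ρ k ω)
  rw [e2, ← h1.1]
  have e5 : G1 ω * dn ω + G2 ω * (v ω * dn ω) = Z ω * M ω ^ 2 - Z ω * v ω ^ 2 := by
    simp only [hG1, hG2]; field_simp; ring
  have e6 : G3 ω * cw P F U (fun u => w u * u ^ 4) k ω =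
      Z ω * (cw P F U (fun u => w u * u ^ 4) k ω * (dn ω)⁻¹) := by simp only [hG3]; ring
  have e7 := mul_le_mul_of_nonneg_left e4 hZ0
  have e8 : 0 ≤ Z ω * v ω ^ 2 := by positivity
  change G1 ω * dn ω + G2 ω * (v ω * dn ω) + _ ≤ _
  rw [e5, e6]
  linarith

lemma A_bound (D : TD P n F U ρ g Λ N δ) (W : GoodW w ρ a q K) (hg : (6 + K) * g ^ 2 ≤ 1 / 2) :
    ∫ ω, ZZ P F U w n ω * MM P F U w n ω ^ 2 ∂P ≤ 2 * K * Λ := by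
  have hK := W.K_ge
  have h1 : ∀ k, k ≤ n → ∫ ω, ZZ P F U w k ω * MM P F U w k ω ^ 2 ∂P ≤
      ∑ j ∈ Finset.range k, 2 * K * ∫ ω, ZZ P F U w j ω * bb P F U ρ j ω ∂P := by
    intro k
    induction k with
    | zero => intro _; simp [MM]
    | succ k ih =>
      intro hk
      rw [Finset.sum_range_succ]
      have := D.A_step W hg hk
      have := ih (by omega)
      linarith
  refine (h1 n le_rfl).trans ?_
  rw [← Finset.mul_sum]
  refine mul_le_mul_of_nonneg_left ?_ (by positivity)
  have h2 : ∀ j ∈ Finset.range n, ∫ ω, ZZ P F U w j ω * bb P F U ρ j ω ∂P =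
      ∫ ω, bb P F U ρ j ω * ZZ P F U w n ω ∂P := by
    intro j hj
    have hj' := Finset.mem_range.1 hj
    rw [← D.tail_int W hg hj'.le le_rfl (M := fun ω => ZZ P F U w j ω * bb P F U ρ j ω) ((D.ZZ_meas W hj'.le).mul (bb_meas j))
      ((ZZ_aeb W j).mul (D.bb_aeb hj'))]
    refine integral_congr_ae (ae_of_all _ fun ω => ?_)
    simp only [ZZ]
    rw [Finset.range_eq_Ico, Finset.range_eq_Ico, ← Finset.prod_Ico_consecutive _ (Nat.zero_le j) hj'.le]
    ring
  rw [Finset.sum_congr rfl h2]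
  have mZ : Measurable (ZZ P F U w n) := (D.ZZ_meas W le_rfl).mono (D.F_le n) le_rfl
  have hi : ∀ j ∈ Finset.range n, Integrable (fun ω => bb P F U ρ j ω * ZZ P F U w n ω) P := by
    intro j hj
    exact ((D.bb_aeb (Finset.mem_range.1 hj)).mul (ZZ_aeb W n)).integrable
      (((bb_meas j).mono (D.F_le j) le_rfl).mul mZ)
  rw [← integral_finsetSum _ hi]
  have h3 : ∫ ω, ZZ P F U w n ω ∂P = 1 := by
    have h := D.tail_int W hg (Nat.zero_le n) le_rfl (M := fun _ => 1) measurable_const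
      ⟨1, ae_of_all _ fun _ => by simp⟩
    rw [← Finset.range_eq_Ico] at h
    simp only [one_mul, integral_const, probReal_univ, smul_eq_mul, mul_one] at h
    exact h
  calc ∫ ω, ∑ j ∈ Finset.range n, bb P F U ρ j ω * ZZ P F U w n ω ∂P
      ≤ ∫ ω, Λ * ZZ P F U w n ω ∂P := by
        refine integral_mono_ae (integrable_finsetSum _ hi)
          (((ZZ_aeb W n).integrable mZ).const_mul _) ?_
        filter_upwards [D.lam] with ω h
        rw [← Finset.sum_mul]
        exact mul_le_mul_of_nonneg_right h (ZZ_nonneg W n ω)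
    _ = Λ := by rw [integral_const_mul, h3, mul_one]

theorem dev (D : TD P n F U ρ g Λ N δ) (W : GoodW w ρ a q K) (hg : (6 + K) * g ^ 2 ≤ 1 / 2)
    (hN : 0 < N) {η L : ℝ} (hη : 0 < η) (hηb : 2 * (34 * K * Λ + N * δ ^ 2) ≤ N * η)
    {Ev : Set Ω} (mEv : MeasurableSet Ev)
    (h1 : ∀ ω ∈ Ev, N * η ≤ |∑ k ∈ Finset.range n, U k ω ^ 2 - N|)
    (h2 : ∀ ω ∈ Ev, Real.exp L ≤ ∏ k ∈ Finset.range n, w (U k ω)) :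
    P.real Ev ≤ Real.exp (q * N + |q| * (N * δ ^ 2) + K * Λ - L) * (8 * K * Λ / (N * η) ^ 2) := by
  have hK := W.K_ge
  set E0 := q * N + |q| * (N * δ ^ 2) + K * Λ with hE0
  have hnu : ∀ᵐ ω ∂P, ∀ k ∈ Finset.range n,
      |nu P F U w k ω - vv P F U k ω| ≤ 34 * K * bb P F U ρ k ω := by
    rw [Filter.eventually_all_finset]
    intro k hk
    exact D.nu_close W hg (Finset.mem_range.1 hk)
  have mZ : Measurable (ZZ P F U w n) := (D.ZZ_meas W le_rfl).mono (D.F_le n) le_rfl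
  have mM : Measurable (MM P F U w n) := (D.MM_meas le_rfl).mono (D.F_le n) le_rfl
  have hpt : ∀ᵐ ω ∂P, Ev.indicator (fun _ => (1:ℝ)) ω ≤
      (Real.exp (E0 - L) * (4 / (N * η) ^ 2)) * (ZZ P F U w n ω * MM P F U w n ω ^ 2) := by
    filter_upwards [hnu, D.lam, D.var, D.prodDn W hg] with ω q1 q2 q3 q4
    have hz := ZZ_nonneg (P := P) (F := F) (U := U) W n ω
    by_cases hω : ω ∈ Ev
    swap
    · rw [Set.indicator_of_notMem hω]; positivity
    rw [Set.indicator_of_mem hω]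
    have r1 := h1 ω hω
    have r2 := h2 ω hω
    rw [TD.prodw (P := P) (F := F)] at r2
    change _ ≤ ZZ P F U w n ω * _ at r2
    have r3 : Real.exp L ≤ ZZ P F U w n ω * Real.exp E0 := r2.trans (by gcongr)
    have r4 : 1 ≤ Real.exp (E0 - L) * ZZ P F U w n ω := by
      rw [Real.exp_sub, div_mul_eq_mul_div, le_div_iff₀ (Real.exp_pos _)]; linarith
    have r5 : |∑ k ∈ Finset.range n, (nu P F U w k ω - vv P F U k ω)| ≤ 34 * K * Λ := by
      refine (Finset.abs_sum_le_sum_abs _ _).trans ((Finset.sum_le_sum q1).trans ?_)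
      rw [← Finset.mul_sum]; gcongr
    have r6 : N * η / 2 ≤ |MM P F U w n ω| := by
      have e : ∑ k ∈ Finset.range n, U k ω ^ 2 - N = MM P F U w n ω +
          ∑ k ∈ Finset.range n, (nu P F U w k ω - vv P F U k ω) +
          (∑ k ∈ Finset.range n, vv P F U k ω - N) := by
        simp only [MM, Finset.sum_sub_distrib]; ring
      rw [e] at r1
      have := abs_add_three (MM P F U w n ω) (∑ k ∈ Finset.range n, (nu P F U w k ω - vv P F U k ω))
        (∑ k ∈ Finset.range n, vv P F U k ω - N)
      linarith
    have r7 : (N * η / 2) ^ 2 ≤ MM P F U w n ω ^ 2 := by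
      rw [← sq_abs (MM P F U w n ω)]; gcongr
    have hp : 0 < (N * η) ^ 2 := by positivity
    have r8 : 1 ≤ 4 / (N * η) ^ 2 * MM P F U w n ω ^ 2 := by
      rw [div_mul_eq_mul_div, le_div_iff₀ hp]; nlinarith
    calc (1:ℝ) = 1 * 1 := by ring
      _ ≤ (Real.exp (E0 - L) * ZZ P F U w n ω) * (4 / (N * η) ^ 2 * MM P F U w n ω ^ 2) := by gcongr
      _ = _ := by ring
  have e : P.real Ev = ∫ ω, Ev.indicator (fun _ => (1:ℝ)) ω ∂P := by
    rw [integral_indicator mEv]; simp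
  rw [e]
  have hInt : Integrable (fun ω => ZZ P F U w n ω * MM P F U w n ω ^ 2) P :=
    (ZM_aeb W n).2.integrable (mZ.mul (mM.pow_const 2))
  refine (integral_mono_ae ((integrable_const _).indicator mEv) (hInt.const_mul _) hpt).trans ?_
  rw [integral_const_mul]
  calc Real.exp (E0 - L) * (4 / (N * η) ^ 2) * ∫ ω, ZZ P F U w n ω * MM P F U w n ω ^ 2 ∂P
      ≤ Real.exp (E0 - L) * (4 / (N * η) ^ 2) * (2 * K * Λ) := by
        gcongr; exact D.A_bound W hg
    _ = _ := by ring
end TD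
end SNC


set_option linter.unusedSectionVars false
set_option linter.unusedVariables false
namespace SNC
open MeasureTheory Filter ProbabilityTheory
open scoped Topology ENNReal NNReal

lemma exp_tay2 (t : ℝ) : |Real.exp t - 1 - t - t ^ 2 / 2| ≤ |t| ^ 3 * Real.exp |t| := by
  have h := Complex.norm_exp_sub_sum_le_norm_mul_exp (t : ℂ) 3
  have e : Complex.exp t - ∑ m ∈ Finset.range 3, (t:ℂ) ^ m / (m.factorial : ℂ) =
      ((Real.exp t - 1 - t - t ^ 2 / 2 : ℝ) : ℂ) := by
    simp [Finset.sum_range_succ, Nat.factorial]; ring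
  rw [e, Complex.norm_real, Complex.norm_real] at h
  exact h

lemma exp_one_ge : (2:ℝ) ≤ Real.exp 1 := by
  have := Real.add_one_le_exp (1:ℝ); linarith

lemma exp_nat_ge (m : ℕ) : (2:ℝ) ^ m ≤ Real.exp m := by
  rw [← Real.exp_one_pow]; exact pow_le_pow_left₀ (by norm_num) exp_one_ge m

lemma fam_tay {a b u : ℝ} (ha : 0 ≤ a) (ha' : a ≤ 3) (hb : 0 ≤ b) (hb' : b ≤ 1) (hu : |u| ≤ 1) :
    |Real.exp (a * u - b * u ^ 2) - 1 - a * u - (a ^ 2 / 2 - b) * u ^ 2| ≤ Real.exp 12 * |u| ^ 3 := by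
  set t := a * u - b * u ^ 2 with ht
  have h0 := abs_nonneg u
  have ht4 : |t| ≤ 4 * |u| := by
    have h1 : |t| ≤ |a * u| + |b * u ^ 2| := abs_sub _ _
    rw [abs_mul, abs_mul, abs_pow, abs_of_nonneg ha, abs_of_nonneg hb] at h1
    have h2 : a * |u| ≤ 3 * |u| := by gcongr
    have h3 : b * |u| ^ 2 ≤ 1 * |u| ^ 2 := by gcongr
    nlinarith
  have h1 := exp_tay2 t
  have h2 : |t| ^ 3 * Real.exp |t| ≤ 64 * |u| ^ 3 * Real.exp 4 := by
    have h3 : |t| ^ 3 ≤ (4 * |u|) ^ 3 := by gcongr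
    have h4 : Real.exp |t| ≤ Real.exp 4 := Real.exp_le_exp.2 (by linarith)
    calc |t| ^ 3 * Real.exp |t| ≤ (4 * |u|) ^ 3 * Real.exp 4 := by gcongr
      _ = _ := by ring
  have e : Real.exp t - 1 - a * u - (a ^ 2 / 2 - b) * u ^ 2 =
      (Real.exp t - 1 - t - t ^ 2 / 2) + (-(a * b) * u ^ 3 + b ^ 2 / 2 * u ^ 4) := by rw [ht]; ring
  rw [e]
  have h5 : |-(a * b) * u ^ 3 + b ^ 2 / 2 * u ^ 4| ≤ 4 * |u| ^ 3 := by
    refine (abs_add_le _ _).trans ?_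
    rw [abs_mul, abs_mul, abs_pow, abs_pow, abs_neg, abs_of_nonneg (mul_nonneg ha hb),
      abs_of_nonneg (by positivity : 0 ≤ b ^ 2 / 2)]
    have h6 : a * b ≤ 3 := by nlinarith
    have h7 : b ^ 2 / 2 ≤ 1 := by nlinarith
    have h8 : |u| ^ 4 ≤ |u| ^ 3 := pow_le_pow_of_le_one h0 hu (by norm_num)
    have h9 : a * b * |u| ^ 3 ≤ 3 * |u| ^ 3 := by gcongr
    have h10 : b ^ 2 / 2 * |u| ^ 4 ≤ 1 * |u| ^ 3 := by gcongr
    linarith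
  have h6 : 64 * Real.exp 4 + 4 ≤ Real.exp 12 := by
    have e1 : Real.exp 12 = Real.exp 8 * Real.exp 4 := by rw [← Real.exp_add]; norm_num
    have e2 := exp_nat_ge 8
    have e3 := exp_nat_ge 4
    push_cast at e2 e3
    rw [e1]; nlinarith
  have h11 : 0 ≤ |u| ^ 3 := by positivity
  calc _ ≤ |Real.exp t - 1 - t - t ^ 2 / 2| + |-(a * b) * u ^ 3 + b ^ 2 / 2 * u ^ 4| := abs_add_le _ _
    _ ≤ 64 * |u| ^ 3 * Real.exp 4 + 4 * |u| ^ 3 := by linarith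
    _ = (64 * Real.exp 4 + 4) * |u| ^ 3 := by ring
    _ ≤ _ := by gcongr

/-- the universal constant for the weights -/
noncomputable def KK : ℝ := Real.exp 70

lemma KK_ge : 1 ≤ KK := Real.one_le_exp (by norm_num)

lemma exp12_le : Real.exp 12 ≤ KK := Real.exp_le_exp.2 (by norm_num)

lemma one_add_pow6 {t : ℝ} (ht : 0 ≤ t) : (1 + t) ^ 6 ≤ Real.exp (6 * t) := by
  have h : 1 + t ≤ Real.exp t := by have := Real.add_one_le_exp t; linarith
  calc (1 + t) ^ 6 ≤ (Real.exp t) ^ 6 := by gcongr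
    _ = Real.exp (6 * t) := by rw [← Real.exp_nat_mul]; norm_num

lemma fam1 {ρ a b : ℝ} (hρ : 0 < ρ) (hρ' : ρ < 1) (ha : 0 ≤ a) (ha' : a ≤ 3) (hb : 1 / 3 ≤ b) (hb' : b ≤ 1) :
    GoodW (fun u => Real.exp (a * u - b * u ^ 2)) ρ a (a ^ 2 / 2 - b) KK where
  meas := by fun_prop
  nonneg u := (Real.exp_pos _).le
  dec u := by
    refine (mul_le_mul_of_nonneg_left (one_add_pow6 (abs_nonneg u)) (Real.exp_pos _).le).trans ?_
    rw [← Real.exp_add]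
    refine Real.exp_le_exp.2 ?_
    have h1 : a * u ≤ 3 * |u| := by
      have := le_abs_self u; have := abs_nonneg u; nlinarith
    have h2 : b * u ^ 2 ≥ 1 / 3 * |u| ^ 2 := by rw [sq_abs]; gcongr
    nlinarith [sq_nonneg (|u| - 27 / 2)]
  tay u := by
    rcases le_total |u| 1 with hu | hu
    · refine (fam_tay ha ha' (by linarith) hb' hu).trans ?_
      have := rpow_ge_cube hρ' hu hρ
      exact mul_le_mul exp12_le this (by positivity) (by linarith [KK_ge])
    · have h2 := rpow_ge_sq hρ hu
      have h3 : Real.exp (a * u - b * u ^ 2) ≤ Real.exp 61 := by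
        refine Real.exp_le_exp.2 ?_
        have h1 : a * u ≤ 3 * |u| := by
          have := le_abs_self u; have := abs_nonneg u; nlinarith
        have h2 : b * u ^ 2 ≥ 1 / 3 * |u| ^ 2 := by rw [sq_abs]; gcongr
        nlinarith [sq_nonneg (|u| - 9 / 2)]
      have h4 := Real.exp_pos (a * u - b * u ^ 2)
      have h5 : |1 + a * u + (a ^ 2 / 2 - b) * u ^ 2| ≤ 10 * |u| ^ 2 := by
        refine (abs_add_three _ _ _).trans ?_
        rw [abs_mul, abs_mul, abs_pow, abs_of_nonneg ha, abs_one]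
        have : |a ^ 2 / 2 - b| ≤ 6 := by rw [abs_le]; constructor <;> nlinarith
        have : |a ^ 2 / 2 - b| * |u| ^ 2 ≤ 6 * |u| ^ 2 := by gcongr
        nlinarith
      have h6 : Real.exp 61 + 10 ≤ KK := by
        have e1 : KK = Real.exp 61 * Real.exp 9 := by unfold KK; rw [← Real.exp_add]; norm_num
        have e2 := exp_nat_ge 9
        have e3 : 1 ≤ Real.exp 61 := Real.one_le_exp (by norm_num)
        push_cast at e2
        rw [e1]; nlinarith
      have h7 : 1 ≤ |u| ^ 2 := one_le_pow₀ hu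
      calc _ = |Real.exp (a * u - b * u ^ 2) - (1 + a * u + (a ^ 2 / 2 - b) * u ^ 2)| := by congr 1; ring
        _ ≤ |Real.exp (a * u - b * u ^ 2)| + |1 + a * u + (a ^ 2 / 2 - b) * u ^ 2| := abs_sub _ _
        _ ≤ Real.exp 61 * |u| ^ 2 + 10 * |u| ^ 2 := by
            rw [abs_of_pos h4]
            refine add_le_add (h3.trans (le_mul_of_one_le_right (Real.exp_pos _).le h7)) h5
        _ = (Real.exp 61 + 10) * |u| ^ 2 := by ring
        _ ≤ KK * |u| ^ (2 + ρ) := mul_le_mul h6 h2 (by positivity) (by linarith [KK_ge])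
  a_le := by rw [abs_of_nonneg ha]; exact ha'
  q_le := by rw [abs_le]; constructor <;> nlinarith
  K_ge := KK_ge

/-- truncated weight -/
noncomputable def tw (a u : ℝ) : ℝ := if |u| ≤ 1 then Real.exp (a * u - a ^ 2 / 2 * u ^ 2) else 0

lemma fam2 {ρ a : ℝ} (hρ : 0 < ρ) (hρ' : ρ < 1) (ha : 0 ≤ a) (ha' : a ≤ 1) : GoodW (tw a) ρ a 0 KK where
  meas := by
    refine Measurable.ite ?_ (by fun_prop) measurable_const
    exact measurableSet_le measurable_norm measurable_const
  nonneg u := by unfold tw; split_ifs; exacts [(Real.exp_pos _).le, le_rfl]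
  dec u := by
    unfold tw; split_ifs with hu
    · refine (mul_le_mul_of_nonneg_left (one_add_pow6 (abs_nonneg u)) (Real.exp_pos _).le).trans ?_
      rw [← Real.exp_add]
      refine Real.exp_le_exp.2 ?_
      have h1 : a * u ≤ 1 * 1 := by
        have := le_abs_self u; nlinarith
      have h2 : 0 ≤ a ^ 2 / 2 * u ^ 2 := by positivity
      linarith
    · rw [zero_mul]; linarith [KK_ge]
  tay u := by
    unfold tw; split_ifs with hu
    · have h := fam_tay (b := a ^ 2 / 2) ha (by linarith) (by positivity) (by nlinarith) hu
      rw [sub_self, zero_mul] at h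
      rw [zero_mul]
      refine h.trans ?_
      have := rpow_ge_cube hρ' hu hρ
      exact mul_le_mul exp12_le this (by positivity) (by linarith [KK_ge])
    · have hu : 1 ≤ |u| := by linarith
      have h2 := rpow_ge_sq hρ hu
      have h3 : |0 - 1 - a * u - 0 * u ^ 2| ≤ 2 * |u| ^ 2 := by
        rw [show 0 - 1 - a * u - 0 * u ^ 2 = -(1 + a * u) by ring, abs_neg]
        refine (abs_add_le _ _).trans ?_
        rw [abs_one, abs_mul, abs_of_nonneg ha]
        nlinarith
      have h4 : 2 ≤ KK := by
        have := exp_nat_ge 70; push_cast at this; unfold KK; linarith [show (2:ℝ) ≤ 2 ^ 70 by norm_num]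
      exact h3.trans (mul_le_mul h4 h2 (by positivity) (by linarith))
  a_le := by rw [abs_of_nonneg ha]; linarith
  q_le := by norm_num
  K_ge := KK_ge

lemma fam1_prod {a b : ℝ} {n : ℕ} (U : ℕ → ℝ) :
    ∏ k ∈ Finset.range n, Real.exp (a * U k - b * U k ^ 2) =
      Real.exp (a * ∑ k ∈ Finset.range n, U k - b * ∑ k ∈ Finset.range n, U k ^ 2) := by
  rw [← Real.exp_sum, Finset.mul_sum, Finset.mul_sum, ← Finset.sum_sub_distrib]

lemma fam2_prod {a : ℝ} {n : ℕ} (U : ℕ → ℝ) (h : ∀ k < n, |U k| ≤ 1) :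
    ∏ k ∈ Finset.range n, tw a (U k) =
      Real.exp (a * ∑ k ∈ Finset.range n, GoodW.ff a (U k)) := by
  rw [Finset.mul_sum, Real.exp_sum]
  refine Finset.prod_congr rfl fun k hk => ?_
  rw [tw, if_pos (h k (Finset.mem_range.1 hk)), GoodW.ff]
  congr 1; ring
end SNC


set_option linter.unusedSectionVars false
set_option linter.unusedVariables false
namespace SNC
open MeasureTheory Filter ProbabilityTheory
open scoped Topology ENNReal NNReal
namespace TD
variable {Ω : Type} [mΩ : MeasurableSpace Ω] {P : Measure Ω} [IsProbabilityMeasure P] {n : ℕ}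
    {F : ℕ → MeasurableSpace Ω} {U : ℕ → Ω → ℝ} {ρ g Λ N δ : ℝ} {w : ℝ → ℝ} {a q K : ℝ}

lemma vv_scale (s : ℝ) (k : ℕ) :
    vv P F (fun k ω => s * U k ω) k =ᵐ[P] fun ω => s ^ 2 * vv P F U k ω := by
  have h := condExp_smul (s ^ 2) (fun ω => U k ω ^ 2) (F k) (μ := P)
  have e : (fun ω => (s * U k ω) ^ 2) = (s ^ 2) • fun ω => U k ω ^ 2 := by
    funext ω; simp [mul_pow]
  simp only [vv]
  rw [e]
  filter_upwards [h] with ω h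
  rw [h]; rfl

lemma bb_scale {s : ℝ} (hs : 0 < s) (k : ℕ) :
    bb P F (fun k ω => s * U k ω) ρ k =ᵐ[P] fun ω => s ^ (2 + ρ) * bb P F U ρ k ω := by
  have h := condExp_smul (s ^ (2 + ρ)) (fun ω => |U k ω| ^ (2 + ρ)) (F k) (μ := P)
  have e : (fun ω => |s * U k ω| ^ (2 + ρ)) = (s ^ (2 + ρ)) • fun ω => |U k ω| ^ (2 + ρ) := by
    funext ω
    rw [abs_mul, abs_of_pos hs, Real.mul_rpow hs.le (abs_nonneg _)]; rfl
  simp only [bb]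
  rw [e]
  filter_upwards [h] with ω h
  rw [h]; rfl

lemma scale (D : TD P n F U ρ g Λ 1 δ) {s : ℝ} (hs : 0 < s) (hsg : s * g ≤ 1) :
    TD P n F (fun k ω => s * U k ω) ρ (s * g) (s ^ (2 + ρ) * Λ) (s ^ 2) δ where
  rho_pos := D.rho_pos
  rho_lt := D.rho_lt
  g_pos := mul_pos hs D.g_pos
  g_le := hsg
  F_mono := D.F_mono
  F_le := D.F_le
  meas k hk := (D.meas k hk).const_mul s
  int k hk := by
    refine ((D.int k hk).const_mul (s ^ (2 + ρ))).congr (ae_of_all _ fun ω => ?_)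
    beta_reduce
    rw [abs_mul, abs_of_pos hs, Real.mul_rpow hs.le (abs_nonneg _)]
  mean k hk := by
    have h := condExp_smul s (U k) (F k) (μ := P)
    have e : (fun ω => s * U k ω) = s • U k := rfl
    rw [e]
    filter_upwards [h, D.mean k hk] with ω h1 h2
    rw [h1, Pi.smul_apply, h2]; simp
  bet k hk := by
    filter_upwards [bb_scale (P := P) (F := F) (U := U) (ρ := ρ) hs k,
      vv_scale (P := P) (F := F) (U := U) s k, D.bet k hk] with ω h1 h2 h3
    rw [h1, h2, Real.mul_rpow hs.le D.g_pos.le]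
    have e : s ^ (2 + ρ) = s ^ ρ * s ^ 2 := by
      rw [add_comm, Real.rpow_add hs]; norm_num
    rw [e]
    have : 0 < s ^ ρ * s ^ 2 := by positivity
    nlinarith
  lam := by
    have h : ∀ᵐ ω ∂P, ∀ k ∈ Finset.range n, bb P F (fun k ω => s * U k ω) ρ k ω =
        s ^ (2 + ρ) * bb P F U ρ k ω := by
      rw [Filter.eventually_all_finset]; exact fun k _ => bb_scale hs k
    filter_upwards [h, D.lam] with ω h1 h2
    rw [Finset.sum_congr rfl h1, ← Finset.mul_sum]
    gcongr
  var := by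
    have h : ∀ᵐ ω ∂P, ∀ k ∈ Finset.range n, vv P F (fun k ω => s * U k ω) k ω =
        s ^ 2 * vv P F U k ω := by
      rw [Filter.eventually_all_finset]; exact fun k _ => vv_scale s k
    filter_upwards [h, D.var] with ω h1 h2
    rw [Finset.sum_congr rfl h1, ← Finset.mul_sum]
    rw [show s ^ 2 * ∑ k ∈ Finset.range n, vv P F U k ω - s ^ 2 =
      s ^ 2 * (∑ k ∈ Finset.range n, vv P F U k ω - 1) by ring, abs_mul, abs_of_nonneg (sq_nonneg s)]
    have : |∑ k ∈ Finset.range n, vv P F U k ω - 1| ≤ δ ^ 2 := by simpa using h2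
    gcongr

lemma big_jump (D : TD P n F U ρ g Λ N δ) :
    P.real {ω | ∃ k, k < n ∧ 1 < |U k ω|} ≤ Λ := by
  have hm : ∀ k, k < n → MeasurableSet {ω | 1 < |U k ω|} := fun k hk =>
    measurableSet_lt measurable_const (measurable_norm.comp (D.meas' hk))
  have hs : {ω | ∃ k, k < n ∧ 1 < |U k ω|} = ⋃ k ∈ Finset.range n, {ω | 1 < |U k ω|} := by
    ext ω; simp
  have hsm : MeasurableSet {ω | ∃ k, k < n ∧ 1 < |U k ω|} := by
    rw [hs]
    exact Finset.measurableSet_biUnion _ fun k hk => hm k (Finset.mem_range.1 hk)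
  have e : P.real {ω | ∃ k, k < n ∧ 1 < |U k ω|} =
      ∫ ω, {ω | ∃ k, k < n ∧ 1 < |U k ω|}.indicator (fun _ => (1:ℝ)) ω ∂P := by
    rw [integral_indicator hsm]; simp
  have hi : ∀ k ∈ Finset.range n, Integrable (fun ω => |U k ω| ^ (2 + ρ)) P := fun k hk =>
    D.int k (Finset.mem_range.1 hk)
  have hρ := D.rho_pos
  rw [e]
  calc ∫ ω, {ω | ∃ k, k < n ∧ 1 < |U k ω|}.indicator (fun _ => (1:ℝ)) ω ∂P
      ≤ ∫ ω, ∑ k ∈ Finset.range n, |U k ω| ^ (2 + ρ) ∂P := by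
        refine integral_mono ((integrable_const _).indicator hsm) (integrable_finsetSum _ hi) fun ω => ?_
        have hn : ∀ k ∈ Finset.range n, 0 ≤ |U k ω| ^ (2 + ρ) := fun k _ => by positivity
        by_cases hω : ω ∈ {ω | ∃ k, k < n ∧ 1 < |U k ω|}
        · rw [Set.indicator_of_mem hω]
          obtain ⟨k, hk, hk1⟩ := hω
          refine le_trans ?_ (Finset.single_le_sum hn (Finset.mem_range.2 hk))
          exact Real.one_le_rpow hk1.le (by linarith)
        · rw [Set.indicator_of_notMem hω]; exact Finset.sum_nonneg hn
    _ = ∑ k ∈ Finset.range n, ∫ ω, |U k ω| ^ (2 + ρ) ∂P := integral_finsetSum _ hi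
    _ = ∑ k ∈ Finset.range n, ∫ ω, bb P F U ρ k ω ∂P := by
        refine Finset.sum_congr rfl fun k _ => ?_
        exact (integral_condExp (D.F_le k)).symm
    _ = ∫ ω, ∑ k ∈ Finset.range n, bb P F U ρ k ω ∂P :=
        (integral_finsetSum _ fun k _ => integrable_condExp).symm
    _ ≤ ∫ ω, Λ ∂P := integral_mono_ae (integrable_finsetSum _ fun k _ => integrable_condExp)
        (integrable_const _) D.lam
    _ = Λ := by simp
end TD
end SNC


set_option linter.unusedSectionVars false
set_option linter.unusedVariables false
namespace SNC
open MeasureTheory Filter ProbabilityTheory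
open scoped Topology ENNReal NNReal

/-- threshold for the quadratic variation -/
noncomputable def et (ρ s e δ : ℝ) : ℝ :=
  s ^ ((ρ - 3) / 4) * e ^ (1 / 4 : ℝ) + 68 * KK * (s ^ ρ * e + δ ^ 2)

lemma rpow_two_add {s ρ : ℝ} (hs : 0 < s) : s ^ (2 + ρ) = s ^ 2 * s ^ ρ := by
  rw [Real.rpow_add hs]; norm_num

lemma et_pos {ρ s e δ : ℝ} (hs : 0 < s) (he : 0 < e) : 0 < et ρ s e δ := by
  have := KK_ge
  unfold et; positivity

lemma et_cond {ρ s e δ : ℝ} (hs : 0 < s) (he : 0 < e) :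
    2 * (34 * KK * (s ^ (2 + ρ) * e) + s ^ 2 * δ ^ 2) ≤ s ^ 2 * et ρ s e δ := by
  have hK := KK_ge
  rw [rpow_two_add hs]
  unfold et
  have h1 : 0 ≤ s ^ 2 * (s ^ ((ρ - 3) / 4) * e ^ (1 / 4 : ℝ)) := by positivity
  have h2 : s ^ 2 * δ ^ 2 ≤ KK * (s ^ 2 * δ ^ 2) := le_mul_of_one_le_left (by positivity) hK
  have h3 : 0 ≤ s ^ 2 * δ ^ 2 := by positivity
  nlinarith

lemma et_ratio {ρ s e δ : ℝ} (hs : 0 < s) (he : 0 < e) :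
    8 * KK * (s ^ (2 + ρ) * e) / (s ^ 2 * et ρ s e δ) ^ 2 ≤
      8 * KK * (s ^ ((ρ - 1) / 2) * e ^ (1 / 2 : ℝ)) := by
  have hK := KK_ge
  have hp := et_pos (ρ := ρ) (δ := δ) hs he
  rw [div_le_iff₀ (by positivity)]
  have h1 : s ^ ((ρ - 3) / 4) * e ^ (1 / 4 : ℝ) ≤ et ρ s e δ := by
    unfold et
    have : 0 ≤ 68 * KK * (s ^ ρ * e + δ ^ 2) := by positivity
    linarith
  have h2 : (s ^ ((ρ - 3) / 4) * e ^ (1 / 4 : ℝ)) ^ 2 ≤ et ρ s e δ ^ 2 := by gcongr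
  have h3 : (s ^ ((ρ - 3) / 4) * e ^ (1 / 4 : ℝ)) ^ 2 = s ^ ((ρ - 3) / 2) * e ^ (1 / 2 : ℝ) := by
    rw [mul_pow, ← Real.rpow_natCast, ← Real.rpow_natCast, ← Real.rpow_mul hs.le, ← Real.rpow_mul he.le]
    congr 2 <;> push_cast <;> ring
  have h4 : s ^ (2 + ρ) * e = s ^ ((ρ - 1) / 2) * e ^ (1 / 2 : ℝ) *
      (s ^ 4 * (s ^ ((ρ - 3) / 2) * e ^ (1 / 2 : ℝ))) := by
    have e1 : s ^ (2 + ρ) = s ^ ((ρ - 1) / 2) * s ^ 4 * s ^ ((ρ - 3) / 2) := by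
      rw [← Real.rpow_natCast s 4, ← Real.rpow_add hs, ← Real.rpow_add hs]
      congr 1; push_cast; ring
    have e2 : e ^ (1 / 2 : ℝ) * e ^ (1 / 2 : ℝ) = e := by
      rw [← Real.rpow_add he]; norm_num
    calc s ^ (2 + ρ) * e = s ^ ((ρ - 1) / 2) * s ^ 4 * s ^ ((ρ - 3) / 2) * (e ^ (1 / 2 : ℝ) * e ^ (1 / 2 : ℝ)) := by
          rw [e1, e2]
      _ = _ := by ring
  rw [h3] at h2
  calc 8 * KK * (s ^ (2 + ρ) * e) = 8 * KK * (s ^ ((ρ - 1) / 2) * e ^ (1 / 2 : ℝ)) *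
        (s ^ 4 * (s ^ ((ρ - 3) / 2) * e ^ (1 / 2 : ℝ))) := by rw [h4]; ring
    _ ≤ 8 * KK * (s ^ ((ρ - 1) / 2) * e ^ (1 / 2 : ℝ)) * (s ^ 4 * et ρ s e δ ^ 2) := by gcongr
    _ = _ := by ring

lemma et_sq {ρ s e δ : ℝ} (hs : 0 < s) (he : 0 < e) (hse : s ^ ρ * e ≤ 1) (hδ : 0 ≤ δ) (hδ' : δ ≤ 1) :
    s ^ 2 * et ρ s e δ ^ 2 ≤ 20000 * KK ^ 2 * (s ^ ((1 + ρ) / 2) * e ^ (1 / 2 : ℝ) +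
      s ^ (2 + ρ) * e + s ^ 2 * δ ^ 2) := by
  have hK := KK_ge
  have h3 : (s ^ ((ρ - 3) / 4) * e ^ (1 / 4 : ℝ)) ^ 2 = s ^ ((ρ - 3) / 2) * e ^ (1 / 2 : ℝ) := by
    rw [mul_pow, ← Real.rpow_natCast, ← Real.rpow_natCast, ← Real.rpow_mul hs.le, ← Real.rpow_mul he.le]
    congr 2 <;> push_cast <;> ring
  have h4 : s ^ 2 * s ^ ((ρ - 3) / 2) = s ^ ((1 + ρ) / 2) := by
    rw [← Real.rpow_natCast s 2, ← Real.rpow_add hs]; congr 1; push_cast; ring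
  rw [rpow_two_add hs]
  unfold et
  set A := s ^ ((ρ - 3) / 4) * e ^ (1 / 4 : ℝ) with hA
  set B := s ^ ρ * e with hB
  have hB0 : 0 ≤ B := by positivity
  have hA0 : 0 ≤ A := by positivity
  have h5 : s ^ ((1 + ρ) / 2) * e ^ (1 / 2 : ℝ) = s ^ 2 * A ^ 2 := by rw [h3, ← h4]; ring
  rw [h5, show s ^ 2 * s ^ ρ * e = s ^ 2 * B by rw [hB]; ring]
  have h6 : (A + 68 * KK * (B + δ ^ 2)) ^ 2 ≤ 20000 * KK ^ 2 * (A ^ 2 + B + δ ^ 2) := by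
    have hd : δ ^ 2 ≤ 1 := by nlinarith
    have h7 : (A + 68 * KK * (B + δ ^ 2)) ^ 2 ≤ 2 * A ^ 2 + 2 * (68 * KK * (B + δ ^ 2)) ^ 2 := by
      nlinarith [sq_nonneg (A - 68 * KK * (B + δ ^ 2))]
    have h8 : (B + δ ^ 2) ^ 2 ≤ 2 * (B + δ ^ 2) := by nlinarith [sq_nonneg δ]
    have hK2 : 1 ≤ KK ^ 2 := one_le_pow₀ hK
    have h9 : KK ^ 2 * (B + δ ^ 2) ^ 2 ≤ KK ^ 2 * (2 * (B + δ ^ 2)) := by gcongr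
    have h10 : A ^ 2 ≤ KK ^ 2 * A ^ 2 := le_mul_of_one_le_left (by positivity) hK2
    have h11 : 0 ≤ KK ^ 2 * (B + δ ^ 2) := by positivity
    have h12 : 0 ≤ KK ^ 2 * A ^ 2 := by positivity
    have e1 : (68 * KK * (B + δ ^ 2)) ^ 2 = 4624 * (KK ^ 2 * (B + δ ^ 2) ^ 2) := by ring
    rw [e1] at h7
    have e2 : 20000 * KK ^ 2 * (A ^ 2 + B + δ ^ 2) = 20000 * (KK ^ 2 * A ^ 2) + 20000 * (KK ^ 2 * (B + δ ^ 2)) := by ring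
    rw [e2]
    linarith
  calc s ^ 2 * (A + 68 * KK * (B + δ ^ 2)) ^ 2 ≤ s ^ 2 * (20000 * KK ^ 2 * (A ^ 2 + B + δ ^ 2)) := by gcongr
    _ = _ := by ring

namespace TD
variable {Ω : Type} [mΩ : MeasurableSpace Ω] {P : Measure Ω} [IsProbabilityMeasure P] {n : ℕ}
    {F : ℕ → MeasurableSpace Ω} {X : ℕ → Ω → ℝ} {ρ γ e δ : ℝ}

lemma VS_scale (s : ℝ) (f : ℕ → ℝ) : ∑ k ∈ Finset.range n, (s * f k) ^ 2 = s ^ 2 * ∑ k ∈ Finset.range n, f k ^ 2 ∧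
    ∑ k ∈ Finset.range n, (s * f k) = s * ∑ k ∈ Finset.range n, f k := by
  refine ⟨?_, by rw [Finset.mul_sum]⟩
  rw [Finset.mul_sum]; exact Finset.sum_congr rfl fun k _ => by ring

lemma dev_bc (D : TD P n F X ρ γ e 1 δ) (he : 0 < e) {x b : ℝ} (hx : 0 < x) (hxγ : x * γ ≤ 1)
    (hg : (6 + KK) * (x * γ) ^ 2 ≤ 1 / 2) (hb : 1 / 3 ≤ b) (hb' : b ≤ 1)
    {Ev : Set Ω} (mEv : MeasurableSet Ev)
    (h1 : ∀ ω ∈ Ev, et ρ x e δ ≤ |∑ k ∈ Finset.range n, X k ω ^ 2 - 1|)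
    (h2 : ∀ ω ∈ Ev, x * Real.sqrt (∑ k ∈ Finset.range n, X k ω ^ 2) ≤ ∑ k ∈ Finset.range n, X k ω)
    (h3 : ∀ ω ∈ Ev, 1 - b ≤ Real.sqrt (∑ k ∈ Finset.range n, X k ω ^ 2) - b * ∑ k ∈ Finset.range n, X k ω ^ 2) :
    P.real Ev ≤ Real.exp (-(x ^ 2) / 2) * (Real.exp (6 * (x ^ 2 * δ ^ 2) + KK * (x ^ (2 + ρ) * e)) *
      (8 * KK * (x ^ ((ρ - 1) / 2) * e ^ (1 / 2 : ℝ)))) := by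
  have hK := KK_ge
  have Ds := D.scale hx hxγ
  have W := fam1 (a := 1) D.rho_pos D.rho_lt (by norm_num) (by norm_num) hb hb'
  have hd := Ds.dev W hg (by positivity) (et_pos (ρ := ρ) (δ := δ) hx he) (et_cond hx he) mEv
    (L := x ^ 2 * (1 - b)) (by
      intro ω hω
      rw [(VS_scale x fun k => X k ω).1, show x ^ 2 * ∑ k ∈ Finset.range n, X k ω ^ 2 - x ^ 2 =
        x ^ 2 * (∑ k ∈ Finset.range n, X k ω ^ 2 - 1) by ring, abs_mul, abs_of_nonneg (sq_nonneg x)]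
      have := h1 ω hω
      gcongr) (by
      intro ω hω
      rw [fam1_prod (fun k => x * X k ω), (VS_scale x fun k => X k ω).1, (VS_scale x fun k => X k ω).2]
      refine Real.exp_le_exp.2 ?_
      have t2 := mul_le_mul_of_nonneg_left (h2 ω hω) hx.le
      have t3 := mul_le_mul_of_nonneg_left (h3 ω hω) (sq_nonneg x)
      linarith)
  refine hd.trans ?_
  have hq : |(1:ℝ) ^ 2 / 2 - b| ≤ 6 := by rw [abs_le]; constructor <;> nlinarith
  have h4 : ((1:ℝ) ^ 2 / 2 - b) * x ^ 2 + |(1:ℝ) ^ 2 / 2 - b| * (x ^ 2 * δ ^ 2) + KK * (x ^ (2 + ρ) * e) - x ^ 2 * (1 - b)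
      ≤ -(x ^ 2) / 2 + (6 * (x ^ 2 * δ ^ 2) + KK * (x ^ (2 + ρ) * e)) := by
    have : |(1:ℝ) ^ 2 / 2 - b| * (x ^ 2 * δ ^ 2) ≤ 6 * (x ^ 2 * δ ^ 2) := by gcongr
    linarith
  calc _ ≤ Real.exp (-(x ^ 2) / 2 + (6 * (x ^ 2 * δ ^ 2) + KK * (x ^ (2 + ρ) * e))) *
      (8 * KK * (x ^ ((ρ - 1) / 2) * e ^ (1 / 2 : ℝ))) :=
        mul_le_mul (Real.exp_le_exp.2 h4) (et_ratio hx he) (by positivity) (Real.exp_pos _).le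
    _ = _ := by rw [Real.exp_add, mul_assoc]

lemma dev_d (D : TD P n F X ρ γ e 1 δ) (he : 0 < e) {x : ℝ} (hx : 1 ≤ x) (hxγ : x * γ ≤ 1)
    (hg : (6 + KK) * (x * γ) ^ 2 ≤ 1 / 2) (hxe : 68 * KK * (x ^ ρ * e) ≤ 1) (hδ : 0 ≤ δ) (hδ' : δ ≤ 1 / 4)
    (j : ℕ) {Ev : Set Ω} (mEv : MeasurableSet Ev)
    (h1 : ∀ ω ∈ Ev, 2 ^ (j + 1) ≤ Real.sqrt (∑ k ∈ Finset.range n, X k ω ^ 2))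
    (h1' : ∀ ω ∈ Ev, Real.sqrt (∑ k ∈ Finset.range n, X k ω ^ 2) ≤ 2 * 2 ^ (j + 1))
    (h2 : ∀ ω ∈ Ev, x * Real.sqrt (∑ k ∈ Finset.range n, X k ω ^ 2) ≤ ∑ k ∈ Finset.range n, X k ω) :
    P.real Ev ≤ Real.exp (-(x ^ 2) / 2) * (Real.exp (6 * (x ^ 2 * δ ^ 2) + KK * (x ^ (2 + ρ) * e)) *
      (32 * KK * (x ^ (ρ - 2) * e))) * (1 / 4) ^ (j + 1) := by
  have hK := KK_ge
  have hρ := D.rho_pos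
  have hρ' := D.rho_lt
  have hγ := D.g_pos
  have hx0 : 0 < x := by linarith
  set t : ℝ := 2 ^ (j + 1) with ht
  have ht2 : 2 ≤ t := by
    rw [ht]; calc (2:ℝ) = 2 ^ 1 := by norm_num
      _ ≤ 2 ^ (j + 1) := pow_le_pow_right₀ (by norm_num) (by omega)
  have ht0 : 0 < t := by linarith
  have ht4 : (1 / 4 : ℝ) ^ (j + 1) = 1 / t ^ 2 := by
    rw [ht, ← pow_mul, mul_comm, pow_mul, one_div_pow]; norm_num
  set s := x / t with hs
  have hs0 : 0 < s := by positivity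
  have hst : s * t = x := by rw [hs]; field_simp
  have hsx : s ≤ x := by rw [hs, div_le_iff₀ ht0]; nlinarith
  have hsγ : s * γ ≤ x * γ := by gcongr
  have Ds := D.scale hs0 (hsγ.trans hxγ)
  have W := fam1 (a := 3) (b := 1) D.rho_pos D.rho_lt (by norm_num) (by norm_num) (by norm_num) le_rfl
  have hg' : (6 + KK) * (s * γ) ^ 2 ≤ 1 / 2 := by
    refine le_trans ?_ hg; gcongr
  have hη : 2 * (34 * KK * (s ^ (2 + ρ) * e) + s ^ 2 * δ ^ 2) ≤ s ^ 2 * (t ^ 2 / 2) := by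
    rw [rpow_two_add hs0]
    have u1 : s ^ ρ ≤ x ^ ρ := Real.rpow_le_rpow hs0.le hsx hρ.le
    have u2 : 68 * KK * (s ^ ρ * e) ≤ 1 := le_trans (by gcongr) hxe
    have u3 : 2 * δ ^ 2 ≤ 1 := by nlinarith
    have u4 : 68 * KK * (s ^ ρ * e) + 2 * δ ^ 2 ≤ t ^ 2 / 2 := by nlinarith
    calc 2 * (34 * KK * (s ^ 2 * s ^ ρ * e) + s ^ 2 * δ ^ 2) =
        s ^ 2 * (68 * KK * (s ^ ρ * e) + 2 * δ ^ 2) := by ring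
      _ ≤ _ := by gcongr
  have hd := Ds.dev W hg' (by positivity) (by positivity : 0 < t ^ 2 / 2) hη mEv
    (L := 2 * x ^ 2) (by
      intro ω hω
      rw [(VS_scale s fun k => X k ω).1, show s ^ 2 * ∑ k ∈ Finset.range n, X k ω ^ 2 - s ^ 2 =
        s ^ 2 * (∑ k ∈ Finset.range n, X k ω ^ 2 - 1) by ring, abs_mul, abs_of_nonneg (sq_nonneg s)]
      have hV0 : 0 ≤ ∑ k ∈ Finset.range n, X k ω ^ 2 := Finset.sum_nonneg fun k _ => sq_nonneg _
      have r1 := h1 ω hω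
      have r2 : t ^ 2 ≤ ∑ k ∈ Finset.range n, X k ω ^ 2 := by
        rw [← Real.sq_sqrt hV0]; gcongr
      have r3 : t ^ 2 / 2 ≤ |∑ k ∈ Finset.range n, X k ω ^ 2 - 1| :=
        le_trans (by nlinarith) (le_abs_self _)
      gcongr) (by
      intro ω hω
      rw [fam1_prod (fun k => s * X k ω), (VS_scale s fun k => X k ω).1, (VS_scale s fun k => X k ω).2]
      refine Real.exp_le_exp.2 ?_
      have hV0 : 0 ≤ ∑ k ∈ Finset.range n, X k ω ^ 2 := Finset.sum_nonneg fun k _ => sq_nonneg _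
      have t1 := h1 ω hω
      have t1' := h1' ω hω
      have t2 := mul_le_mul_of_nonneg_left (h2 ω hω) hs0.le
      have t3 := Real.sq_sqrt hV0
      set r := Real.sqrt (∑ k ∈ Finset.range n, X k ω ^ 2) with hr
      rw [← t3]
      have t4 : 0 ≤ s ^ 2 * ((r - t) * (2 * t - r)) := by
        have a1 : 0 ≤ r - t := by linarith
        have a2 : 0 ≤ 2 * t - r := by linarith
        positivity
      have t5 : s * (x * r) = s ^ 2 * (t * r) := by rw [← hst]; ring
      rw [t5] at t2
      rw [← hst]
      nlinarith)
  refine hd.trans ?_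
  rw [ht4]
  have hst2 : s ^ 2 ≤ x ^ 2 / 4 := by
    rw [← hst]; nlinarith [sq_nonneg s, mul_nonneg (sq_nonneg s) (by nlinarith : 0 ≤ t ^ 2 - 4)]
  have hsr : s ^ (2 + ρ) ≤ x ^ (2 + ρ) := Real.rpow_le_rpow hs0.le hsx (by linarith)
  have h4 : ((3:ℝ) ^ 2 / 2 - 1) * s ^ 2 + |(3:ℝ) ^ 2 / 2 - 1| * (s ^ 2 * δ ^ 2) + KK * (s ^ (2 + ρ) * e) - 2 * x ^ 2
      ≤ -(x ^ 2) / 2 + (6 * (x ^ 2 * δ ^ 2) + KK * (x ^ (2 + ρ) * e)) := by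
    have a1 : |(3:ℝ) ^ 2 / 2 - 1| = 7 / 2 := by norm_num
    rw [a1]
    have a2 : s ^ 2 * δ ^ 2 ≤ x ^ 2 * δ ^ 2 := by gcongr
    have a3 : KK * (s ^ (2 + ρ) * e) ≤ KK * (x ^ (2 + ρ) * e) := by gcongr
    have a4 : 0 ≤ x ^ 2 * δ ^ 2 := by positivity
    have a5 : 0 ≤ x ^ 2 := by positivity
    have a6 : (3:ℝ) ^ 2 / 2 - 1 = 7 / 2 := by norm_num
    rw [a6]
    linarith
  have h5 : 8 * KK * (s ^ (2 + ρ) * e) / (s ^ 2 * (t ^ 2 / 2)) ^ 2 ≤ 32 * KK * (x ^ (ρ - 2) * e) * (1 / t ^ 2) := by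
    have e1 : s ^ (2 + ρ) = s ^ 4 * s ^ (ρ - 2) := by
      rw [← Real.rpow_natCast s 4, ← Real.rpow_add hs0]; congr 1; push_cast; ring
    have e2 : s ^ (ρ - 2) ≤ x ^ (ρ - 2) * t ^ 2 := by
      rw [hs, Real.div_rpow hx0.le ht0.le, div_le_iff₀ (by positivity), mul_assoc]
      refine le_mul_of_one_le_right (by positivity) ?_
      rw [← Real.rpow_natCast, ← Real.rpow_add ht0]
      exact Real.one_le_rpow (by linarith) (by push_cast; linarith)
    rw [div_le_iff₀ (by positivity), e1]
    calc 8 * KK * (s ^ 4 * s ^ (ρ - 2) * e) ≤ 8 * KK * (s ^ 4 * (x ^ (ρ - 2) * t ^ 2) * e) := by gcongr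
      _ = _ := by field_simp; ring
  calc _ ≤ Real.exp (-(x ^ 2) / 2 + (6 * (x ^ 2 * δ ^ 2) + KK * (x ^ (2 + ρ) * e))) *
      (32 * KK * (x ^ (ρ - 2) * e) * (1 / t ^ 2)) :=
        mul_le_mul (Real.exp_le_exp.2 h4) h5 (by positivity) (Real.exp_pos _).le
    _ = _ := by rw [Real.exp_add]; simp only [mul_assoc]
end TD
end SNC


set_option linter.unusedSectionVars false
set_option linter.unusedVariables false
namespace SNC
open MeasureTheory Filter ProbabilityTheory
open scoped Topology ENNReal NNReal

lemma real_iUnion_geom {Ω : Type} [mΩ : MeasurableSpace Ω] {P : Measure Ω} [IsProbabilityMeasure P]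
    (E : ℕ → Set Ω) {a : ℝ} (ha : 0 ≤ a) (h : ∀ j, P.real (E j) ≤ a * (1 / 4) ^ (j + 1)) :
    P.real (⋃ j, E j) ≤ a := by
  refine ENNReal.toReal_le_of_le_ofReal ha ?_
  have hsum : HasSum (fun j : ℕ => a * (1 / 4 : ℝ) ^ (j + 1)) (a / 3) := by
    have := (hasSum_geometric_of_lt_one (by norm_num : (0:ℝ) ≤ 1 / 4) (by norm_num)).mul_left (a * (1 / 4))
    have e1 : (fun j : ℕ => a * (1 / 4 : ℝ) ^ (j + 1)) = fun j : ℕ => a * (1 / 4) * (1 / 4 : ℝ) ^ j := by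
      funext j; rw [pow_succ]; ring
    have e2 : a / 3 = a * (1 / 4) * (1 - 1 / 4)⁻¹ := by norm_num; ring
    rw [e1, e2]; exact this
  calc P (⋃ j, E j) ≤ ∑' j, P (E j) := measure_iUnion_le E
    _ ≤ ∑' j, ENNReal.ofReal (a * (1 / 4) ^ (j + 1)) := by
        refine ENNReal.tsum_le_tsum fun j => ?_
        exact (ENNReal.le_ofReal_iff_toReal_le (measure_ne_top _ _) (by positivity)).2 (h j)
    _ = ENNReal.ofReal (∑' j : ℕ, a * (1 / 4) ^ (j + 1)) :=
        (ENNReal.ofReal_tsum_of_nonneg (fun j => by positivity) hsum.summable).symm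
    _ ≤ ENNReal.ofReal a := by
        refine ENNReal.ofReal_le_ofReal ?_
        rw [hsum.tsum_eq]; linarith

lemma elem1 {r v : ℝ} (h0 : 0 ≤ r) (h1 : r ≤ 1) (h : r ^ 2 = v) : 1 - 1 ≤ r - 1 * v := by
  rw [← h]; nlinarith

lemma elem2 {r v : ℝ} (h0 : 1 ≤ r) (h1 : r ≤ 2) (h : r ^ 2 = v) : 1 - 1 / 3 ≤ r - 1 / 3 * v := by
  rw [← h]; nlinarith

lemma exp_combine {p C1 C3 c2 R T : ℝ} (hp : 0 ≤ p) (h1 : 0 ≤ C1) (h3 : 0 ≤ C3) (h2 : 0 ≤ c2)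
    (hR : 0 ≤ R) (hT : T ≤ R) :
    p * Real.exp (C1 * R) + p * (c2 * T) * Real.exp (C3 * R) ≤ p * Real.exp ((C1 + C3 + c2) * R) := by
  have e1 : Real.exp (C1 * R) ≤ Real.exp ((C1 + C3) * R) := Real.exp_le_exp.2 (by nlinarith)
  have e3 : Real.exp (C3 * R) ≤ Real.exp ((C1 + C3) * R) := Real.exp_le_exp.2 (by nlinarith)
  have e2 : 1 + c2 * R ≤ Real.exp (c2 * R) := by linarith [Real.add_one_le_exp (c2 * R)]
  calc p * Real.exp (C1 * R) + p * (c2 * T) * Real.exp (C3 * R)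
      ≤ p * Real.exp ((C1 + C3) * R) + p * (c2 * R) * Real.exp ((C1 + C3) * R) := by gcongr
    _ = p * (Real.exp ((C1 + C3) * R) * (1 + c2 * R)) := by ring
    _ ≤ p * (Real.exp ((C1 + C3) * R) * Real.exp (c2 * R)) := by gcongr
    _ = _ := by rw [← Real.exp_add]; ring_nf

/-- error term -/
noncomputable def RR (ρ s γ e δ : ℝ) : ℝ :=
  s ^ (2 + ρ) * e + s ^ 2 * δ ^ 2 + s * ((s * γ) ^ ρ + δ) + s ^ ((1 + ρ) / 2) * e ^ (1 / 2 : ℝ)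

namespace TD
variable {Ω : Type} [mΩ : MeasurableSpace Ω] {P : Measure Ω} [IsProbabilityMeasure P] {n : ℕ}
    {F : ℕ → MeasurableSpace Ω} {X : ℕ → Ω → ℝ} {ρ γ e δ g Λ N : ℝ}

lemma mS (D : TD P n F X ρ g Λ N δ) : Measurable fun ω => ∑ k ∈ Finset.range n, X k ω :=
  Finset.measurable_fun_sum _ fun k hk => D.meas' (Finset.mem_range.1 hk)

lemma mV (D : TD P n F X ρ g Λ N δ) : Measurable fun ω => ∑ k ∈ Finset.range n, X k ω ^ 2 :=
  Finset.measurable_fun_sum _ fun k hk => (D.meas' (Finset.mem_range.1 hk)).pow_const 2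

set_option maxHeartbeats 2000000 in
lemma core_big {C g1 : ℝ} (hC : 0 < C)
    (main : ∀ {U : ℕ → Ω → ℝ} {g Λ N a s η : ℝ} {w : ℝ → ℝ} {Ev : Set Ω}
      (_ : TD P n F U ρ g Λ N δ) (_ : GoodW w ρ a 0 KK), 0 ≤ a → a ≤ 1 → 1 ≤ s → N = s ^ 2 →
      g ≤ g1 → 0 ≤ δ → δ ≤ 1 → 0 ≤ Λ → 0 ≤ η → MeasurableSet Ev →
      (∀ ω ∈ Ev, a * s * Real.sqrt (∑ k ∈ Finset.range n, U k ω ^ 2) ≤ ∑ k ∈ Finset.range n, U k ω) →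
      (∀ ω ∈ Ev, |∑ k ∈ Finset.range n, U k ω ^ 2 - s ^ 2| ≤ s ^ 2 * η) →
      (∀ ω ∈ Ev, Real.exp (a * ∑ k ∈ Finset.range n, GoodW.ff a (U k ω)) ≤
        ∏ k ∈ Finset.range n, w (U k ω)) →
      P.real Ev ≤ (1 - stdNormalCDF (a * s)) *
        Real.exp (C * (Λ + s ^ 2 * δ ^ 2 + s ^ 2 * η ^ 2 + s * (g ^ ρ + δ))))
    (D : TD P n F X ρ γ e 1 δ) (he : 0 < e) {x : ℝ} (hx : 1 ≤ x) (hxγ : x * γ ≤ 1) (hxg : x * γ ≤ g1)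
    (hg : (6 + KK) * (x * γ) ^ 2 ≤ 1 / 2) (hxe : 68 * KK * (x ^ ρ * e) ≤ 1) (hδ : 0 ≤ δ) (hδ' : δ ≤ 1 / 4) :
    P.real {ω | x * Real.sqrt (∑ k ∈ Finset.range n, X k ω ^ 2) ≤ ∑ k ∈ Finset.range n, X k ω} ≤
      (1 - stdNormalCDF x) * Real.exp ((C * (1 + 20000 * KK ^ 2) + (6 + KK) + 1440 * KK) * RR ρ x γ e δ) := by
  have hK := KK_ge
  have hx0 : 0 < x := by linarith
  have hρ := D.rho_pos
  have hρ' := D.rho_lt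
  have hγ := D.g_pos
  have hp := one_sub_cdf_pos x
  set p := 1 - stdNormalCDF x with hpdef
  set V := fun ω => ∑ k ∈ Finset.range n, X k ω ^ 2 with hV
  set S := fun ω => ∑ k ∈ Finset.range n, X k ω with hS
  set H := et ρ x e δ with hH
  set R := RR ρ x γ e δ with hR
  set T := x ^ ((1 + ρ) / 2) * e ^ (1 / 2 : ℝ) with hT
  have mS : Measurable S := D.mS
  have mV : Measurable V := D.mV
  have mr : Measurable fun ω => Real.sqrt (V ω) := mV.sqrt
  have mxS : MeasurableSet {ω | x * Real.sqrt (V ω) ≤ S ω} := measurableSet_le (mr.const_mul x) mS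
  have hV0 : ∀ ω, 0 ≤ V ω := fun ω => Finset.sum_nonneg fun k _ => sq_nonneg _
  have hxρ1 : 1 ≤ x ^ ρ := Real.one_le_rpow hx hρ.le
  have hxe1 : x ^ ρ * e ≤ 1 := by
    have : 0 ≤ x ^ ρ * e := by positivity
    nlinarith
  have he1 : e ≤ 1 := by nlinarith
  have hT0 : 0 ≤ T := by positivity
  have r1 : 0 ≤ x ^ (2 + ρ) * e := by positivity
  have r2 : 0 ≤ x ^ 2 * δ ^ 2 := by positivity
  have r3 : 0 ≤ x * ((x * γ) ^ ρ + δ) := by positivity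
  have hRdef : R = x ^ (2 + ρ) * e + x ^ 2 * δ ^ 2 + x * ((x * γ) ^ ρ + δ) + T := rfl
  have hR0 : 0 ≤ R := by rw [hRdef]; positivity
  have hTR : T ≤ R := by rw [hRdef]; linarith
  have hHpos : 0 < H := et_pos hx0 he
  -- main part
  set E1 := {ω | x * Real.sqrt (V ω) ≤ S ω} ∩ {ω | |V ω - 1| ≤ H} with hE1
  set E2 := {ω | x * Real.sqrt (V ω) ≤ S ω} ∩ ({ω | H ≤ |V ω - 1|} ∩ {ω | V ω ≤ 1}) with hE2
  set E3 := {ω | x * Real.sqrt (V ω) ≤ S ω} ∩ ({ω | H ≤ |V ω - 1|} ∩ ({ω | 1 ≤ Real.sqrt (V ω)} ∩ {ω | Real.sqrt (V ω) ≤ 2})) with hE3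
  set E4 : ℕ → Set Ω := fun j => {ω | x * Real.sqrt (V ω) ≤ S ω} ∩ ({ω | 2 ^ (j + 1) ≤ Real.sqrt (V ω)} ∩ {ω | Real.sqrt (V ω) ≤ 2 * 2 ^ (j + 1)}) with hE4
  have mabs : Measurable fun ω => |V ω - 1| := measurable_norm.comp (mV.sub_const 1)
  have P1 : P.real E1 ≤ p * Real.exp (C * (1 + 20000 * KK ^ 2) * R) := by
    have Ds := D.scale hx0 hxγ
    have W := fam1 (a := 1) (b := 1 / 2) hρ hρ' (by norm_num) (by norm_num) (by norm_num) (by norm_num)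
    rw [show (1:ℝ) ^ 2 / 2 - 1 / 2 = 0 by norm_num] at W
    have h := main (η := H) (Ev := E1) Ds W (by norm_num) le_rfl hx rfl hxg hδ (by linarith) r1 hHpos.le
      (mxS.inter (measurableSet_le mabs measurable_const)) (by
        intro ω hω
        have h1 : x * Real.sqrt (V ω) ≤ S ω := hω.1
        rw [(VS_scale x fun k => X k ω).1, (VS_scale x fun k => X k ω).2, Real.sqrt_mul (sq_nonneg x),
          Real.sqrt_sq hx0.le, one_mul]
        exact mul_le_mul_of_nonneg_left h1 hx0.le) (by
        intro ω hω
        have h1 : |V ω - 1| ≤ H := hω.2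
        rw [(VS_scale x fun k => X k ω).1, show x ^ 2 * ∑ k ∈ Finset.range n, X k ω ^ 2 - x ^ 2 =
          x ^ 2 * (∑ k ∈ Finset.range n, X k ω ^ 2 - 1) by ring, abs_mul, abs_of_nonneg (sq_nonneg x)]
        exact mul_le_mul_of_nonneg_left h1 (sq_nonneg x)) (by
        intro ω hω
        rw [fam1_prod (fun k => x * X k ω)]
        refine Real.exp_le_exp.2 (le_of_eq ?_)
        rw [one_mul, one_mul, Finset.mul_sum, ← Finset.sum_sub_distrib]
        rfl)
    rw [one_mul] at h
    refine h.trans (mul_le_mul_of_nonneg_left (Real.exp_le_exp.2 ?_) hp.le)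
    have hsq := et_sq (ρ := ρ) hx0 he hxe1 hδ (by linarith : δ ≤ 1)
    rw [mul_assoc]
    refine mul_le_mul_of_nonneg_left ?_ hC.le
    have : 20000 * KK ^ 2 * (x ^ ((1 + ρ) / 2) * e ^ (1 / 2 : ℝ) + x ^ (2 + ρ) * e + x ^ 2 * δ ^ 2) ≤ 20000 * KK ^ 2 * R := by
      refine mul_le_mul_of_nonneg_left ?_ (by positivity)
      rw [hRdef]; linarith
    have h5 : x ^ 2 * H ^ 2 ≤ 20000 * KK ^ 2 * R := hsq.trans this
    have h6 : x ^ (2 + ρ) * e + x ^ 2 * δ ^ 2 + x * ((x * γ) ^ ρ + δ) ≤ R := by rw [hRdef]; linarith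
    linarith
  have hml := mills_lower hx0.le
  have hml2 : Real.exp (-(x ^ 2) / 2) ≤ 30 * x * p := by
    refine hml.trans ?_
    have : 0 ≤ p * (x - 1) := mul_nonneg hp.le (by linarith)
    linarith
  have hE : Real.exp (6 * (x ^ 2 * δ ^ 2) + KK * (x ^ (2 + ρ) * e)) ≤ Real.exp ((6 + KK) * R) := by
    refine Real.exp_le_exp.2 ?_
    have a1 : x ^ 2 * δ ^ 2 ≤ R := by rw [hRdef]; linarith
    have a2 : x ^ (2 + ρ) * e ≤ R := by rw [hRdef]; linarith
    have a3 : KK * (x ^ (2 + ρ) * e) ≤ KK * R := by gcongr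
    linarith
  have hx1 : x * x ^ ((ρ - 1) / 2) = x ^ ((1 + ρ) / 2) := by
    nth_rewrite 1 [← Real.rpow_one x]
    rw [← Real.rpow_add hx0]; congr 1; ring
  have hbc : Real.exp (-(x ^ 2) / 2) * (Real.exp (6 * (x ^ 2 * δ ^ 2) + KK * (x ^ (2 + ρ) * e)) *
      (8 * KK * (x ^ ((ρ - 1) / 2) * e ^ (1 / 2 : ℝ)))) ≤ p * (240 * KK * T) * Real.exp ((6 + KK) * R) := by
    calc _ ≤ 30 * x * p * (Real.exp ((6 + KK) * R) * (8 * KK * (x ^ ((ρ - 1) / 2) * e ^ (1 / 2 : ℝ)))) := by gcongr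
      _ = p * (240 * KK * ((x * x ^ ((ρ - 1) / 2)) * e ^ (1 / 2 : ℝ))) * Real.exp ((6 + KK) * R) := by ring
      _ = _ := by rw [hx1]
  have hd : Real.exp (-(x ^ 2) / 2) * (Real.exp (6 * (x ^ 2 * δ ^ 2) + KK * (x ^ (2 + ρ) * e)) *
      (32 * KK * (x ^ (ρ - 2) * e))) ≤ p * (960 * KK * T) * Real.exp ((6 + KK) * R) := by
    have b1 : x * x ^ (ρ - 2) * e ≤ T := by
      have c1 : x * x ^ (ρ - 2) ≤ x ^ ((1 + ρ) / 2) := by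
        nth_rewrite 1 [← Real.rpow_one x]
        rw [← Real.rpow_add hx0]
        exact Real.rpow_le_rpow_of_exponent_le hx (by linarith)
      have c2 : e ≤ e ^ (1 / 2 : ℝ) := by
        nth_rewrite 1 [← Real.rpow_one e]
        exact Real.rpow_le_rpow_of_exponent_ge he he1 (by norm_num)
      exact mul_le_mul c1 c2 he.le (by positivity)
    calc _ ≤ 30 * x * p * (Real.exp ((6 + KK) * R) * (32 * KK * (x ^ (ρ - 2) * e))) := by gcongr
      _ = p * (960 * KK * (x * x ^ (ρ - 2) * e)) * Real.exp ((6 + KK) * R) := by ring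
      _ ≤ _ := by gcongr
  have P2 : P.real E2 ≤ p * (240 * KK * T) * Real.exp ((6 + KK) * R) := by
    refine le_trans (D.dev_bc he hx0 hxγ hg (b := 1) (by norm_num) le_rfl
      (mxS.inter ((measurableSet_le measurable_const mabs).inter (measurableSet_le mV measurable_const)))
      (fun ω hω => hω.2.1) (fun ω hω => hω.1) ?_) hbc
    intro ω hω
    have h1 : V ω ≤ 1 := hω.2.2
    change 1 - 1 ≤ Real.sqrt (V ω) - 1 * V ω
    have h2 := Real.sq_sqrt (hV0 ω)
    have h3 : Real.sqrt (V ω) ≤ 1 := Real.sqrt_le_one.2 h1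
    exact elem1 (Real.sqrt_nonneg (V ω)) h3 h2
  have P3 : P.real E3 ≤ p * (240 * KK * T) * Real.exp ((6 + KK) * R) := by
    refine le_trans (D.dev_bc he hx0 hxγ hg (b := 1 / 3) le_rfl (by norm_num)
      (mxS.inter ((measurableSet_le measurable_const mabs).inter
        ((measurableSet_le measurable_const mr).inter (measurableSet_le mr measurable_const))))
      (fun ω hω => hω.2.1) (fun ω hω => hω.1) ?_) hbc
    intro ω hω
    have h1 : 1 ≤ Real.sqrt (V ω) := hω.2.2.1
    have h3 : Real.sqrt (V ω) ≤ 2 := hω.2.2.2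
    change 1 - 1 / 3 ≤ Real.sqrt (V ω) - 1 / 3 * V ω
    exact elem2 h1 h3 (Real.sq_sqrt (hV0 ω))
  have P4 : P.real (⋃ j, E4 j) ≤ p * (960 * KK * T) * Real.exp ((6 + KK) * R) := by
    refine le_trans (real_iUnion_geom E4 (by positivity) fun j => ?_) hd
    exact D.dev_d he hx hxγ hg hxe hδ hδ' j
      (mxS.inter ((measurableSet_le measurable_const mr).inter (measurableSet_le mr measurable_const)))
      (fun ω hω => hω.2.1) (fun ω hω => hω.2.2) (fun ω hω => hω.1)
  have hsub : {ω | x * Real.sqrt (V ω) ≤ S ω} ⊆ E1 ∪ (E2 ∪ (E3 ∪ ⋃ j, E4 j)) := by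
    intro ω hω
    by_cases h1 : |V ω - 1| ≤ H
    · exact Or.inl ⟨hω, h1⟩
    refine Or.inr ?_
    have h1' : H ≤ |V ω - 1| := (not_le.1 h1).le
    by_cases h2 : V ω ≤ 1
    · exact Or.inl ⟨hω, h1', h2⟩
    refine Or.inr ?_
    have h2' : 1 ≤ Real.sqrt (V ω) := Real.one_le_sqrt.2 (not_le.1 h2).le
    by_cases h3 : Real.sqrt (V ω) ≤ 2
    · exact Or.inl ⟨hω, h1', h2', h3⟩
    refine Or.inr (Set.mem_iUnion.2 ?_)
    obtain ⟨j, hj1, hj2⟩ := exists_nat_pow_near (x := Real.sqrt (V ω) / 2) (y := 2) (by linarith [not_le.1 h3]) (by norm_num)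
    refine ⟨j, hω, ?_, ?_⟩
    · change 2 ^ (j + 1) ≤ Real.sqrt (V ω)
      rw [pow_succ]; linarith
    · change Real.sqrt (V ω) ≤ 2 * 2 ^ (j + 1)
      linarith
  have hfin := exp_combine (C1 := C * (1 + 20000 * KK ^ 2)) (C3 := 6 + KK) (c2 := 1440 * KK) hp.le
    (by positivity) (by positivity) (by positivity) hR0 hTR
  refine le_trans ?_ hfin
  have u1 := measureReal_mono (μ := P) hsub
  have u2 := measureReal_union_le (μ := P) E1 (E2 ∪ (E3 ∪ ⋃ j, E4 j))
  have u3 := measureReal_union_le (μ := P) E2 (E3 ∪ ⋃ j, E4 j)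
  have u4 := measureReal_union_le (μ := P) E3 (⋃ j, E4 j)
  have e1 : p * (1440 * KK * T) * Real.exp ((6 + KK) * R) = p * (240 * KK * T) * Real.exp ((6 + KK) * R) +
    p * (240 * KK * T) * Real.exp ((6 + KK) * R) + p * (960 * KK * T) * Real.exp ((6 + KK) * R) := by ring
  rw [e1]
  linarith

end TD
end SNC


set_option linter.unusedSectionVars false
set_option linter.unusedVariables false
namespace SNC
open MeasureTheory Filter ProbabilityTheory
open scoped Topology ENNReal NNReal

lemma cdf_lower_small {x : ℝ} (h0 : 0 ≤ x) (h1 : x ≤ 1) : 1 ≤ 60 * (1 - stdNormalCDF x) := by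
  have hml := mills_lower h0
  have hp := one_sub_cdf_pos x
  have h2 : (1:ℝ) / 2 ≤ Real.exp (-(x ^ 2) / 2) := by
    have := Real.add_one_le_exp (-(x ^ 2) / 2)
    nlinarith
  nlinarith

namespace TD
variable {Ω : Type} [mΩ : MeasurableSpace Ω] {P : Measure Ω} [IsProbabilityMeasure P] {n : ℕ}
    {F : ℕ → MeasurableSpace Ω} {X : ℕ → Ω → ℝ} {ρ γ e δ g Λ N : ℝ}

set_option maxHeartbeats 2000000 in
lemma core_small {C g1 : ℝ} (hC : 0 < C)
    (main : ∀ {U : ℕ → Ω → ℝ} {g Λ N a s η : ℝ} {w : ℝ → ℝ} {Ev : Set Ω}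
      (_ : TD P n F U ρ g Λ N δ) (_ : GoodW w ρ a 0 KK), 0 ≤ a → a ≤ 1 → 1 ≤ s → N = s ^ 2 →
      g ≤ g1 → 0 ≤ δ → δ ≤ 1 → 0 ≤ Λ → 0 ≤ η → MeasurableSet Ev →
      (∀ ω ∈ Ev, a * s * Real.sqrt (∑ k ∈ Finset.range n, U k ω ^ 2) ≤ ∑ k ∈ Finset.range n, U k ω) →
      (∀ ω ∈ Ev, |∑ k ∈ Finset.range n, U k ω ^ 2 - s ^ 2| ≤ s ^ 2 * η) →
      (∀ ω ∈ Ev, Real.exp (a * ∑ k ∈ Finset.range n, GoodW.ff a (U k ω)) ≤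
        ∏ k ∈ Finset.range n, w (U k ω)) →
      P.real Ev ≤ (1 - stdNormalCDF (a * s)) *
        Real.exp (C * (Λ + s ^ 2 * δ ^ 2 + s ^ 2 * η ^ 2 + s * (g ^ ρ + δ))))
    (D : TD P n F X ρ γ e 1 δ) (he : 0 < e) {x : ℝ} (hx0 : 0 ≤ x) (hx : x ≤ 1) (hγg : γ ≤ g1)
    (hg : (6 + KK) * γ ^ 2 ≤ 1 / 2) (hxe : 68 * KK * e ≤ 1) (hδ : 0 ≤ δ) (hδ' : δ ≤ 1 / 4) :
    P.real {ω | x * Real.sqrt (∑ k ∈ Finset.range n, X k ω ^ 2) ≤ ∑ k ∈ Finset.range n, X k ω} ≤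
      (1 - stdNormalCDF x) * Real.exp ((C * (1 + 20000 * KK ^ 2) + (6 + KK) + 1440 * KK) * RR ρ 1 γ e δ) := by
  have hK := KK_ge
  have hρ := D.rho_pos
  have hρ' := D.rho_lt
  have hγ := D.g_pos
  have hp := one_sub_cdf_pos x
  have hp60 := cdf_lower_small hx0 hx
  set p := 1 - stdNormalCDF x with hpdef
  set V := fun ω => ∑ k ∈ Finset.range n, X k ω ^ 2 with hV
  set S := fun ω => ∑ k ∈ Finset.range n, X k ω with hS
  set H := et ρ 1 e δ with hH
  set R := RR ρ 1 γ e δ with hR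
  set T := e ^ (1 / 2 : ℝ) with hT
  have mS : Measurable S := D.mS
  have mV : Measurable V := D.mV
  have mr : Measurable fun ω => Real.sqrt (V ω) := mV.sqrt
  have mxS : MeasurableSet {ω | x * Real.sqrt (V ω) ≤ S ω} := measurableSet_le (mr.const_mul x) mS
  have mabs : Measurable fun ω => |V ω - 1| := measurable_norm.comp (mV.sub_const 1)
  have he1 : e ≤ 1 := by nlinarith
  have hT0 : 0 ≤ T := by positivity
  have r3 : 0 ≤ γ ^ ρ + δ := by positivity
  have r2 : 0 ≤ δ ^ 2 := by positivity
  have hRdef : R = e + δ ^ 2 + (γ ^ ρ + δ) + T := by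
    rw [hR, RR]; simp only [Real.one_rpow, one_pow, one_mul, hT]
  have hR0 : 0 ≤ R := by rw [hRdef]; positivity
  have hTR : T ≤ R := by rw [hRdef]; linarith
  have hHpos : 0 < H := et_pos one_pos he
  have heT : e ≤ T := by
    rw [hT]; nth_rewrite 1 [← Real.rpow_one e]
    exact Real.rpow_le_rpow_of_exponent_ge he he1 (by norm_num)
  set J := {ω | ∃ k, k < n ∧ 1 < |X k ω|} with hJ
  have mJ : MeasurableSet J := by
    have hs : J = ⋃ k ∈ Finset.range n, {ω | 1 < |X k ω|} := by ext ω; simp [hJ]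
    rw [hs]
    exact Finset.measurableSet_biUnion _ fun k hk =>
      measurableSet_lt measurable_const (measurable_norm.comp (D.meas' (Finset.mem_range.1 hk)))
  have hJc : ∀ ω ∈ Jᶜ, ∀ k < n, |X k ω| ≤ 1 := by
    intro ω hω k hk
    by_contra hc
    exact hω ⟨k, hk, not_le.1 hc⟩
  set E1 := {ω | x * Real.sqrt (V ω) ≤ S ω} ∩ ({ω | |V ω - 1| ≤ H} ∩ Jᶜ) with hE1
  set E2 := {ω | H ≤ |V ω - 1|} ∩ Jᶜ with hE2
  have P1 : P.real E1 ≤ p * Real.exp (C * (1 + 20000 * KK ^ 2) * R) := by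
    have W := fam2 (a := x) hρ hρ' hx0 hx
    have h := main (η := H) (Ev := E1) D W hx0 hx (le_refl 1) (by norm_num) hγg hδ (by linarith) he.le hHpos.le
      (mxS.inter ((measurableSet_le mabs measurable_const).inter mJ.compl)) (by
        intro ω hω
        have h1 : x * Real.sqrt (V ω) ≤ S ω := hω.1
        rw [mul_one]; exact h1) (by
        intro ω hω
        have h1 : |V ω - 1| ≤ H := hω.2.1
        rw [one_pow, one_mul]; exact h1) (by
        intro ω hω
        rw [fam2_prod (fun k => X k ω) (hJc ω hω.2.2)])
    rw [mul_one] at h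
    refine h.trans (mul_le_mul_of_nonneg_left (Real.exp_le_exp.2 ?_) hp.le)
    have hsq := et_sq (ρ := ρ) (s := 1) one_pos he (by rw [Real.one_rpow, one_mul]; exact he1) hδ (by linarith : δ ≤ 1)
    simp only [Real.one_rpow, one_pow, one_mul] at hsq ⊢
    rw [mul_assoc]
    refine mul_le_mul_of_nonneg_left ?_ hC.le
    have : 20000 * KK ^ 2 * (e ^ (1 / 2 : ℝ) + e + δ ^ 2) ≤ 20000 * KK ^ 2 * R := by
      refine mul_le_mul_of_nonneg_left ?_ (by positivity)
      rw [hRdef]; linarith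
    have h5 : H ^ 2 ≤ 20000 * KK ^ 2 * R := hsq.trans this
    have h6 : e + δ ^ 2 + (γ ^ ρ + δ) ≤ R := by rw [hRdef]; linarith
    linarith
  have P2 : P.real E2 ≤ 8 * KK * T * Real.exp ((6 + KK) * R) := by
    have W := fam2 (a := 0) hρ hρ' le_rfl (by norm_num)
    have hc := et_cond (ρ := ρ) (s := 1) (δ := δ) one_pos he
    have hr := et_ratio (ρ := ρ) (s := 1) (δ := δ) one_pos he
    simp only [Real.one_rpow, one_pow, one_mul] at hc hr
    have h := D.dev W hg one_pos (η := H) (L := 0) (Ev := E2) hHpos (by rw [one_mul, one_mul]; exact hc)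
      ((measurableSet_le measurable_const mabs).inter mJ.compl) (by
        intro ω hω
        have h1 : H ≤ |V ω - 1| := hω.1
        rw [one_mul]; exact h1) (by
        intro ω hω
        rw [fam2_prod (fun k => X k ω) (hJc ω hω.2), zero_mul])
    refine h.trans ?_
    rw [one_mul, one_mul, mul_comm]
    refine mul_le_mul hr (Real.exp_le_exp.2 ?_) (Real.exp_pos _).le (by positivity)
    rw [abs_zero]
    have : KK * e ≤ KK * R := by
      refine mul_le_mul_of_nonneg_left ?_ (by linarith)
      rw [hRdef]; linarith
    linarith
  have P3 : P.real J ≤ e := D.big_jump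
  have hsub : {ω | x * Real.sqrt (V ω) ≤ S ω} ⊆ E1 ∪ (E2 ∪ J) := by
    intro ω hω
    by_cases h3 : ω ∈ J
    · exact Or.inr (Or.inr h3)
    by_cases h1 : |V ω - 1| ≤ H
    · exact Or.inl ⟨hω, h1, h3⟩
    · exact Or.inr (Or.inl ⟨(not_le.1 h1).le, h3⟩)
  have hfin := exp_combine (C1 := C * (1 + 20000 * KK ^ 2)) (C3 := 6 + KK) (c2 := 1440 * KK) hp.le
    (by positivity) (by positivity) (by positivity) hR0 hTR
  refine le_trans ?_ hfin
  have u1 := measureReal_mono (μ := P) hsub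
  have u2 := measureReal_union_le (μ := P) E1 (E2 ∪ J)
  have u3 := measureReal_union_le (μ := P) E2 J
  have hex : 1 ≤ Real.exp ((6 + KK) * R) := Real.one_le_exp (by positivity)
  have v1 : e ≤ KK * T * Real.exp ((6 + KK) * R) := by
    calc e ≤ 1 * T * 1 := by linarith
      _ ≤ _ := by gcongr
  have v0 : 0 ≤ KK * T * Real.exp ((6 + KK) * R) := by positivity
  have v2 : 9 * (KK * T * Real.exp ((6 + KK) * R)) ≤ p * (1440 * KK * T) * Real.exp ((6 + KK) * R) := by
    have : 9 * (KK * T * Real.exp ((6 + KK) * R)) * 1 ≤ 9 * (KK * T * Real.exp ((6 + KK) * R)) * (60 * p) := by gcongr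
    have w : 0 ≤ p * (KK * T * Real.exp ((6 + KK) * R)) := by positivity
    linarith
  linarith

end TD

theorem core (ρ : ℝ) (hρ : 0 < ρ) (hρ' : ρ < 1) :
    ∃ C c0 : ℝ, 0 < C ∧ 0 < c0 ∧ c0 ≤ 1 ∧ ∀ {Ω : Type} [mΩ : MeasurableSpace Ω] {P : Measure Ω}
      [IsProbabilityMeasure P] {n : ℕ} {F : ℕ → MeasurableSpace Ω} {X : ℕ → Ω → ℝ}
      {γ e δ x : ℝ} (_ : TD P n F X ρ γ e 1 δ), 0 < e → e ≤ 2 * γ ^ ρ → 0 ≤ δ → δ ≤ 1 / 4 → 0 ≤ x →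
      max x 1 * γ ≤ c0 →
      P.real {ω | x * Real.sqrt (∑ k ∈ Finset.range n, X k ω ^ 2) ≤ ∑ k ∈ Finset.range n, X k ω} ≤
      (1 - stdNormalCDF x) * Real.exp (C * RR ρ (max x 1) γ e δ) := by
  obtain ⟨C, g1, hC, hg1, main⟩ := main_lemma ρ hρ hρ' KK KK_ge
  have hK := KK_ge
  refine ⟨C * (1 + 20000 * KK ^ 2) + (6 + KK) + 1440 * KK,
    min (min g1 (1 / (2 * (6 + KK)))) (min ((1 / (136 * KK)) ^ (1 / ρ)) 1), by positivity,
    lt_min (lt_min hg1 (by positivity)) (lt_min (by positivity) one_pos),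
    (min_le_right _ _).trans (min_le_right _ _), ?_⟩
  intro Ω mΩ P _ n F X γ e δ x D he heγ hδ hδ' hx hs
  have hγ := D.g_pos
  set s := max x 1 with hsdef
  have hs1 : 1 ≤ s := le_max_right _ _
  have hs0 : 0 < s := by linarith
  have a1 : s * γ ≤ g1 := hs.trans ((min_le_left _ _).trans (min_le_left _ _))
  have a2 : s * γ ≤ 1 / (2 * (6 + KK)) := hs.trans ((min_le_left _ _).trans (min_le_right _ _))
  have a3 : s * γ ≤ (1 / (136 * KK)) ^ (1 / ρ) := hs.trans ((min_le_right _ _).trans (min_le_left _ _))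
  have a4 : s * γ ≤ 1 := hs.trans ((min_le_right _ _).trans (min_le_right _ _))
  have hsγ : 0 < s * γ := by positivity
  have b2 : (6 + KK) * (s * γ) ^ 2 ≤ 1 / 2 := by
    rw [le_div_iff₀ (by positivity)] at a2
    nlinarith
  have b3 : 68 * KK * (s ^ ρ * e) ≤ 1 := by
    have c1 : (s * γ) ^ ρ ≤ 1 / (136 * KK) := by
      calc (s * γ) ^ ρ ≤ ((1 / (136 * KK)) ^ (1 / ρ)) ^ ρ := Real.rpow_le_rpow hsγ.le a3 hρ.le
        _ = 1 / (136 * KK) := by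
          rw [← Real.rpow_mul (by positivity), one_div_mul_cancel hρ.ne', Real.rpow_one]
    rw [Real.mul_rpow hs0.le hγ.le, le_div_iff₀ (by positivity)] at c1
    have c2 : s ^ ρ * e ≤ s ^ ρ * (2 * γ ^ ρ) := by gcongr
    have c3 : KK * (s ^ ρ * e) ≤ KK * (s ^ ρ * (2 * γ ^ ρ)) := by gcongr
    linarith
  rcases le_total 1 x with h1 | h1
  · have es : s = x := max_eq_left h1
    rw [es] at a1 a4 b2 b3 ⊢
    exact D.core_big hC main he h1 a4 a1 b2 b3 hδ hδ'
  · have es : s = 1 := max_eq_right h1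
    rw [es] at a1 a4 b2 b3 ⊢
    rw [one_mul] at a1 b2
    rw [Real.one_rpow, one_mul] at b3
    exact D.core_small hC main he hx h1 a1 b2 b3 hδ hδ'
end SNC


set_option linter.unusedSectionVars false
set_option linter.unusedVariables false
namespace SNC
open MeasureTheory Filter ProbabilityTheory
open scoped Topology ENNReal NNReal

/-- full error term -/
noncomputable def RF (ρ x ε γ δ : ℝ) : ℝ :=
  x ^ (2 + ρ) * ε ^ ρ + x ^ 2 * δ ^ 2 + (1 + x) * (x ^ ρ * γ ^ ρ + γ ^ ρ + δ +
    ε ^ (ρ * (2 - ρ) / 4) / (1 + x ^ (ρ * (2 + ρ) / 4)))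

lemma sqrt_pow_eq {ρ ε : ℝ} (hε : 0 < ε) : (ε ^ ρ) ^ (1 / 2 : ℝ) = ε ^ (ρ / 2) := by
  rw [← Real.rpow_mul hε.le]; congr 1; ring

lemma amgm_step {ρ x ε : ℝ} (hρ : 0 < ρ) (hρ' : ρ < 1) (hx : 1 ≤ x) (hε : 0 < ε) :
    x ^ ((1 + ρ) / 2) * ε ^ (ρ / 2) ≤ x ^ (2 + ρ) * ε ^ ρ +
      x ^ (1 - ρ * (2 + ρ) / 4) * ε ^ (ρ * (2 - ρ) / 4) := by
  have hx0 : 0 < x := by linarith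
  have h2 : 0 < 2 + ρ := by linarith
  set A := x ^ (2 + ρ) * ε ^ ρ with hA
  set B := x ^ (1 - ρ * (2 + ρ) / 4) * ε ^ (ρ * (2 - ρ) / 4) with hB
  have hA0 : 0 ≤ A := by positivity
  have hB0 : 0 ≤ B := by positivity
  have h := Real.geom_mean_le_arith_mean2_weighted (w₁ := ρ / (2 + ρ)) (w₂ := 2 / (2 + ρ))
    (by positivity) (by positivity) hA0 hB0 (by field_simp; ring)
  have h1 : ρ / (2 + ρ) * A ≤ A := mul_le_of_le_one_left hA0 (by rw [div_le_one h2]; linarith)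
  have h3 : 2 / (2 + ρ) * B ≤ B := mul_le_of_le_one_left hB0 (by rw [div_le_one h2]; linarith)
  have e : A ^ (ρ / (2 + ρ)) * B ^ (2 / (2 + ρ)) = x ^ (ρ / 2 + 2 / (2 + ρ)) * ε ^ (ρ / 2) := by
    rw [hA, hB, Real.mul_rpow (by positivity) (by positivity), Real.mul_rpow (by positivity) (by positivity),
      ← Real.rpow_mul hx0.le, ← Real.rpow_mul hx0.le, ← Real.rpow_mul hε.le, ← Real.rpow_mul hε.le]
    calc _ = (x ^ ((2 + ρ) * (ρ / (2 + ρ))) * x ^ ((1 - ρ * (2 + ρ) / 4) * (2 / (2 + ρ)))) *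
        (ε ^ (ρ * (ρ / (2 + ρ))) * ε ^ (ρ * (2 - ρ) / 4 * (2 / (2 + ρ)))) := by ring
      _ = _ := by
        rw [← Real.rpow_add hx0, ← Real.rpow_add hε]
        congr 2
        · field_simp; ring
        · field_simp; ring
  have h4 : x ^ ((1 + ρ) / 2) ≤ x ^ (ρ / 2 + 2 / (2 + ρ)) := by
    refine Real.rpow_le_rpow_of_exponent_le hx ?_
    have : 1 / 2 ≤ 2 / (2 + ρ) := by rw [div_le_div_iff₀ (by norm_num) h2]; linarith
    linarith
  calc x ^ ((1 + ρ) / 2) * ε ^ (ρ / 2) ≤ x ^ (ρ / 2 + 2 / (2 + ρ)) * ε ^ (ρ / 2) := by gcongr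
    _ ≤ A + B := by rw [← e]; linarith

lemma RR_le {ρ x ε γ δ : ℝ} (hρ : 0 < ρ) (hρ' : ρ < 1) (hx : 0 ≤ x) (hε : 0 < ε) (hε' : ε ≤ 1 / 4)
    (hγ : 0 < γ) (hδ : 0 ≤ δ) (hδ' : δ ≤ 1 / 4) :
    RR ρ (max x 1) γ (min (ε ^ ρ) (2 * γ ^ ρ)) δ ≤ 3 * RF ρ x ε γ δ := by
  set e := min (ε ^ ρ) (2 * γ ^ ρ) with he
  have he0 : 0 < e := lt_min (by positivity) (by positivity)
  have he1 : e ≤ ε ^ ρ := min_le_left _ _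
  have he2 : e ≤ 2 * γ ^ ρ := min_le_right _ _
  have he3 : e ^ (1 / 2 : ℝ) ≤ ε ^ (ρ / 2) := by
    rw [← sqrt_pow_eq hε]; exact Real.rpow_le_rpow he0.le he1 (by norm_num)
  unfold RF
  set κ := ρ * (2 + ρ) / 4 with hκ
  have hκ0 : 0 < κ := by positivity
  set E := ε ^ (ρ * (2 - ρ) / 4) with hE
  have hE0 : 0 < E := by positivity
  have hxκ : 0 ≤ x ^ κ := by positivity
  set G := E / (1 + x ^ κ) with hG
  have hG0 : 0 < G := by positivity
  have p1 : 0 ≤ x ^ (2 + ρ) * ε ^ ρ := by positivity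
  have p2 : 0 ≤ x ^ 2 * δ ^ 2 := by positivity
  have p3 : 0 ≤ x ^ ρ * γ ^ ρ := by positivity
  have p4 : 0 < γ ^ ρ := by positivity
  rcases le_total 1 x with h1 | h1
  · rw [max_eq_left h1, RR]
    have hx0 : 0 < x := by linarith
    have a1 : x ^ (2 + ρ) * e ≤ x ^ (2 + ρ) * ε ^ ρ := by gcongr
    have a2 : x ^ ((1 + ρ) / 2) * e ^ (1 / 2 : ℝ) ≤ x ^ ((1 + ρ) / 2) * ε ^ (ρ / 2) := by gcongr
    have a3 := amgm_step hρ hρ' h1 hε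
    have a4 : x ^ (1 - ρ * (2 + ρ) / 4) * ε ^ (ρ * (2 - ρ) / 4) ≤ 2 * (x * G) := by
      have b1 : 1 ≤ x ^ κ := Real.one_le_rpow h1 hκ0.le
      have b2 : x ^ (1 - ρ * (2 + ρ) / 4) = x / x ^ κ := by
        rw [Real.rpow_sub hx0, Real.rpow_one]
      rw [b2, hG]
      have b3 : E / x ^ κ ≤ 2 * (E / (1 + x ^ κ)) := by
        rw [div_le_iff₀ (by linarith), mul_comm, ← mul_assoc, ← mul_div_assoc, le_div_iff₀ (by linarith)]
        nlinarith
      calc x / x ^ κ * E = x * (E / x ^ κ) := by ring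
        _ ≤ x * (2 * (E / (1 + x ^ κ))) := by gcongr
        _ = _ := by ring
    rw [Real.mul_rpow hx hγ.le]
    have q1 : 0 ≤ x * G := by positivity
    have q2 : 0 ≤ x * (x ^ ρ * γ ^ ρ) := by positivity
    have q3 : 0 ≤ x * γ ^ ρ := by positivity
    have q4 : 0 ≤ x * δ := by positivity
    have ex : (1 + x) * (x ^ ρ * γ ^ ρ + γ ^ ρ + δ + G) = x ^ ρ * γ ^ ρ + γ ^ ρ + δ + G +
      (x * (x ^ ρ * γ ^ ρ) + x * γ ^ ρ + x * δ + x * G) := by ring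
    rw [ex, mul_add x]
    linarith
  · rw [max_eq_right h1, RR]
    simp only [Real.one_rpow, one_pow, one_mul]
    have a1 : ε ^ (ρ / 2) ≤ E := Real.rpow_le_rpow_of_exponent_ge hε (by linarith) (by nlinarith)
    have a2 : x ^ κ ≤ 1 := Real.rpow_le_one hx h1 hκ0.le
    have a3 : E ≤ 2 * G := by
      rw [hG, ← mul_div_assoc, le_div_iff₀ (by linarith)]; nlinarith
    have a4 : δ ^ 2 ≤ δ := by nlinarith
    have a5 : x ^ ρ * γ ^ ρ + γ ^ ρ + δ + G ≤ (1 + x) * (x ^ ρ * γ ^ ρ + γ ^ ρ + δ + G) :=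
      le_mul_of_one_le_left (by positivity) (by linarith)
    linarith

lemma sum_Icc_shift (f : ℕ → ℝ) (n : ℕ) : ∑ i ∈ Finset.Icc 1 n, f i = ∑ k ∈ Finset.range n, f (k + 1) := by
  induction n with
  | zero => simp
  | succ m ih => rw [Finset.sum_Icc_succ_top (by omega), ih, Finset.sum_range_succ]

lemma Bsq_pos {Ω : Type} [mΩ : MeasurableSpace Ω] {P : Measure Ω} (A : MDS Ω P) : 0 < A.Bsq := by
  unfold MDS.Bsq
  refine Finset.sum_pos (fun i hi => ?_) ⟨1, Finset.mem_Icc.2 ⟨le_rfl, A.npos⟩⟩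
  rw [Finset.mem_Icc] at hi
  exact A.var_pos i hi.1 hi.2

lemma toTD {Ω : Type} [mΩ : MeasurableSpace Ω] {P : Measure Ω} [IsProbabilityMeasure P] (A : MDS Ω P)
    {ρ ε γ δ : ℝ} (hρ : 0 < ρ) (hρ' : ρ < 1) (h1 : A.CondA1 δ) (h2 : A.CondA2 ρ ε) (h4 : A.CondA4 ρ γ) :
    TD P A.n A.F (fun k ω => (Real.sqrt A.Bsq)⁻¹ * A.X (k + 1) ω) ρ γ (min (ε ^ ρ) (2 * γ ^ ρ)) 1 δ := by
  have hB := Bsq_pos A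
  set B := Real.sqrt A.Bsq with hBdef
  have hB0 : 0 < B := Real.sqrt_pos.2 hB
  have hB2 : B ^ 2 = A.Bsq := Real.sq_sqrt hB.le
  have hBi : 0 < B⁻¹ := by positivity
  obtain ⟨hδ, hδ', h1⟩ := h1
  obtain ⟨hε, hε', h2i, h2⟩ := h2
  obtain ⟨hγ, hγ', h4i, h4⟩ := h4
  set U : ℕ → Ω → ℝ := fun k ω => A.X (k + 1) ω with hU
  have hv : ∀ k, vv P A.F U k = P[fun ω' => (A.X (k + 1) ω') ^ 2|A.F (k + 1 - 1)] := fun k => by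
    rw [Nat.add_sub_cancel]; rfl
  have hb : ∀ k, bb P A.F U ρ k = P[fun ω' => |A.X (k + 1) ω'| ^ (2 + ρ)|A.F (k + 1 - 1)] := fun k => by
    rw [Nat.add_sub_cancel]; rfl
  have sv := fun k => TD.vv_scale (P := P) (F := A.F) (U := U) B⁻¹ k
  have sb := fun k => TD.bb_scale (P := P) (F := A.F) (U := U) (ρ := ρ) hBi k
  have hBr : B⁻¹ ^ (2 + ρ) = (B⁻¹) ^ 2 * B⁻¹ ^ ρ := rpow_two_add hBi
  have bet : ∀ k, k < A.n → ∀ᵐ ω ∂P, bb P A.F (fun k ω => B⁻¹ * U k ω) ρ k ω ≤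
      γ ^ ρ * vv P A.F (fun k ω => B⁻¹ * U k ω) k ω := by
    intro k hk
    filter_upwards [sv k, sb k, h4 (k + 1) (by omega) (by omega)] with ω e1 e2 e3
    rw [e1, e2, hv, hb]
    refine (mul_le_mul_of_nonneg_left e3 (by positivity)).trans (le_of_eq ?_)
    rw [hBr, Real.mul_rpow hγ.le hB0.le]
    have : B⁻¹ ^ ρ * B ^ ρ = 1 := by
      rw [← Real.mul_rpow hBi.le hB0.le, inv_mul_cancel₀ hB0.ne', Real.one_rpow]
    linear_combination (B⁻¹ ^ 2 * γ ^ ρ * (P[fun ω' => (A.X (k + 1) ω') ^ 2|A.F (k + 1 - 1)]) ω) * this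
  have asv : ∀ᵐ ω ∂P, ∀ k, vv P A.F (fun k ω => B⁻¹ * U k ω) k ω = B⁻¹ ^ 2 * vv P A.F U k ω := ae_all_iff.2 sv
  have asb : ∀ᵐ ω ∂P, ∀ k, bb P A.F (fun k ω => B⁻¹ * U k ω) ρ k ω = B⁻¹ ^ (2 + ρ) * bb P A.F U ρ k ω := ae_all_iff.2 sb
  have var : ∀ᵐ ω ∂P, |∑ k ∈ Finset.range A.n, vv P A.F (fun k ω => B⁻¹ * U k ω) k ω - 1| ≤ 1 * δ ^ 2 := by
    filter_upwards [asv, h1] with ω e1 e2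
    rw [Finset.sum_congr rfl fun k _ => e1 k, ← Finset.mul_sum, one_mul]
    have e3 : A.CV ω = ∑ k ∈ Finset.range A.n, vv P A.F U k ω := by
      unfold MDS.CV
      rw [sum_Icc_shift]
      exact Finset.sum_congr rfl fun k _ => by rw [hv]
    rw [← e3]
    have e4 : B⁻¹ ^ 2 * A.CV ω - 1 = A.Bsq⁻¹ * (A.CV ω - A.Bsq) := by
      rw [inv_pow, hB2]; field_simp
    rw [e4, abs_mul, abs_of_pos (by positivity)]
    calc A.Bsq⁻¹ * |A.CV ω - A.Bsq| ≤ A.Bsq⁻¹ * (δ ^ 2 * A.Bsq) := by gcongr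
      _ = δ ^ 2 := by field_simp
  refine ⟨hρ, hρ', hγ, by linarith, A.F_mono, A.F_le, ?_, ?_, ?_, bet, ?_, var⟩
  · intro k hk
    exact ((A.meas (k + 1) (by omega) (by omega)).measurable).const_mul _
  · intro k hk
    have := (h2i (k + 1) (by omega) (by omega)).const_mul (B⁻¹ ^ (2 + ρ))
    refine this.congr (ae_of_all _ fun ω => ?_)
    beta_reduce
    rw [abs_mul, abs_of_pos hBi, Real.mul_rpow hBi.le (abs_nonneg _)]
  · intro k hk
    have h := condExp_smul (B⁻¹) (A.X (k + 1)) (A.F k) (μ := P)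
    have hm := A.mean_zero (k + 1) (by omega) (by omega)
    rw [Nat.add_sub_cancel] at hm
    have e : (fun ω => B⁻¹ * A.X (k + 1) ω) = B⁻¹ • A.X (k + 1) := rfl
    rw [e]
    filter_upwards [h, hm] with ω u1 u2
    rw [u1, Pi.smul_apply, u2]; simp
  · have bet' : ∀ᵐ ω ∂P, ∀ k ∈ Finset.range A.n, bb P A.F (fun k ω => B⁻¹ * U k ω) ρ k ω ≤
        γ ^ ρ * vv P A.F (fun k ω => B⁻¹ * U k ω) k ω := by
      rw [Filter.eventually_all_finset]
      exact fun k hk => bet k (Finset.mem_range.1 hk)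
    filter_upwards [asb, h2, var, bet'] with ω e1 e2 e3 e4
    refine le_min ?_ ?_
    · rw [Finset.sum_congr rfl fun k _ => e1 k, ← Finset.mul_sum]
      rw [sum_Icc_shift] at e2
      rw [Finset.sum_congr rfl fun k _ => congrFun (hb k) ω]
      refine (mul_le_mul_of_nonneg_left e2 (by positivity)).trans (le_of_eq ?_)
      have : A.Bsq ^ ((2 + ρ) / 2) = B ^ (2 + ρ) := by
        rw [hBdef, Real.sqrt_eq_rpow, ← Real.rpow_mul hB.le]; congr 1; ring
      rw [this, mul_left_comm, ← Real.mul_rpow hBi.le hB0.le, inv_mul_cancel₀ hB0.ne', Real.one_rpow, mul_one]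
    · refine (Finset.sum_le_sum e4).trans ?_
      rw [← Finset.mul_sum, mul_comm]
      refine mul_le_mul_of_nonneg_right ?_ (by positivity)
      have := (abs_le.1 e3).2
      nlinarith

lemma W_sub {Ω : Type} [mΩ : MeasurableSpace Ω] {P : Measure Ω} (A : MDS Ω P) {x : ℝ} :
    {ω | x ≤ A.W ω} ⊆ {ω | x * Real.sqrt (∑ k ∈ Finset.range A.n, ((Real.sqrt A.Bsq)⁻¹ * A.X (k + 1) ω) ^ 2)
      ≤ ∑ k ∈ Finset.range A.n, (Real.sqrt A.Bsq)⁻¹ * A.X (k + 1) ω} := by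
  intro ω hω
  have hB := Real.sqrt_pos.2 (Bsq_pos A)
  set b := (Real.sqrt A.Bsq)⁻¹ with hb
  have hb0 : 0 < b := by positivity
  have h : x ≤ A.S ω / Real.sqrt (A.QV ω) := hω
  have hq : A.QV ω = ∑ k ∈ Finset.range A.n, A.X (k + 1) ω ^ 2 := sum_Icc_shift _ _
  have hs : A.S ω = ∑ k ∈ Finset.range A.n, A.X (k + 1) ω := sum_Icc_shift _ _
  have hv := TD.VS_scale (n := A.n) b fun k => A.X (k + 1) ω
  change x * Real.sqrt (∑ k ∈ Finset.range A.n, (b * A.X (k + 1) ω) ^ 2) ≤ ∑ k ∈ Finset.range A.n, b * A.X (k + 1) ω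
  rw [hv.1, hv.2, ← hq, ← hs, Real.sqrt_mul (sq_nonneg b), Real.sqrt_sq hb0.le, mul_left_comm]
  refine mul_le_mul_of_nonneg_left ?_ hb0.le
  have hq0 : 0 ≤ A.QV ω := by rw [hq]; exact Finset.sum_nonneg fun k _ => sq_nonneg _
  rcases hq0.eq_or_lt with h0 | h0
  · have : A.S ω = 0 := by
      rw [hs]
      refine Finset.sum_eq_zero fun k hk => ?_
      rw [hq] at h0
      exact pow_eq_zero_iff (two_ne_zero) |>.1 ((Finset.sum_eq_zero_iff_of_nonneg fun k _ => sq_nonneg _).1 h0.symm k hk)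
    rw [← h0, this]; simp
  · rwa [le_div_iff₀ (Real.sqrt_pos.2 h0)] at h

theorem one_sided (ρ : ℝ) (hρ : 0 < ρ) (hρ' : ρ < 1) :
    ∃ c c0 : ℝ, 0 < c ∧ 0 < c0 ∧ ∀ {Ω : Type} [mΩ : MeasurableSpace Ω] {P : Measure Ω}
      [IsProbabilityMeasure P] (A : MDS Ω P) {γ ε δ x : ℝ}, A.CondA1 δ → A.CondA2 ρ ε → A.CondA4 ρ γ →
      0 ≤ x → x * γ ≤ c0 →
      P.real {ω | x ≤ A.W ω} / (1 - stdNormalCDF x) ≤ Real.exp (c * RF ρ x ε γ δ) := by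
  obtain ⟨C, c0, hC, hc0, hc1, hcore⟩ := core ρ hρ hρ'
  refine ⟨3 * C + 60 / c0 ^ ρ, c0, by positivity, hc0, ?_⟩
  intro Ω mΩ P _ A γ ε δ x h1 h2 h4 hx hxγ
  have D := toTD A hρ hρ' h1 h2 h4
  obtain ⟨hδ, hδ', -⟩ := h1
  obtain ⟨hε, hε', -⟩ := h2
  obtain ⟨hγ, hγ', -⟩ := h4
  have hp := one_sub_cdf_pos x
  have hRlow : γ ^ ρ ≤ RF ρ x ε γ δ := by
    unfold RF
    have q1 : 0 ≤ x ^ (2 + ρ) * ε ^ ρ + x ^ 2 * δ ^ 2 := by positivity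
    have q2 : 0 ≤ x ^ ρ * γ ^ ρ + δ + ε ^ (ρ * (2 - ρ) / 4) / (1 + x ^ (ρ * (2 + ρ) / 4)) := by positivity
    have q3 : 0 < γ ^ ρ := by positivity
    nlinarith [mul_nonneg hx q2, mul_nonneg hx q3.le]
  have hR0 : 0 ≤ RF ρ x ε γ δ := le_trans (by positivity) hRlow
  rw [div_le_iff₀ hp, mul_comm]
  by_cases hm : max x 1 * γ ≤ c0
  · have h := hcore D (lt_min (by positivity) (by positivity)) (min_le_right _ _) hδ hδ' hx hm
    refine (measureReal_mono (W_sub A)).trans (h.trans ?_)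
    refine mul_le_mul_of_nonneg_left (Real.exp_le_exp.2 ?_) hp.le
    have hr := RR_le (ρ := ρ) hρ hρ' hx hε hε' hγ hδ hδ'
    have : C * RR ρ (max x 1) γ (min (ε ^ ρ) (2 * γ ^ ρ)) δ ≤ C * (3 * RF ρ x ε γ δ) := by gcongr
    have h0 : 0 ≤ 60 / c0 ^ ρ * RF ρ x ε γ δ := by positivity
    linarith
  · have hx1 : x ≤ 1 := by
      by_contra hc
      rw [max_eq_left (not_le.1 hc).le] at hm
      exact hm hxγ
    rw [max_eq_right hx1, one_mul, not_le] at hm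
    have h60 := cdf_lower_small hx hx1
    have h3 : c0 ^ ρ ≤ γ ^ ρ := Real.rpow_le_rpow hc0.le hm.le hρ.le
    have hcp : 0 < c0 ^ ρ := by positivity
    have h5 : 60 ≤ (3 * C + 60 / c0 ^ ρ) * RF ρ x ε γ δ := by
      have u1 : 60 / c0 ^ ρ * c0 ^ ρ ≤ 60 / c0 ^ ρ * RF ρ x ε γ δ := by
        gcongr; exact h3.trans hRlow
      rw [div_mul_cancel₀ _ hcp.ne'] at u1
      have : 0 ≤ 3 * C * RF ρ x ε γ δ := by positivity
      linarith
    have h6 : 60 ≤ Real.exp ((3 * C + 60 / c0 ^ ρ) * RF ρ x ε γ δ) := by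
      linarith [Real.add_one_le_exp ((3 * C + 60 / c0 ^ ρ) * RF ρ x ε γ δ)]
    calc P.real {ω | x ≤ A.W ω} ≤ 1 := measureReal_le_one
      _ ≤ (1 - stdNormalCDF x) * 60 := by linarith
      _ ≤ _ := by gcongr

/-- the negated sequence -/
def negMDS {Ω : Type} [mΩ : MeasurableSpace Ω] {P : Measure Ω} (A : MDS Ω P) : MDS Ω P where
  n := A.n
  npos := A.npos
  F := A.F
  F_mono := A.F_mono
  F_le := A.F_le
  F_zero := A.F_zero
  X := fun i ω => -A.X i ω
  meas i h1 h2 := (A.meas i h1 h2).neg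
  sq_int i h1 h2 := by simp only [neg_sq]; exact A.sq_int i h1 h2
  mean_zero i h1 h2 := by
    have h := condExp_neg (A.X i) (A.F (i - 1)) (μ := P)
    filter_upwards [h, A.mean_zero i h1 h2] with ω u1 u2
    have e : (fun ω => -A.X i ω) = -A.X i := rfl
    rw [e, u1, Pi.neg_apply, u2]; simp
  var_pos i h1 h2 := by simp only [neg_sq]; exact A.var_pos i h1 h2

section
variable {Ω : Type} [mΩ : MeasurableSpace Ω] {P : Measure Ω} (A : MDS Ω P)

lemma neg_Bsq : (negMDS A).Bsq = A.Bsq := by simp [MDS.Bsq, negMDS]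
lemma neg_QV : (negMDS A).QV = A.QV := by funext ω; simp [MDS.QV, negMDS]
lemma neg_CV : (negMDS A).CV = A.CV := by funext ω; simp [MDS.CV, negMDS]
lemma neg_S (ω : Ω) : (negMDS A).S ω = -A.S ω := by simp [MDS.S, negMDS]
lemma neg_W (ω : Ω) : (negMDS A).W ω = -A.W ω := by
  simp only [MDS.W, neg_S, neg_QV, neg_div]

lemma neg_A1 {δ : ℝ} (h : A.CondA1 δ) : (negMDS A).CondA1 δ := by
  unfold MDS.CondA1; rw [neg_CV, neg_Bsq]; exact h
lemma neg_A2 {ρ ε : ℝ} (h : A.CondA2 ρ ε) : (negMDS A).CondA2 ρ ε := by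
  unfold MDS.CondA2; rw [neg_Bsq]; simp only [negMDS, abs_neg]; exact h
lemma neg_A4 {ρ γ : ℝ} (h : A.CondA4 ρ γ) : (negMDS A).CondA4 ρ γ := by
  unfold MDS.CondA4; rw [neg_Bsq]; simp only [negMDS, abs_neg, neg_sq]; exact h
end
end SNC




/-- Theorem 2.3 [i]: upper bound under (A1), (A2), (A4), for `ρ ∈ (0,1)`. -/
theorem upper_bound_A1A2A4_rho_lt_one (ρ : ℝ) (hρ : 0 < ρ) (hρ' : ρ < 1) :
    ∃ c : ℝ, 0 < c ∧
      ∀ (Ω : Type) [MeasurableSpace Ω] (P : Measure Ω), IsProbabilityMeasure P →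
        ∀ (A : ℕ → MDS Ω P) (δ ε γ x : ℕ → ℝ),
          (∀ n, (A n).CondA1 (δ n)) →
          (∀ n, (A n).CondA2 ρ (ε n)) →
          (∀ n, (A n).CondA4 ρ (γ n)) →
          (∀ n, 0 ≤ x n) →
          Tendsto (fun n => x n * γ n) atTop (nhds 0) →
          ∀ᶠ n in atTop,
            (P {ω | x n ≤ (A n).W ω}).toReal / (1 - stdNormalCDF (x n)) ≤
                Real.exp (c * (x n ^ (2 + ρ) * ε n ^ ρ + x n ^ 2 * δ n ^ 2 + (1 + x n) * (x n ^ ρ * γ n ^ ρ + γ n ^ ρ + δ n + ε n ^ (ρ * (2 - ρ) / 4) / (1 + x n ^ (ρ * (2 + ρ) / 4))))) ∧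
              (P {ω | (A n).W ω ≤ -x n}).toReal / stdNormalCDF (-x n) ≤
                Real.exp (c * (x n ^ (2 + ρ) * ε n ^ ρ + x n ^ 2 * δ n ^ 2 + (1 + x n) * (x n ^ ρ * γ n ^ ρ + γ n ^ ρ + δ n + ε n ^ (ρ * (2 - ρ) / 4) / (1 + x n ^ (ρ * (2 + ρ) / 4))))) := by
  obtain ⟨c, c0, hc, hc0, h⟩ := SNC.one_sided ρ hρ hρ'
  refine ⟨c, hc, ?_⟩
  intro Ω _ P _ A δ ε γ x h1 h2 h4 hx hlim
  filter_upwards [hlim.eventually (ge_mem_nhds hc0)] with n hn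
  refine ⟨h (A n) (h1 n) (h2 n) (h4 n) (hx n) hn, ?_⟩
  have h' := h (SNC.negMDS (A n)) (SNC.neg_A1 _ (h1 n)) (SNC.neg_A2 _ (h2 n)) (SNC.neg_A4 _ (h4 n)) (hx n) hn
  have e : {ω | (A n).W ω ≤ -x n} = {ω | x n ≤ (SNC.negMDS (A n)).W ω} := by
    ext ω
    rw [Set.mem_ofPred_eq, Set.mem_ofPred_eq, SNC.neg_W]
    exact ⟨fun h => by linarith, fun h => by linarith⟩
  rw [e, SNC.cdf_neg]
  exact h'
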